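/- Let n ≥ 2, 1 < p ≤ 2 and λ > 1. Then for any compact time interval I there is a constant C such that for every Schwartz function f on ℝ^n, ‖(∫_I |∫_{ℝ^n} e^{ix·ξ} f̂(ξ) e^{it|ξ|^λ} dξ|² dt)^{1/2}‖_{L^p(ℝ^n)} ≤ C ‖f‖_{W^{β,p}(ℝ^n)}, where β/λ = n(1/p − 1/2). -/

import Mathlib

open MeasureTheory Filter Set Metric
open scoped ENNReal NNReal RealInnerProductSpace Topology

noncomputable section

/-- Euclidean space ℝ^n. -/
abbrev En (n : ℕ) := EuclideanSpace ℝ (Fin n)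

/-- The Fourier transform f̂(ξ) = ∫ e^{-ix·ξ} f(x) dx. -/
def ftP (n : ℕ) (f : En n → ℂ) (ξ : En n) : ℂ :=
  ∫ x : En n, Complex.exp (-Complex.I * ((⟪x, ξ⟫ : ℝ) : ℂ)) * f x

/-- The oscillatory integral ∫ e^{ix·ξ} f̂(ξ) e^{it|ξ|^γ} dξ. -/
def waveExt (n : ℕ) (γ : ℝ) (f : En n → ℂ) (x : En n) (t : ℝ) : ℂ :=
  ∫ ξ : En n,
    Complex.exp (Complex.I * (((⟪x, ξ⟫ : ℝ) : ℂ) + (t : ℂ) * ((‖ξ‖ ^ γ : ℝ) : ℂ))) * ftP n f ξ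

/-- The Bessel potential (fractional Sobolev) norm ‖f‖_{W^{s,p}} = ‖(I−Δ)^{s/2} f‖_{L^p},
computed on the Fourier side: (I−Δ)^{s/2}f = (2π)^{-n} ∫ e^{ix·ξ} (1+|ξ|²)^{s/2} f̂(ξ) dξ. -/
def besselNorm (n : ℕ) (s p : ℝ) (f : En n → ℂ) : ℝ≥0∞ :=
  eLpNorm
    (fun x : En n =>
      ((2 * Real.pi) ^ n)⁻¹ •
        ∫ ξ : En n,
          Complex.exp (Complex.I * ((⟪x, ξ⟫ : ℝ) : ℂ)) *
            (((1 + ‖ξ‖ ^ 2) ^ (s / 2) : ℝ) : ℂ) * ftP n f ξ)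
    (ENNReal.ofReal p) volume

open FourierTransform SchwartzMap in
theorem lintegral_enorm_fourier_sq {n : ℕ} {h : En n → ℂ} (h1 : Integrable h)
    (h2 : MemLp h 2 volume) :
    ∫⁻ ξ, ‖𝓕 h ξ‖ₑ ^ 2 = ∫⁻ x, ‖h x‖ₑ ^ 2 := by
  set H : Lp ℂ 2 (volume : Measure (En n)) := h2.toLp h with hH
  have hcont : Continuous (𝓕 h) :=
    VectorFourier.fourierIntegral_continuous Real.continuous_fourierChar
      continuous_inner h1
  have hae : ∀ᵐ ξ, 𝓕 h ξ = (𝓕 H : Lp ℂ 2 (volume : Measure (En n))) ξ := by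
    refine ae_eq_of_integral_contDiff_smul_eq hcont.locallyIntegrable
      ((Lp.memLp _).locallyIntegrable (by norm_num)) ?_
    intro g hg hgc
    have hgC : ContDiff ℝ (⊤ : ℕ∞) (fun x => (g x : ℂ)) := Complex.ofRealCLM.contDiff.comp hg
    have hgs : HasCompactSupport (fun x => (g x : ℂ)) :=
      hgc.comp_left (g := fun r : ℝ => (r : ℂ)) (by simp)
    set ψ : 𝓢(En n, ℂ) := hgs.toSchwartzMap hgC
    have hψ : ∀ x, ψ x = g x := fun x => rfl
    have e1 : ∫ x, ψ x • (𝓕 H : Lp ℂ 2 (volume : Measure (En n))) x = ∫ x, (𝓕 ψ) x • H x := by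
      rw [← Lp.toTemperedDistribution_apply, ← Lp.toTemperedDistribution_apply,
        ← Lp.fourier_toTemperedDistribution_eq, TemperedDistribution.fourier_apply]
    have e2 : ∫ x, (𝓕 ψ) x • H x = ∫ x, (𝓕 ψ) x • h x := by
      refine integral_congr_ae ?_
      filter_upwards [h2.coeFn_toLp] with x hx
      rw [hH, hx]
    have e3 : ∫ x, (𝓕 ψ) x • h x = ∫ x, ψ x • 𝓕 h x := by
      have := VectorFourier.integral_fourierIntegral_smul_eq_flip (𝕜 := ℝ) (V := En n)
        (W := En n) (F := ℂ) (e := Real.fourierChar) (μ := volume) (ν := volume)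
        (L := innerₗ (En n)) (f := ψ) (g := h) Real.continuous_fourierChar
        continuous_inner ψ.integrable h1
      rw [flip_innerₗ] at this
      exact this
    have : ∀ (F : En n → ℂ), ∫ x, g x • F x = ∫ x, ψ x • F x := by
      intro F
      refine integral_congr_ae (ae_of_all _ fun x => ?_)
      simp [hψ]
    rw [this, this, e1, e2, e3]
  calc ∫⁻ ξ, ‖𝓕 h ξ‖ₑ ^ 2 = ∫⁻ ξ, ‖(𝓕 H : Lp ℂ 2 (volume : Measure (En n))) ξ‖ₑ ^ 2 := by
        refine lintegral_congr_ae ?_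
        filter_upwards [hae] with ξ hξ
        rw [hξ]
    _ = (‖(𝓕 H : Lp ℂ 2 (volume : Measure (En n)))‖ₑ) ^ 2 := by
        rw [Lp.enorm_def]
        rw [eLpNorm_eq_lintegral_rpow_enorm_toReal (by norm_num) (by norm_num)]
        rw [← ENNReal.rpow_natCast, ← ENNReal.rpow_mul]
        simp
    _ = (‖H‖ₑ) ^ 2 := by
        rw [← ofReal_norm, ← ofReal_norm, Lp.norm_fourier_eq]
    _ = ∫⁻ x, ‖H x‖ₑ ^ 2 := by
        rw [Lp.enorm_def]
        rw [eLpNorm_eq_lintegral_rpow_enorm_toReal (by norm_num) (by norm_num)]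
        rw [← ENNReal.rpow_natCast, ← ENNReal.rpow_mul]
        simp
    _ = ∫⁻ x, ‖h x‖ₑ ^ 2 := by
        refine lintegral_congr_ae ?_
        filter_upwards [h2.coeFn_toLp] with x hx
        rw [hH, hx]

open FourierTransform in
theorem ftP_eq_fourier {n : ℕ} (h : En n → ℂ) (ξ : En n) :
    ftP n h ξ = 𝓕 h ((2 * Real.pi)⁻¹ • ξ) := by
  rw [Real.fourier_eq', ftP]
  refine integral_congr_ae (ae_of_all _ fun x => ?_)
  simp only [smul_eq_mul, inner_smul_right]
  congr 2
  have : (-2 * Real.pi * ((2 * Real.pi)⁻¹ * ⟪x, ξ⟫) : ℝ) = -⟪x, ξ⟫ := by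
    field_simp
  rw [this]; push_cast; ring

theorem lintegral_comp_smul_eq {n : ℕ} {F : En n → ℝ≥0∞} (hF : Measurable F) {c : ℝ}
    (hc : 0 < c) :
    ∫⁻ x, F (c • x) = ENNReal.ofReal ((c ^ n)⁻¹) * ∫⁻ x, F x := by
  have := Measure.map_addHaar_smul (volume : Measure (En n)) hc.ne'
  rw [← lintegral_map hF (measurable_const_smul c), this, lintegral_smul_measure]
  simp [abs_of_pos hc]

/-- Plancherel's theorem for the Fourier transform `ftP`. -/
theorem lintegral_enorm_ftP_sq {n : ℕ} {h : En n → ℂ} (h1 : Integrable h)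
    (h2 : MemLp h 2 volume) :
    ∫⁻ ξ, ‖ftP n h ξ‖ₑ ^ 2 = ENNReal.ofReal ((2 * Real.pi) ^ n) * ∫⁻ x, ‖h x‖ₑ ^ 2 := by
  have hcont : Continuous (FourierTransform.fourier h : En n → ℂ) :=
    VectorFourier.fourierIntegral_continuous Real.continuous_fourierChar
      continuous_inner h1
  simp_rw [ftP_eq_fourier]
  rw [lintegral_comp_smul_eq (F := fun ξ => ‖FourierTransform.fourier h ξ‖ₑ ^ 2)
    (by fun_prop) (by positivity), lintegral_enorm_fourier_sq h1 h2, inv_pow, inv_inv]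

theorem continuous_ftP {n : ℕ} {h : En n → ℂ} (h1 : Integrable h) : Continuous (ftP n h) := by
  have hcont : Continuous (FourierTransform.fourier h : En n → ℂ) :=
    VectorFourier.fourierIntegral_continuous Real.continuous_fourierChar
      continuous_inner h1
  have : ftP n h = fun ξ => FourierTransform.fourier h ((2 * Real.pi)⁻¹ • ξ) :=
    funext (ftP_eq_fourier h)
  rw [this]
  fun_prop

theorem norm_exp_neg_I_mul (r : ℝ) : ‖Complex.exp (-Complex.I * (r : ℂ))‖ = 1 := by
  have : -Complex.I * (r : ℂ) = ((-r : ℝ) : ℂ) * Complex.I := by push_cast; ring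
  rw [this, Complex.norm_exp_ofReal_mul_I]

theorem norm_exp_I_mul (r : ℝ) : ‖Complex.exp (Complex.I * (r : ℂ))‖ = 1 := by
  rw [mul_comm, Complex.norm_exp_ofReal_mul_I]

theorem norm_ftP_le {n : ℕ} (h : En n → ℂ) (ξ : En n) : ‖ftP n h ξ‖ ≤ ∫ x, ‖h x‖ := by
  refine (norm_integral_le_integral_norm _).trans_eq ?_
  refine integral_congr_ae (ae_of_all _ fun x => ?_)
  simp only [norm_mul, norm_exp_neg_I_mul, one_mul]

theorem integrable_exp_mul {n : ℕ} {h : En n → ℂ} (h1 : Integrable h) (ξ : En n) :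
    Integrable fun x : En n => Complex.exp (-Complex.I * ((⟪x, ξ⟫ : ℝ) : ℂ)) * h x := by
  refine h1.bdd_mul (c := 1) (by fun_prop) (ae_of_all _ fun x => ?_)
  rw [norm_exp_neg_I_mul]

/-- The (unnormalised) Fourier multiplier operator with symbol `m`. -/
def mulOp (n : ℕ) (m h : En n → ℂ) (x : En n) : ℂ :=
  ∫ ξ : En n, Complex.exp (Complex.I * ((⟪x, ξ⟫ : ℝ) : ℂ)) * (m ξ * ftP n h ξ)

/-- The convolution kernel of `mulOp`. -/
def mulKer (n : ℕ) (m : En n → ℂ) (z : En n) : ℂ :=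
  ∫ ξ : En n, Complex.exp (Complex.I * ((⟪z, ξ⟫ : ℝ) : ℂ)) * m ξ

/-- The partial derivative in the `j`-th coordinate direction. -/
def pderiv {n : ℕ} (j : Fin n) (m : En n → ℂ) (ξ : En n) : ℂ :=
  fderiv ℝ m ξ (EuclideanSpace.single j 1)

theorem mulOp_eq_ftP {n : ℕ} (m h : En n → ℂ) (x : En n) :
    mulOp n m h x = ftP n (fun ξ => m ξ * ftP n h ξ) (-x) := by
  unfold mulOp
  rw [ftP]
  refine integral_congr_ae (ae_of_all _ fun ξ => ?_)
  simp only [inner_neg_right, real_inner_comm ξ x]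
  congr 2
  push_cast
  ring

theorem norm_mulKer_le {n : ℕ} (m : En n → ℂ) (z : En n) : ‖mulKer n m z‖ ≤ ∫ ξ, ‖m ξ‖ := by
  refine (norm_integral_le_integral_norm _).trans_eq ?_
  refine integral_congr_ae (ae_of_all _ fun x => ?_)
  simp only [norm_mul, norm_exp_I_mul, one_mul]

theorem integrable_exp_I_mul {n : ℕ} {m : En n → ℂ} (hm : Integrable m) (z : En n) :
    Integrable fun ξ : En n => Complex.exp (Complex.I * ((⟪z, ξ⟫ : ℝ) : ℂ)) * m ξ := by
  refine hm.bdd_mul (c := 1) (by fun_prop) (ae_of_all _ fun x => ?_)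
  rw [norm_exp_I_mul]

theorem continuous_mulKer {n : ℕ} {m : En n → ℂ} (hm : Integrable m) :
    Continuous (mulKer n m) := by
  have : mulKer n m = fun z => ftP n m (-z) := by
    funext z
    unfold mulKer ftP
    refine integral_congr_ae (ae_of_all _ fun ξ => ?_)
    simp only [inner_neg_right, real_inner_comm ξ z]
    congr 2
    push_cast
    ring
  rw [this]
  exact (continuous_ftP hm).comp continuous_neg

theorem mulOp_eq_mulKer {n : ℕ} {m h : En n → ℂ} (hm : Integrable m) (hh : Integrable h)
    (x : En n) : mulOp n m h x = ∫ y, mulKer n m (x - y) * h y := by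
  unfold mulOp mulKer ftP
  simp_rw [← integral_const_mul, ← integral_mul_const]
  rw [integral_integral_swap]
  · refine integral_congr_ae (ae_of_all _ fun y => ?_)
    refine integral_congr_ae (ae_of_all _ fun ξ => ?_)
    simp only [inner_sub_left]
    rw [show Complex.I * ((⟪x, ξ⟫ - ⟪y, ξ⟫ : ℝ) : ℂ)
      = Complex.I * ((⟪x, ξ⟫ : ℝ) : ℂ) + (-Complex.I * ((⟪y, ξ⟫ : ℝ) : ℂ)) by push_cast; ring,
      Complex.exp_add]
    ring
  · have h0 : Integrable (fun p : En n × En n => m p.1 * h p.2) (volume.prod volume) :=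
      hm.mul_prod hh
    have : Integrable (fun p : En n × En n =>
        (Complex.exp (Complex.I * ((⟪x, p.1⟫ : ℝ) : ℂ)) *
          Complex.exp (-Complex.I * ((⟪p.2, p.1⟫ : ℝ) : ℂ))) * (m p.1 * h p.2))
        (volume.prod volume) := by
      refine h0.bdd_mul (c := 1) (by fun_prop) (ae_of_all _ fun p => ?_)
      rw [norm_mul, norm_exp_I_mul, norm_exp_neg_I_mul, one_mul]
    refine this.congr (ae_of_all _ fun p => ?_)
    simp only [Function.uncurry]
    ring

theorem mulOp_L2 {n : ℕ} {m h : En n → ℂ} (hm : Continuous m) (hmc : HasCompactSupport m)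
    (hh : Integrable h) :
    ∫⁻ x, ‖mulOp n m h x‖ₑ ^ 2
      = ENNReal.ofReal ((2 * Real.pi) ^ n) * ∫⁻ ξ, ‖m ξ * ftP n h ξ‖ₑ ^ 2 := by
  have hc : Continuous fun ξ => m ξ * ftP n h ξ := hm.mul (continuous_ftP hh)
  have hs : HasCompactSupport fun ξ => m ξ * ftP n h ξ := hmc.mul_right
  rw [← lintegral_enorm_ftP_sq (hc.integrable_of_hasCompactSupport hs)
    (hc.memLp_of_hasCompactSupport hs)]
  simp_rw [mulOp_eq_ftP]
  exact (Measure.measurePreserving_neg (volume : Measure (En n))).lintegral_comp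
    (f := fun ξ => ‖ftP n (fun ξ => m ξ * ftP n h ξ) ξ‖ₑ ^ 2)
    ((continuous_ftP (hc.integrable_of_hasCompactSupport hs)).enorm.measurable.pow_const 2)

theorem contDiff_pderiv {n : ℕ} (j : Fin n) {m : En n → ℂ} (hm : ContDiff ℝ (⊤ : ℕ∞) m) :
    ContDiff ℝ (⊤ : ℕ∞) (pderiv j m) :=
  (hm.fderiv_right (m := (⊤ : ℕ∞)) (by simp)).clm_apply contDiff_const

theorem hasCompactSupport_pderiv {n : ℕ} (j : Fin n) {m : En n → ℂ} (hm : HasCompactSupport m) :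
    HasCompactSupport (pderiv j m) :=
  hm.fderiv_apply ℝ _

theorem contDiff_pderiv_iterate {n : ℕ} (j : Fin n) {m : En n → ℂ}
    (hm : ContDiff ℝ (⊤ : ℕ∞) m) (i : ℕ) : ContDiff ℝ (⊤ : ℕ∞) ((pderiv j)^[i] m) := by
  induction i generalizing m with
  | zero => exact hm
  | succ i ih => exact ih (contDiff_pderiv j hm)

theorem pderiv_support_subset {n : ℕ} (j : Fin n) (m : En n → ℂ) :
    tsupport (pderiv j m) ⊆ tsupport m :=
  tsupport_fderiv_apply_subset ℝ _

theorem pderiv_iterate_support_subset {n : ℕ} (j : Fin n) (m : En n → ℂ) (i : ℕ) :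
    tsupport ((pderiv j)^[i] m) ⊆ tsupport m := by
  induction i generalizing m with
  | zero => exact subset_rfl
  | succ i ih => exact (ih _).trans (pderiv_support_subset j m)

theorem coord_mul_mulKer {n : ℕ} (j : Fin n) {m : En n → ℂ} (hm : ContDiff ℝ (⊤ : ℕ∞) m)
    (hmc : HasCompactSupport m) (z : En n) :
    (z j : ℂ) * mulKer n m z = Complex.I * mulKer n (pderiv j m) z := by
  set e : En n := EuclideanSpace.single j 1
  have hE : ∀ ξ, HasFDerivAt (fun ξ : En n => Complex.exp (Complex.I * ((⟪z, ξ⟫ : ℝ) : ℂ)))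
      ((Complex.exp (Complex.I * ((⟪z, ξ⟫ : ℝ) : ℂ))) •
        (Complex.I • (Complex.ofRealCLM ∘L (innerSL ℝ z)))) ξ := by
    intro ξ
    have h1 : HasFDerivAt (fun ξ : En n => ((⟪z, ξ⟫ : ℝ) : ℂ))
        (Complex.ofRealCLM ∘L (innerSL ℝ z)) ξ :=
      (Complex.ofRealCLM ∘L (innerSL ℝ z)).hasFDerivAt
    exact (h1.const_mul Complex.I).cexp
  have hd : ∀ ξ, fderiv ℝ (fun ξ : En n => Complex.exp (Complex.I * ((⟪z, ξ⟫ : ℝ) : ℂ))) ξ e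
      = Complex.exp (Complex.I * ((⟪z, ξ⟫ : ℝ) : ℂ)) * (Complex.I * (z j : ℂ)) := by
    intro ξ
    rw [(hE ξ).fderiv]
    simp [e, EuclideanSpace.inner_single_right]
  have hmi : Integrable m := hm.continuous.integrable_of_hasCompactSupport hmc
  have hdi : Integrable (pderiv j m) :=
    (contDiff_pderiv j hm).continuous.integrable_of_hasCompactSupport
    (hasCompactSupport_pderiv j hmc)
  have key := integral_mul_fderiv_eq_neg_fderiv_mul_of_integrable (μ := volume) (𝕜 := ℂ)
    (f := fun ξ : En n => Complex.exp (Complex.I * ((⟪z, ξ⟫ : ℝ) : ℂ))) (g := m) (v := e)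
    ?_ ?_ ?_ (fun ξ _ => (hE ξ).differentiableAt)
    (fun ξ _ => hm.differentiable (by simp) ξ)
  · unfold mulKer
    have h2 : ∫ ξ, Complex.exp (Complex.I * ((⟪z, ξ⟫ : ℝ) : ℂ)) * pderiv j m ξ
        = - (Complex.I * (z j : ℂ)) * ∫ ξ, Complex.exp (Complex.I * ((⟪z, ξ⟫ : ℝ) : ℂ)) * m ξ := by
      unfold pderiv
      rw [key, ← integral_const_mul, ← integral_neg]
      refine integral_congr_ae (ae_of_all _ fun ξ => ?_)
      simp only [hd]
      ring
    rw [h2]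
    linear_combination (↑(z j) * ∫ ξ, Complex.exp (Complex.I * ((⟪z, ξ⟫ : ℝ) : ℂ)) * m ξ) *
      Complex.I_mul_I
  · simp_rw [hd]
    refine ((integrable_exp_I_mul hmi z).const_mul (Complex.I * (z j : ℂ))).congr
      (ae_of_all _ fun ξ => ?_)
    ring
  · exact integrable_exp_I_mul hdi z
  · exact integrable_exp_I_mul hmi z

theorem integrable_coord_mul {n : ℕ} (j : Fin n) {h : En n → ℂ} (hh : Integrable h) {r : ℝ}
    (hr : ∀ y, r < ‖y‖ → h y = 0) : Integrable fun y : En n => (y j : ℂ) * h y := by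
  have h1 : Integrable fun y : En n => (r : ℂ) * h y := hh.const_mul _
  refine h1.mono ?_ (ae_of_all _ fun y => ?_)
  · exact (Continuous.aestronglyMeasurable (by fun_prop)).mul hh.1
  · by_cases hy : r < ‖y‖
    · simp [hr y hy]
    · push Not at hy
      rw [norm_mul, norm_mul, Complex.norm_real, Complex.norm_real]
      gcongr
      exact (PiLp.norm_apply_le y j).trans (hy.trans (le_abs_self r))

theorem coord_mul_mulOp {n : ℕ} (j : Fin n) {m h : En n → ℂ} (hm : ContDiff ℝ (⊤ : ℕ∞) m)
    (hmc : HasCompactSupport m) (hh : Integrable h) {r : ℝ} (hr : ∀ y, r < ‖y‖ → h y = 0)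
    (x : En n) :
    (x j : ℂ) * mulOp n m h x
      = mulOp n m (fun y => (y j : ℂ) * h y) x + Complex.I * mulOp n (pderiv j m) h x := by
  have hmi : Integrable m := hm.continuous.integrable_of_hasCompactSupport hmc
  have hdi : Integrable (pderiv j m) :=
    (contDiff_pderiv j hm).continuous.integrable_of_hasCompactSupport
    (hasCompactSupport_pderiv j hmc)
  have hb : ∀ {M : En n → ℂ} {H : En n → ℂ}, Integrable M → Integrable H →
      Integrable fun y => mulKer n M (x - y) * H y := by
    intro M H hM hH
    refine hH.bdd_mul (c := ∫ ξ, ‖M ξ‖) ?_ (ae_of_all _ fun y => norm_mulKer_le _ _)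
    exact ((continuous_mulKer hM).comp (by fun_prop)).aestronglyMeasurable
  rw [mulOp_eq_mulKer hmi hh, mulOp_eq_mulKer hmi (integrable_coord_mul j hh hr),
    mulOp_eq_mulKer hdi hh, ← integral_const_mul, ← integral_const_mul, ← integral_add
    (hb hmi (integrable_coord_mul j hh hr)) ((hb hdi hh).const_mul _)]
  refine integral_congr_ae (ae_of_all _ fun y => ?_)
  have := coord_mul_mulKer j hm hmc (x - y)
  simp only [PiLp.sub_apply, Complex.ofReal_sub] at this
  linear_combination (h y) * this

theorem enorm_add_sq_le (a b : ℂ) : ‖a + b‖ₑ ^ 2 ≤ 2 * (‖a‖ₑ ^ 2 + ‖b‖ₑ ^ 2) := by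
  have h : ‖a + b‖ ^ 2 ≤ 2 * (‖a‖ ^ 2 + ‖b‖ ^ 2) := by
    have := norm_add_le a b
    nlinarith [norm_nonneg (a + b), sq_nonneg (‖a‖ - ‖b‖)]
  rw [← ofReal_norm, ← ofReal_norm, ← ofReal_norm, ← ENNReal.ofReal_pow (norm_nonneg _),
    ← ENNReal.ofReal_pow (norm_nonneg _), ← ENNReal.ofReal_pow (norm_nonneg _),
    ← ENNReal.ofReal_add (by positivity) (by positivity),
    show (2 : ℝ≥0∞) = ENNReal.ofReal 2 by simp, ← ENNReal.ofReal_mul (by norm_num)]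
  exact ENNReal.ofReal_le_ofReal h

theorem continuous_mulOp {n : ℕ} {m h : En n → ℂ} (hm : Continuous m)
    (hmc : HasCompactSupport m) (hh : Integrable h) : Continuous (mulOp n m h) := by
  have hc : Continuous fun ξ => m ξ * ftP n h ξ := hm.mul (continuous_ftP hh)
  have hs : HasCompactSupport fun ξ => m ξ * ftP n h ξ := hmc.mul_right
  have : mulOp n m h = fun x => ftP n (fun ξ => m ξ * ftP n h ξ) (-x) :=
    funext (mulOp_eq_ftP m h)
  rw [this]
  exact (continuous_ftP (hc.integrable_of_hasCompactSupport hs)).comp continuous_neg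

/-- Weighted `L²` bound for a multiplier operator in terms of derivatives of the symbol. -/
theorem weighted_mulOp_L2 {n : ℕ} (j : Fin n) (N : ℕ) {m h : En n → ℂ}
    (hm : ContDiff ℝ (⊤ : ℕ∞) m) (hmc : HasCompactSupport m) (hh : Integrable h) {r : ℝ}
    (hr : ∀ y, r < ‖y‖ → h y = 0) {E : ℝ≥0∞}
    (hE : ∀ i l, i + l = N → ∫⁻ ξ, ‖(pderiv j)^[i] m ξ *
      ftP n (fun y => (y j : ℂ) ^ l * h y) ξ‖ₑ ^ 2 ≤ E) :
    ∫⁻ x, ‖(x j : ℂ) ^ N * mulOp n m h x‖ₑ ^ 2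
      ≤ ENNReal.ofReal ((2 * Real.pi) ^ n) * (4 ^ N * E) := by
  induction N generalizing m h with
  | zero =>
    have h0 := hE 0 0 rfl
    simp only [pow_zero, one_mul, Function.iterate_zero, id] at h0 ⊢
    rw [mulOp_L2 hm.continuous hmc hh]
    gcongr
  | succ N ih =>
    have hxh := integrable_coord_mul j hh hr
    have hd := contDiff_pderiv j hm
    have hdc := hasCompactSupport_pderiv j hmc
    have h1 := ih (h := fun y => (y j : ℂ) * h y) hm hmc hxh
      (fun y hy => by simp [hr y hy]) (fun i l hil => by
        refine le_trans (le_of_eq ?_) (hE i (l + 1) (by omega))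
        refine lintegral_congr fun ξ => ?_
        congr 4
        funext y
        ring)
    have h2 := ih hd hdc hh hr (fun i l hil => hE (i + 1) l (by omega))
    calc ∫⁻ x, ‖(x j : ℂ) ^ (N + 1) * mulOp n m h x‖ₑ ^ 2
        ≤ ∫⁻ x : En n, 2 * (‖(x j : ℂ) ^ N * mulOp n m (fun y => (y j : ℂ) * h y) x‖ₑ ^ 2 +
            ‖(x j : ℂ) ^ N * mulOp n (pderiv j m) h x‖ₑ ^ 2) := by
          refine lintegral_mono fun x => ?_
          have : (x j : ℂ) ^ (N + 1) * mulOp n m h x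
              = (x j : ℂ) ^ N * mulOp n m (fun y => (y j : ℂ) * h y) x +
                Complex.I * ((x j : ℂ) ^ N * mulOp n (pderiv j m) h x) := by
            rw [pow_succ, mul_assoc, coord_mul_mulOp j hm hmc hh hr]
            ring
          rw [this]
          refine (enorm_add_sq_le _ _).trans_eq ?_
          rw [enorm_mul Complex.I, ← ofReal_norm Complex.I, Complex.norm_I, ENNReal.ofReal_one,
            one_mul]
      _ = 2 * ((∫⁻ x, ‖(x j : ℂ) ^ N * mulOp n m (fun y => (y j : ℂ) * h y) x‖ₑ ^ 2) +
            ∫⁻ x, ‖(x j : ℂ) ^ N * mulOp n (pderiv j m) h x‖ₑ ^ 2) := by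
          have := continuous_mulOp hm.continuous hmc hxh
          rw [lintegral_const_mul' _ _ (by simp), lintegral_add_left]
          fun_prop
      _ ≤ 2 * (ENNReal.ofReal ((2 * Real.pi) ^ n) * (4 ^ N * E) +
            ENNReal.ofReal ((2 * Real.pi) ^ n) * (4 ^ N * E)) := by gcongr
      _ = _ := by ring

theorem one_add_norm_pow_le {n : ℕ} (N : ℕ) (x : En n) :
    (1 + ‖x‖) ^ (2 * N) ≤ 4 ^ N * (n + 1) ^ N * (1 + ∑ j, |x j| ^ (2 * N)) := by
  have h1 : (1 + ‖x‖) ^ 2 ≤ 4 * (n + 1) * (max 1 (‖x‖ ^ 2 / (n + 1))) := by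
    have : (1 + ‖x‖) ^ 2 ≤ 2 * (1 + ‖x‖ ^ 2) := by nlinarith [sq_nonneg (1 - ‖x‖)]
    have h3 : (1:ℝ) ≤ max 1 (‖x‖ ^ 2 / (n + 1)) := le_max_left _ _
    have h4 : ‖x‖ ^ 2 / (n + 1) ≤ max 1 (‖x‖ ^ 2 / (n + 1)) := le_max_right _ _
    rw [div_le_iff₀ (by positivity)] at h4
    have h5 : (0:ℝ) ≤ n := by positivity
    nlinarith
  have h2 : (max 1 (‖x‖ ^ 2 / (n + 1))) ^ N ≤ 1 + ∑ j, |x j| ^ (2 * N) := by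
    have hs : 0 ≤ ∑ j, |x j| ^ (2 * N) := by positivity
    rcases le_total (‖x‖ ^ 2 / (n + 1)) 1 with h | h
    · rw [max_eq_left h, one_pow]; linarith
    · rw [max_eq_right h]
      have hne : (Finset.univ : Finset (Fin n)).Nonempty := by
        by_contra hc
        rw [Finset.not_nonempty_iff_eq_empty] at hc
        have : ‖x‖ ^ 2 = 0 := by rw [EuclideanSpace.real_norm_sq_eq, hc]; simp
        rw [this] at h; norm_num at h
      obtain ⟨j, -, hj⟩ := Finset.exists_max_image Finset.univ (fun j => |x j| ^ 2) hne
      have h6 : ‖x‖ ^ 2 / (n + 1) ≤ |x j| ^ 2 := by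
        rw [div_le_iff₀ (by positivity), EuclideanSpace.real_norm_sq_eq]
        calc ∑ i, (x i) ^ 2 ≤ ∑ i : Fin n, |x j| ^ 2 :=
              Finset.sum_le_sum fun i hi => by simpa [sq_abs] using hj i hi
          _ = n * |x j| ^ 2 := by simp
          _ ≤ |x j| ^ 2 * (n + 1) := by nlinarith [sq_nonneg |x j|]
      calc (‖x‖ ^ 2 / (n + 1)) ^ N ≤ (|x j| ^ 2) ^ N := by gcongr
        _ = |x j| ^ (2 * N) := by rw [pow_mul]
        _ ≤ ∑ j, |x j| ^ (2 * N) :=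
          Finset.single_le_sum (f := fun j => |x j| ^ (2 * N)) (fun i _ => by positivity)
            (Finset.mem_univ j)
        _ ≤ _ := by linarith
  calc (1 + ‖x‖) ^ (2 * N) = ((1 + ‖x‖) ^ 2) ^ N := by rw [pow_mul]
    _ ≤ (4 * (n + 1) * (max 1 (‖x‖ ^ 2 / (n + 1)))) ^ N := by gcongr
    _ = 4 ^ N * (n + 1) ^ N * (max 1 (‖x‖ ^ 2 / (n + 1))) ^ N := by rw [mul_pow, mul_pow]
    _ ≤ _ := by gcongr

/-- Cauchy–Schwarz against a polynomial weight. -/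
theorem lintegral_sq_le_of_weighted {n N : ℕ} (hN : n < 2 * N) :
    ∃ C : ℝ≥0, ∀ (G : En n → ℝ≥0∞) (R : ℝ) (E : ℝ≥0∞), Measurable G → 0 < R →
      ∫⁻ x, G x ^ 2 ≤ E →
      (∀ j, ∫⁻ x, ENNReal.ofReal (|x j| ^ (2 * N)) * G x ^ 2 ≤ ENNReal.ofReal (R ^ (2 * N)) * E) →
      (∫⁻ x, G x) ^ 2 ≤ C * ENNReal.ofReal (R ^ n) * E := by
  have hW : ∫⁻ x : En n, ENNReal.ofReal ((1 + ‖x‖) ^ (-((2 * N : ℕ) : ℝ))) < ∞ :=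
    finite_integral_one_add_norm (by simpa using by exact_mod_cast hN)
  set W := ∫⁻ x : En n, ENNReal.ofReal ((1 + ‖x‖) ^ (-((2 * N : ℕ) : ℝ))) with hWdef
  refine ⟨W.toNNReal * (4 ^ N * (n + 1) ^ N * (n + 1)), fun G R E hG hR h0 hj => ?_⟩
  have hwc : Continuous fun x : En n => 1 + ‖R⁻¹ • x‖ := by fun_prop
  have hwp : ∀ x : En n, 0 < 1 + ‖R⁻¹ • x‖ := fun x => by positivity
  have hu : Continuous fun x : En n => ((1 + ‖R⁻¹ • x‖) ^ N)⁻¹ :=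
    (hwc.pow N).inv₀ fun x => (pow_pos (hwp x) N).ne'
  have hum : Measurable fun x : En n => ENNReal.ofReal (((1 + ‖R⁻¹ • x‖) ^ N)⁻¹) :=
    hu.measurable.ennreal_ofReal
  have hvm : Measurable fun x : En n => ENNReal.ofReal ((1 + ‖R⁻¹ • x‖) ^ N) * G x :=
    (hwc.pow N).measurable.ennreal_ofReal.mul hG
  have hCS := ENNReal.lintegral_mul_le_Lp_mul_Lq volume Real.HolderConjugate.two_two
    hum.aemeasurable hvm.aemeasurable
  have e1 : ∀ x, ((fun x : En n => ENNReal.ofReal (((1 + ‖R⁻¹ • x‖) ^ N)⁻¹)) *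
      fun x => ENNReal.ofReal ((1 + ‖R⁻¹ • x‖) ^ N) * G x) x = G x := fun x => by
    have := pow_pos (hwp x) N
    simp only [Pi.mul_apply]
    rw [← mul_assoc, ← ENNReal.ofReal_mul (by positivity), inv_mul_cancel₀ this.ne']
    simp
  have e2 : ∫⁻ x : En n, ENNReal.ofReal (((1 + ‖R⁻¹ • x‖) ^ N)⁻¹) ^ (2:ℝ)
      = ENNReal.ofReal (R ^ n) * W := by
    have := lintegral_comp_smul_eq (n := n)
      (F := fun x => ENNReal.ofReal ((1 + ‖x‖) ^ (-((2 * N : ℕ) : ℝ)))) (by fun_prop)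
      (c := R⁻¹) (by positivity)
    rw [inv_pow, inv_inv] at this
    rw [← this]
    refine lintegral_congr fun x => ?_
    rw [ENNReal.ofReal_rpow_of_nonneg (by positivity) (by norm_num)]
    congr 1
    rw [Real.rpow_neg (hwp x).le, Real.rpow_natCast, Real.rpow_two, inv_pow, ← pow_mul,
      mul_comm N 2]
  have e3 : ∫⁻ x : En n, (ENNReal.ofReal ((1 + ‖R⁻¹ • x‖) ^ N) * G x) ^ (2:ℝ)
      ≤ (4 ^ N * (n + 1) ^ N * (n + 1) : ℝ≥0) * E := by
    have hle : ∀ x : En n, (ENNReal.ofReal ((1 + ‖R⁻¹ • x‖) ^ N) * G x) ^ (2:ℝ)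
        ≤ (4 ^ N * (n + 1) ^ N : ℝ≥0) * (G x ^ 2 + ∑ j, ENNReal.ofReal ((R ^ (2 * N))⁻¹) *
          (ENNReal.ofReal (|x j| ^ (2 * N)) * G x ^ 2)) := fun x => by
      have := one_add_norm_pow_le N (R⁻¹ • x)
      rw [ENNReal.rpow_two, mul_pow, ← ENNReal.ofReal_pow (by positivity), ← pow_mul,
        mul_comm N 2]
      calc _ ≤ ENNReal.ofReal (4 ^ N * (n + 1) ^ N * (1 + ∑ j, |(R⁻¹ • x) j| ^ (2 * N))) *
          G x ^ 2 := by
            gcongr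
        _ = _ := by
          rw [ENNReal.ofReal_mul (by positivity),
            ENNReal.ofReal_add (by positivity) (by positivity),
            ENNReal.ofReal_sum_of_nonneg (fun _ _ => by positivity), mul_assoc, add_mul,
            Finset.sum_mul, ENNReal.ofReal_one, one_mul]
          congr 1
          · rw [ENNReal.ofReal, Real.toNNReal_mul (by positivity)]
            congr 1
            have : (4:ℝ) ^ N = ((4 ^ N : ℝ≥0) : ℝ) := by simp
            rw [this, Real.toNNReal_coe]
            have : ((n:ℝ)+1) ^ N = (((n+1) ^ N : ℝ≥0) : ℝ) := by simp
            rw [this, Real.toNNReal_coe]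
          · congr 1
            refine Finset.sum_congr rfl fun j _ => ?_
            rw [← mul_assoc, ← ENNReal.ofReal_mul (by positivity)]
            congr 2
            simp only [PiLp.smul_apply, smul_eq_mul]
            rw [abs_mul, mul_pow, abs_of_pos (by positivity), inv_pow]
    refine (lintegral_mono hle).trans ?_
    rw [lintegral_const_mul' _ _ ENNReal.coe_ne_top, lintegral_add_left (by fun_prop),
      lintegral_finsetSum _ (fun j _ => by fun_prop)]
    have h7 : ∀ j : Fin n, ∫⁻ x : En n, ENNReal.ofReal ((R ^ (2 * N))⁻¹) *
          (ENNReal.ofReal (|x j| ^ (2 * N)) * G x ^ 2) ≤ E := fun j => by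
      rw [lintegral_const_mul' _ _ (by simp)]
      refine (mul_le_mul_right (hj j) _).trans_eq ?_
      rw [← mul_assoc, ← ENNReal.ofReal_mul (by positivity), inv_mul_cancel₀ (by positivity)]
      simp
    calc _ ≤ ((4 ^ N * (n + 1) ^ N : ℝ≥0) : ℝ≥0∞) * (E + ∑ j : Fin n, E) := by
          gcongr with j _; exact h7 j
      _ = _ := by simp; ring
  simp only [e1] at hCS
  rw [e2] at hCS
  calc (∫⁻ x, G x) ^ 2 ≤ ((ENNReal.ofReal (R ^ n) * W) ^ (1 / 2 : ℝ) *
        (∫⁻ x : En n, (ENNReal.ofReal ((1 + ‖R⁻¹ • x‖) ^ N) * G x) ^ (2:ℝ)) ^ (1 / 2 : ℝ)) ^ 2 := by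
        gcongr
    _ = (ENNReal.ofReal (R ^ n) * W) *
        (∫⁻ x : En n, (ENNReal.ofReal ((1 + ‖R⁻¹ • x‖) ^ N) * G x) ^ (2:ℝ)) := by
        rw [mul_pow, ← ENNReal.rpow_two, ← ENNReal.rpow_two, ← ENNReal.rpow_mul, ← ENNReal.rpow_mul]
        norm_num
    _ ≤ (ENNReal.ofReal (R ^ n) * W) * ((4 ^ N * (n + 1) ^ N * (n + 1) : ℝ≥0) * E) := by gcongr
    _ = _ := by
      rw [ENNReal.coe_mul W.toNNReal, ENNReal.coe_toNNReal hW.ne]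
      ring

theorem continuous_mulOp_param {n : ℕ} {m : ℝ → En n → ℂ} {h : En n → ℂ}
    (hm : Continuous (Function.uncurry m)) {r : ℝ} (hms : ∀ t ξ, r < ‖ξ‖ → m t ξ = 0)
    (hh : Integrable h) : Continuous fun q : En n × ℝ => mulOp n (m q.2) h q.1 := by
  unfold mulOp
  have hf := continuous_ftP hh
  have hm' : Continuous fun q : (En n × ℝ) × En n => m q.1.2 q.2 :=
    hm.comp (by fun_prop : Continuous fun q : (En n × ℝ) × En n => (q.1.2, q.2))
  have hc : Continuous (Function.uncurry fun (q : En n × ℝ) ξ =>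
      Complex.exp (Complex.I * ((⟪q.1, ξ⟫ : ℝ) : ℂ)) * (m q.2 ξ * ftP n h ξ)) := by
    simp only [Function.uncurry_def]
    fun_prop
  refine (continuous_parametric_integral_of_continuous (μ := volume) hc
    (isCompact_closedBall (0 : En n) r)).congr fun q => ?_
  · refine setIntegral_eq_integral_of_forall_compl_eq_zero fun ξ hξ => ?_
    rw [hms _ _ (by simpa using hξ)]
    simp

theorem mulOp_translate {n : ℕ} {m h : En n → ℂ} (hm : Integrable m) (hh : Integrable h)
    (c x : En n) : mulOp n m (fun y => h (y + c)) x = mulOp n m h (x + c) := by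
  rw [mulOp_eq_mulKer hm hh, mulOp_eq_mulKer hm (hh.comp_add_right c),
    ← integral_add_right_eq_self (fun y => mulKer n m (x + c - y) * h y) c]
  simp

theorem volume_closedBall_En (n : ℕ) {r : ℝ} (hr : 0 ≤ r) :
    volume (closedBall (0 : En n) r)
      = ENNReal.ofReal (r ^ n * (volume (closedBall (0 : En n) 1)).toReal) := by
  rw [Measure.addHaar_closedBall' _ _ hr, ENNReal.ofReal_mul (by positivity),
    ENNReal.ofReal_toReal measure_closedBall_lt_top.ne]
  simp

theorem integrable_of_bdd_supp {n : ℕ} {h : En n → ℂ} (hh : Measurable h) {M r : ℝ}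
    (hM : ∀ y, ‖h y‖ ≤ M) (hs : ∀ y, r < ‖y‖ → h y = 0) : Integrable h := by
  refine IntegrableOn.integrable_of_forall_notMem_eq_zero (s := closedBall (0 : En n) r) ?_
    fun x hx => hs x (by simpa using hx)
  exact Measure.integrableOn_of_bounded (measure_closedBall_lt_top).ne
    hh.aestronglyMeasurable (ae_of_all _ hM)

theorem lintegral_enorm_sq_le_of_bdd_supp {n : ℕ} {h : En n → ℂ} {M r : ℝ}
    (hM : ∀ y, ‖h y‖ ≤ M) (hr : 0 ≤ r) (hs : ∀ y, r < ‖y‖ → h y = 0) :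
    ∫⁻ y, ‖h y‖ₑ ^ 2
      ≤ ENNReal.ofReal (M ^ 2 * (r ^ n * (volume (closedBall (0 : En n) 1)).toReal)) := by
  have hM0 : 0 ≤ M := (norm_nonneg _).trans (hM 0)
  rw [ENNReal.ofReal_mul (by positivity), ← volume_closedBall_En n hr,
    ← setLIntegral_const, ← lintegral_indicator measurableSet_closedBall]
  refine lintegral_mono fun y => ?_
  by_cases hy : y ∈ closedBall (0 : En n) r
  · rw [indicator_of_mem hy, ENNReal.ofReal_pow hM0, ← ofReal_norm]
    gcongr
    exact hM y
  · rw [hs y (by simpa using hy)]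
    simp

theorem integral_norm_le_of_bdd_supp {n : ℕ} {h : En n → ℂ} (hh : Measurable h) {M r : ℝ}
    (hM : ∀ y, ‖h y‖ ≤ M) (hr : 0 ≤ r) (hs : ∀ y, r < ‖y‖ → h y = 0) :
    ∫ y, ‖h y‖ ≤ M * (r ^ n * (volume (closedBall (0 : En n) 1)).toReal) := by
  have h1 := integrable_of_bdd_supp hh hM hs
  rw [← setIntegral_eq_integral_of_forall_compl_eq_zero (s := closedBall (0 : En n) r)
    fun y hy => by rw [hs y (by simpa using hy), norm_zero]]
  have hM0 : 0 ≤ M := (norm_nonneg _).trans (hM 0)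
  have := setIntegral_mono_on (g := fun _ => M) (s := closedBall (0 : En n) r) h1.norm.integrableOn
    (integrableOn_const (measure_closedBall_lt_top).ne) measurableSet_closedBall fun y _ => hM y
  refine this.trans_eq ?_
  rw [setIntegral_const, measureReal_def, volume_closedBall_En n hr,
    ENNReal.toReal_ofReal (by positivity), smul_eq_mul, mul_comm]

theorem norm_ftP_le_of_integral_eq_zero {n : ℕ} {h : En n → ℂ} (hh : Integrable h) {r : ℝ}
    (hs : ∀ y, r < ‖y‖ → h y = 0) (h0 : ∫ y, h y = 0) (ξ : En n) :
    ‖ftP n h ξ‖ ≤ r * ‖ξ‖ * ∫ y, ‖h y‖ := by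
  have : ftP n h ξ = ∫ y, (Complex.exp (-Complex.I * ((⟪y, ξ⟫ : ℝ) : ℂ)) - 1) * h y := by
    simp_rw [sub_mul, one_mul]
    rw [integral_sub (integrable_exp_mul hh ξ) hh, h0, sub_zero, ftP]
  rw [this, ← integral_const_mul]
  refine norm_integral_le_of_norm_le (hh.norm.const_mul _) (ae_of_all _ fun y => ?_)
  rw [norm_mul]
  rcases le_or_gt ‖y‖ r with hy | hy
  · gcongr
    have e : -Complex.I * ((⟪y, ξ⟫ : ℝ) : ℂ) = Complex.I * ((-⟪y, ξ⟫ : ℝ) : ℂ) := by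
      push_cast; ring
    rw [e]
    refine (Real.norm_exp_I_mul_ofReal_sub_one_le).trans ?_
    rw [norm_neg, Real.norm_eq_abs]
    exact (abs_real_inner_le_norm _ _).trans (by gcongr)
  · rw [hs y hy]; simp

theorem norm_coord_pow_mul_le {n : ℕ} (j : Fin n) (l : ℕ) {h : En n → ℂ} {M r : ℝ}
    (hM : ∀ y, ‖h y‖ ≤ M) (hr : 0 ≤ r) (hs : ∀ y, r < ‖y‖ → h y = 0) (y : En n) :
    ‖(y j : ℂ) ^ l * h y‖ ≤ r ^ l * M := by
  have hM0 : 0 ≤ M := (norm_nonneg _).trans (hM 0)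
  rw [norm_mul, norm_pow, Complex.norm_real]
  rcases le_or_gt ‖y‖ r with hy | hy
  · gcongr
    · exact (PiLp.norm_apply_le y j).trans hy
    · exact hM y
  · rw [hs y hy]; simp; positivity

/-- `L²` bound on the Fourier side by Plancherel. -/
theorem lintegral_ftP_coord_sq_le {n : ℕ} (j : Fin n) (l : ℕ) {h : En n → ℂ} (hh : Measurable h)
    {M r R : ℝ} (hM : ∀ y, ‖h y‖ ≤ M) (hr : 0 < r) (hs : ∀ y, r < ‖y‖ → h y = 0) (hR : r ≤ R) :
    ∫⁻ ξ, ‖ftP n (fun y => (y j : ℂ) ^ l * h y) ξ‖ₑ ^ 2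
      ≤ ENNReal.ofReal (R ^ (2 * l) * ((2 * Real.pi) ^ n *
        (M ^ 2 * (r ^ n * (volume (closedBall (0 : En n) 1)).toReal)))) := by
  have hM' := norm_coord_pow_mul_le j l hM hr.le hs
  have hs' : ∀ y : En n, r < ‖y‖ → (y j : ℂ) ^ l * h y = 0 := fun y hy => by rw [hs y hy, mul_zero]
  have hm' : Measurable fun y : En n => (y j : ℂ) ^ l * h y := by fun_prop
  have h1 := integrable_of_bdd_supp hm' hM' hs'
  have h2 : MemLp (fun y : En n => (y j : ℂ) ^ l * h y) 2 volume := by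
    rw [memLp_two_iff_integrable_sq_norm hm'.aestronglyMeasurable]
    refine (h1.norm.bdd_mul (c := r ^ l * M) hm'.norm.aestronglyMeasurable
      (ae_of_all _ fun y => by simpa using hM' y)).congr (ae_of_all _ fun y => by simp [sq])
  rw [lintegral_enorm_ftP_sq h1 h2]
  refine (mul_le_mul_right (lintegral_enorm_sq_le_of_bdd_supp hM' hr.le hs') _).trans ?_
  rw [← ENNReal.ofReal_mul (by positivity)]
  refine ENNReal.ofReal_le_ofReal ?_
  have : r ^ (2 * l) ≤ R ^ (2 * l) := by gcongr
  calc (2 * Real.pi) ^ n * ((r ^ l * M) ^ 2 * (r ^ n * (volume (closedBall (0 : En n) 1)).toReal))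
      = r ^ (2 * l) * ((2 * Real.pi) ^ n *
        (M ^ 2 * (r ^ n * (volume (closedBall (0 : En n) 1)).toReal))) := by ring
    _ ≤ _ := by gcongr

/-- `L²` bound on a small frequency ball for functions with vanishing mean. -/
theorem setLIntegral_ftP_coord_sq_le {n : ℕ} (j : Fin n) (l : ℕ) {h : En n → ℂ}
    (hh : Measurable h) {M r R ρ : ℝ} (hM : ∀ y, ‖h y‖ ≤ M) (hr : 0 < r)
    (hs : ∀ y, r < ‖y‖ → h y = 0) (h0 : ∫ y, h y = 0) (hρ : 0 < ρ) (hrρ : r * ρ ≤ 1)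
    (hRρ : 1 ≤ R * ρ) :
    ∫⁻ ξ in closedBall (0 : En n) (2 * ρ), ‖ftP n (fun y => (y j : ℂ) ^ l * h y) ξ‖ₑ ^ 2
      ≤ ENNReal.ofReal (R ^ (2 * l) * (2 ^ (n + 2) * (M * r ^ n * (r * ρ)) ^ 2 * ρ ^ n *
        (volume (closedBall (0 : En n) 1)).toReal ^ 3)) := by
  set ω := (volume (closedBall (0 : En n) 1)).toReal with hω
  have hω0 : 0 ≤ ω := ENNReal.toReal_nonneg
  have hM0 : 0 ≤ M := (norm_nonneg _).trans (hM 0)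
  have hR : 0 < R := by by_contra hc; nlinarith
  have hrR : r ≤ R := by
    by_contra hc
    nlinarith
  have hpt : ∀ ξ ∈ closedBall (0 : En n) (2 * ρ),
      ‖ftP n (fun y => (y j : ℂ) ^ l * h y) ξ‖ ≤ 2 * (r * ρ) * R ^ l * (M * (r ^ n * ω)) := by
    intro ξ hξ
    have hξ' : ‖ξ‖ ≤ 2 * ρ := by simpa using hξ
    rcases l with _ | l
    · simp only [pow_zero, one_mul, mul_one]
      calc _ ≤ r * ‖ξ‖ * ∫ y, ‖h y‖ :=
            norm_ftP_le_of_integral_eq_zero (integrable_of_bdd_supp hh hM hs) hs h0 ξ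
        _ ≤ r * (2 * ρ) * (M * (r ^ n * ω)) := by
            gcongr
            exact integral_norm_le_of_bdd_supp hh hM hr.le hs
        _ = _ := by ring
    · have hM' := norm_coord_pow_mul_le j (l + 1) hM hr.le hs
      calc _ ≤ ∫ y : En n, ‖(y j : ℂ) ^ (l + 1) * h y‖ := norm_ftP_le _ _
        _ ≤ r ^ (l + 1) * M * (r ^ n * ω) :=
          integral_norm_le_of_bdd_supp (by fun_prop) hM' hr.le
            fun y hy => by rw [hs y hy, mul_zero]
        _ = r ^ (l + 1) * (M * (r ^ n * ω)) := by ring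
        _ ≤ 2 * (r * ρ) * R ^ (l + 1) * (M * (r ^ n * ω)) := by
          gcongr
          calc r ^ (l + 1) = r ^ l * r := pow_succ _ _
            _ ≤ R ^ l * (2 * r * (R * ρ)) := by
              gcongr
              nlinarith
            _ = _ := by ring
  calc _ ≤ ∫⁻ ξ in closedBall (0 : En n) (2 * ρ),
        ENNReal.ofReal ((2 * (r * ρ) * R ^ l * (M * (r ^ n * ω))) ^ 2) := by
        refine setLIntegral_mono measurable_const fun ξ hξ => ?_
        rw [ENNReal.ofReal_pow (by positivity), ← ofReal_norm]
        gcongr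
        exact hpt ξ hξ
    _ = ENNReal.ofReal ((2 * (r * ρ) * R ^ l * (M * (r ^ n * ω))) ^ 2 * ((2 * ρ) ^ n * ω)) := by
        rw [setLIntegral_const, volume_closedBall_En n (by positivity),
          ← ENNReal.ofReal_mul (by positivity)]
    _ = _ := by congr 1; ring

/-- A family of smooth symbols `m t`, supported in `‖ξ‖ ≤ 2 ρ`, whose `i`-th pure partial
derivatives are bounded by `A * R ^ i` for `i ≤ N` and `t ∈ I`. -/
structure SymbolBound (n N : ℕ) (I : Set ℝ) (m : ℝ → En n → ℂ) (A R ρ : ℝ) : Prop where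
  continuous : Continuous (Function.uncurry m)
  contDiff : ∀ t, ContDiff ℝ (⊤ : ℕ∞) (m t)
  supp : ∀ t ξ, 2 * ρ < ‖ξ‖ → m t ξ = 0
  bound : ∀ t ∈ I, ∀ j : Fin n, ∀ i ≤ N, ∀ ξ, ‖(pderiv j)^[i] (m t) ξ‖ ≤ A * R ^ i

theorem SymbolBound.hasCompactSupport {n N : ℕ} {I : Set ℝ} {m : ℝ → En n → ℂ} {A R ρ : ℝ}
    (hm : SymbolBound n N I m A R ρ) (t : ℝ) : HasCompactSupport (m t) :=
  HasCompactSupport.intro (isCompact_closedBall (0 : En n) (2 * ρ))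
    fun ξ hξ => hm.supp t ξ (by simpa using hξ)

theorem SymbolBound.lintegral_le {n N : ℕ} {I : Set ℝ} {m : ℝ → En n → ℂ} {A R ρ R' : ℝ}
    (hm : SymbolBound n N I m A R ρ) (hR : 0 ≤ R) (hRR : R ≤ R') {t : ℝ} (ht : t ∈ I)
    (j : Fin n) {i l N' : ℕ} (hN : N' ≤ N) (hil : i + l = N') {F : En n → ℂ}
    {B : ℝ}
    (hB : ∫⁻ ξ in closedBall (0 : En n) (2 * ρ), ‖F ξ‖ₑ ^ 2 ≤ ENNReal.ofReal (R' ^ (2 * l) * B)) :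
    ∫⁻ ξ, ‖(pderiv j)^[i] (m t) ξ * F ξ‖ₑ ^ 2 ≤ ENNReal.ofReal (A ^ 2 * R' ^ (2 * N') * B) := by
  have hb := hm.bound t ht j i (by omega)
  have hs : ∀ ξ, ξ ∉ closedBall (0 : En n) (2 * ρ) → (pderiv j)^[i] (m t) ξ = 0 := by
    intro ξ hξ
    refine image_eq_zero_of_notMem_tsupport fun hc => hξ ?_
    have h1 : tsupport ((pderiv j)^[i] (m t)) ⊆ tsupport (m t) :=
      pderiv_iterate_support_subset j (m t) i
    refine closure_minimal (fun ζ hζ => ?_) isClosed_closedBall (h1 hc)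
    by_contra hc'
    exact hζ (hm.supp t ζ (by simpa using hc'))
  rw [← setLIntegral_eq_of_support_subset (s := closedBall (0 : En n) (2 * ρ))
    (fun ξ hξ => by by_contra hc; exact hξ (by simp [hs ξ hc]))]
  calc _ ≤ ∫⁻ ξ in closedBall (0 : En n) (2 * ρ),
        ENNReal.ofReal ((A * R ^ i) ^ 2) * ‖F ξ‖ₑ ^ 2 := by
        refine lintegral_mono fun ξ => ?_
        have h2 := hb ξ
        rw [enorm_mul, mul_pow, ← ofReal_norm ((pderiv j)^[i] (m t) ξ),
          ENNReal.ofReal_pow ((norm_nonneg _).trans h2)]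
        gcongr
    _ ≤ ENNReal.ofReal ((A * R ^ i) ^ 2) * ENNReal.ofReal (R' ^ (2 * l) * B) := by
        rw [lintegral_const_mul' _ _ (by simp)]
        gcongr
    _ ≤ ENNReal.ofReal (A ^ 2 * R' ^ (2 * N') * B) := by
        rcases le_total 0 B with hB0 | hB0
        · rw [← ENNReal.ofReal_mul (by positivity)]
          refine ENNReal.ofReal_le_ofReal ?_
          have : R ^ i ≤ R' ^ i := by gcongr
          have hR' : 0 ≤ R' := hR.trans hRR
          calc (A * R ^ i) ^ 2 * (R' ^ (2 * l) * B) ≤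
              (A ^ 2 * (R' ^ i) ^ 2) * (R' ^ (2 * l) * B) := by
                rw [mul_pow]; gcongr
            _ = A ^ 2 * R' ^ (2 * N') * B := by rw [← hil]; ring
        · rw [ENNReal.ofReal_of_nonpos (p := R' ^ (2 * l) * B)
            (mul_nonpos_of_nonneg_of_nonpos (by have := hR.trans hRR; positivity) hB0)]
          simp

theorem SymbolBound.lintegral_mulOp_le {n N : ℕ} (hn : 0 < n) (hN : n < 2 * N) (a b : ℝ) :
    ∃ C : ℝ, 0 ≤ C ∧ ∀ (m : ℝ → En n → ℂ) (A R ρ R' B r : ℝ) (h : En n → ℂ),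
      SymbolBound n N (Icc a b) m A R ρ → 0 ≤ A → 0 < R → R ≤ R' → Integrable h → 0 ≤ B →
      (∀ y, r < ‖y‖ → h y = 0) →
      (∀ (j : Fin n) (l : ℕ), ∫⁻ ξ in closedBall (0 : En n) (2 * ρ),
        ‖ftP n (fun y => (y j : ℂ) ^ l * h y) ξ‖ₑ ^ 2 ≤ ENNReal.ofReal (R' ^ (2 * l) * B ^ 2)) →
      ∫⁻ x, (∫⁻ t in Icc a b, ‖mulOp n (m t) h x‖ₑ ^ 2) ^ (1 / 2 : ℝ)
        ≤ ENNReal.ofReal (C * A * R' ^ (n / 2 : ℝ) * B) := by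
  obtain ⟨C, hC⟩ := lintegral_sq_le_of_weighted hN
  refine ⟨Real.sqrt (C * ((2 * Real.pi) ^ n * 4 ^ N * (max (b - a) 0))), by positivity, ?_⟩
  intro m A R ρ R' B r h hm hA hR hRR hh hB0 hs hB
  have hR' : 0 < R' := hR.trans_le hRR
  have hcont := continuous_mulOp_param hm.continuous hm.supp hh
  have hmeas : Measurable fun q : En n × ℝ => ‖mulOp n (m q.2) h q.1‖ₑ ^ 2 :=
    hcont.enorm.measurable.pow_const 2
  have hmx : ∀ x, Measurable fun t => ‖mulOp n (m t) h x‖ₑ ^ 2 := fun x =>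
    hmeas.comp (g := fun q : En n × ℝ => ‖mulOp n (m q.2) h q.1‖ₑ ^ 2) (f := fun t => (x, t))
      measurable_prodMk_left
  have hGm : Measurable fun x => ∫⁻ t in Icc a b, ‖mulOp n (m t) h x‖ₑ ^ 2 :=
    hmeas.lintegral_prod_right'
  have hcoord : ∀ j (N' : ℕ), N' ≤ N → ∀ t ∈ Icc a b,
      ∫⁻ x, ‖(x j : ℂ) ^ N' * mulOp n (m t) h x‖ₑ ^ 2
      ≤ ENNReal.ofReal ((2 * Real.pi) ^ n * 4 ^ N * (A ^ 2 * R' ^ (2 * N') * B ^ 2)) := by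
    intro j N' hN' t ht
    refine (weighted_mulOp_L2 (E := ENNReal.ofReal (A ^ 2 * R' ^ (2 * N') * B ^ 2)) j N'
      (hm.contDiff t) (hm.hasCompactSupport t) hh hs fun i l hil => ?_).trans ?_
    · exact hm.lintegral_le hR.le hRR ht j hN' hil (hB j l)
    · rw [← mul_assoc, show (4 : ℝ≥0∞) = ENNReal.ofReal 4 by simp,
        ← ENNReal.ofReal_pow (by norm_num),
        ← ENNReal.ofReal_mul (by positivity), ← ENNReal.ofReal_mul (by positivity)]
      refine ENNReal.ofReal_le_ofReal ?_
      have : (4:ℝ) ^ N' ≤ 4 ^ N := by gcongr; norm_num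
      gcongr
  have hsw : ∀ (w : En n → ℝ≥0∞), Measurable w → ∀ E : ℝ, 0 ≤ E →
      (∀ t ∈ Icc a b, ∫⁻ x, w x * ‖mulOp n (m t) h x‖ₑ ^ 2 ≤ ENNReal.ofReal E) →
      ∫⁻ x, w x * ((∫⁻ t in Icc a b, ‖mulOp n (m t) h x‖ₑ ^ 2) ^ (1 / 2 : ℝ)) ^ 2
        ≤ ENNReal.ofReal (max (b - a) 0 * E) := by
    intro w hw E hE0 hE
    have e1 : ∀ x, w x * ((∫⁻ t in Icc a b, ‖mulOp n (m t) h x‖ₑ ^ 2) ^ (1 / 2 : ℝ)) ^ 2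
        = ∫⁻ t in Icc a b, w x * ‖mulOp n (m t) h x‖ₑ ^ 2 := fun x => by
      rw [← ENNReal.rpow_two, ← ENNReal.rpow_mul, lintegral_const_mul]
      · norm_num
      · exact hmx x
    simp_rw [e1]
    rw [lintegral_lintegral_swap]
    · calc _ ≤ ∫⁻ t in Icc a b, ENNReal.ofReal E :=
            setLIntegral_mono measurable_const fun t ht => hE t ht
        _ ≤ _ := by
          rw [setLIntegral_const, Real.volume_Icc, mul_comm, ENNReal.ofReal_mul (by positivity)]
          gcongr
          exact le_max_left _ _
    · exact ((hw.comp measurable_fst).mul hmeas).aemeasurable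
  have key := hC (fun x => (∫⁻ t in Icc a b, ‖mulOp n (m t) h x‖ₑ ^ 2) ^ (1 / 2 : ℝ)) R'
    (ENNReal.ofReal (max (b - a) 0 * ((2 * Real.pi) ^ n * 4 ^ N * (A ^ 2 * B ^ 2))))
    (hGm.pow_const _) hR' ?_ ?_
  · have e : (∫⁻ x, (∫⁻ t in Icc a b, ‖mulOp n (m t) h x‖ₑ ^ 2) ^ (1 / 2 : ℝ)) ^ 2
        ≤ ENNReal.ofReal (Real.sqrt (C * ((2 * Real.pi) ^ n * 4 ^ N * (max (b - a) 0))) * A *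
          R' ^ (n / 2 : ℝ) * B) ^ 2 := by
      refine key.trans_eq ?_
      rw [← ENNReal.ofReal_pow (by positivity), ← ENNReal.ofReal_coe_nnreal,
        ← ENNReal.ofReal_mul (by positivity), ← ENNReal.ofReal_mul (by positivity)]
      congr 1
      rw [mul_pow _ B, mul_pow _ (R' ^ _), mul_pow _ A, Real.sq_sqrt (by positivity),
        ← Real.rpow_natCast (R' ^ (_ : ℝ)),
        ← Real.rpow_mul hR'.le]
      have : (n / 2 : ℝ) * (2 : ℕ) = (n : ℝ) := by push_cast; ring
      rw [this, Real.rpow_natCast]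
      ring
    exact (ENNReal.pow_le_pow_left_iff (by norm_num)).1 e
  · have := hsw (fun _ => 1) measurable_const ((2 * Real.pi) ^ n * 4 ^ N * (A ^ 2 * B ^ 2))
      (by positivity) (fun t ht => by
        simpa using hcoord ⟨0, hn⟩ 0 (Nat.zero_le _) t ht)
    simpa using this
  · intro j
    have := hsw (fun x => ENNReal.ofReal (|x j| ^ (2 * N))) (by fun_prop)
      ((2 * Real.pi) ^ n * 4 ^ N * (A ^ 2 * R' ^ (2 * N) * B ^ 2))
        (by positivity) (fun t ht => by
          refine le_trans (le_of_eq (lintegral_congr fun x => ?_)) (hcoord j N le_rfl t ht)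
          rw [enorm_mul, mul_pow, ← ofReal_norm ((x j : ℂ) ^ N), norm_pow, Complex.norm_real,
            ← ENNReal.ofReal_pow (by positivity), ← pow_mul, mul_comm N 2, Real.norm_eq_abs])
    refine this.trans_eq ?_
    rw [← ENNReal.ofReal_mul (by positivity)]
    congr 1
    ring

/-- `L¹` bound for a multiplier operator acting on an atom. -/
theorem SymbolBound.lintegral_atom_le {n N : ℕ} (hn : 2 ≤ n) (hN : n < 2 * N) (a b : ℝ) :
    ∃ C : ℝ, 0 ≤ C ∧ ∀ (m : ℝ → En n → ℂ) (A R ρ : ℝ), SymbolBound n N (Icc a b) m A R ρ →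
      0 ≤ A → 0 < R → 0 < ρ → 1 ≤ R * ρ →
      ∀ (h : En n → ℂ) (M r : ℝ) (c : En n), Measurable h → (∀ y, ‖h y‖ ≤ M) → 0 < r →
        (∀ y, r < ‖y - c‖ → h y = 0) → ∫ y, h y = 0 →
      ∫⁻ x, (∫⁻ t in Icc a b, ‖mulOp n (m t) h x‖ₑ ^ 2) ^ (1 / 2 : ℝ)
        ≤ ENNReal.ofReal (C * A * M * r ^ n *
          (1 + (R * ρ) ^ (n / 2 : ℝ) * min (r * ρ) (r * ρ)⁻¹)) := by
  obtain ⟨C, hC0, hC⟩ := SymbolBound.lintegral_mulOp_le (by omega : 0 < n) hN a b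
  set ω := (volume (closedBall (0 : En n) 1)).toReal with hω
  have hω0 : 0 ≤ ω := ENNReal.toReal_nonneg
  set C1 := Real.sqrt (2 ^ (n + 2) * ω ^ 3) with hC1
  set C2 := Real.sqrt ((2 * Real.pi) ^ n * ω) with hC2
  refine ⟨C * (C1 + C2), by positivity, ?_⟩
  intro m A R ρ hm hA hR hρ hRρ h M r c hh hM hr hs h0
  have hM0 : 0 ≤ M := (norm_nonneg _).trans (hM 0)
  have hinteg : Integrable fun y => h (y + c) :=
    integrable_of_bdd_supp (r := r) (M := M) (by fun_prop) (fun y => hM _)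
      fun y hy => hs _ (by simpa using hy)
  have hinteg' : Integrable h := by simpa using hinteg.comp_sub_right c
  have hmi : ∀ t, Integrable (m t) := fun t =>
    (hm.contDiff t).continuous.integrable_of_hasCompactSupport (hm.hasCompactSupport t)
  set g : En n → ℂ := fun y => h (y + c) with hg
  have hgm : Measurable g := by fun_prop
  have hgM : ∀ y, ‖g y‖ ≤ M := fun y => hM _
  have hgs : ∀ y, r < ‖y‖ → g y = 0 := fun y hy => hs _ (by simpa using hy)
  have hg0 : ∫ y, g y = 0 := by rw [hg, integral_add_right_eq_self, h0]
  have etrans : ∫⁻ x, (∫⁻ t in Icc a b, ‖mulOp n (m t) h x‖ₑ ^ 2) ^ (1 / 2 : ℝ)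
      = ∫⁻ x, (∫⁻ t in Icc a b, ‖mulOp n (m t) g x‖ₑ ^ 2) ^ (1 / 2 : ℝ) := by
    rw [← lintegral_add_right_eq_self _ c]
    simp_rw [hg, mulOp_translate (hmi _) hinteg' c]
  rw [etrans]
  have hsq : ∀ x : ℝ, 0 < x → (x ^ (n / 2 : ℝ)) ^ 2 = x ^ n := fun x hx => by
    rw [← Real.rpow_natCast (x ^ (_ : ℝ)), ← Real.rpow_mul hx.le]
    have : (n / 2 : ℝ) * (2 : ℕ) = (n : ℝ) := by push_cast; ring
    rw [this, Real.rpow_natCast]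
  have hRρn : (R * ρ) ^ (n / 2 : ℝ) = R ^ (n / 2 : ℝ) * ρ ^ (n / 2 : ℝ) :=
    Real.mul_rpow hR.le hρ.le
  rcases le_or_gt (r * ρ) 1 with hrρ | hrρ
  · have := hC m A R ρ R (C1 * (M * r ^ n * (r * ρ)) * ρ ^ (n / 2 : ℝ)) r g hm hA hR le_rfl hinteg
      (by positivity) hgs (fun j l => by
        refine (setLIntegral_ftP_coord_sq_le j l hgm hgM hr hgs hg0 hρ hrρ hRρ).trans_eq ?_
        congr 2
        rw [mul_pow _ (ρ ^ _), mul_pow C1, hsq ρ hρ, hC1, Real.sq_sqrt (by positivity)]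
        ring)
    refine this.trans (ENNReal.ofReal_le_ofReal ?_)
    have hmin : min (r * ρ) (r * ρ)⁻¹ = r * ρ :=
      min_eq_left (hrρ.trans ((one_le_inv₀ (by positivity)).2 hrρ))
    rw [hmin, hRρn]
    calc C * A * R ^ (n / 2 : ℝ) * (C1 * (M * r ^ n * (r * ρ)) * ρ ^ (n / 2 : ℝ))
        = C * C1 * A * M * r ^ n * (R ^ (n / 2 : ℝ) * ρ ^ (n / 2 : ℝ) * (r * ρ)) := by ring
      _ ≤ C * (C1 + C2) * A * M * r ^ n *
          (1 + R ^ (n / 2 : ℝ) * ρ ^ (n / 2 : ℝ) * (r * ρ)) := by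
        gcongr
        · exact le_add_of_nonneg_right (by positivity)
        · linarith
  · have := hC m A R ρ (max R r) (C2 * M * r ^ (n / 2 : ℝ)) r g hm hA hR (le_max_left _ _) hinteg
      (by positivity) hgs (fun j l => by
        refine (setLIntegral_le_lintegral _ _).trans ((lintegral_ftP_coord_sq_le j l hgm hgM hr hgs
          (le_max_right R r)).trans_eq ?_)
        congr 2
        rw [mul_pow _ (r ^ _), mul_pow C2, hsq r hr, hC2, Real.sq_sqrt (by positivity)]
        ring)
    refine this.trans (ENNReal.ofReal_le_ofReal ?_)
    have hmin : min (r * ρ) (r * ρ)⁻¹ = (r * ρ)⁻¹ :=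
      min_eq_right ((inv_le_one_of_one_le₀ hrρ.le).trans hrρ.le)
    rw [hmin, hRρn]
    have hmax : (max R r) ^ (n / 2 : ℝ) ≤ r ^ (n / 2 : ℝ) + R ^ (n / 2 : ℝ) := by
      have h1 : 0 ≤ r ^ (n / 2 : ℝ) := by positivity
      have h2 : 0 ≤ R ^ (n / 2 : ℝ) := by positivity
      rcases max_cases R r with ⟨h, _⟩ | ⟨h, _⟩ <;> rw [h] <;> linarith
    have hle : R ^ (n / 2 : ℝ) * r ^ (n / 2 : ℝ)
        ≤ r ^ n * (R ^ (n / 2 : ℝ) * ρ ^ (n / 2 : ℝ) * (r * ρ)⁻¹) := by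
      have h1 : r * ρ ≤ r ^ (n / 2 : ℝ) * ρ ^ (n / 2 : ℝ) := by
        rw [← Real.mul_rpow hr.le hρ.le]
        refine Real.self_le_rpow_of_one_le hrρ.le ?_
        rw [le_div_iff₀ (by norm_num)]
        exact_mod_cast (by omega : 1 * 2 ≤ n)
      rw [← hsq r hr]
      calc R ^ (n / 2 : ℝ) * r ^ (n / 2 : ℝ)
          = R ^ (n / 2 : ℝ) * r ^ (n / 2 : ℝ) * ((r * ρ) * (r * ρ)⁻¹) := by
            rw [mul_inv_cancel₀ (by positivity), mul_one]
        _ ≤ R ^ (n / 2 : ℝ) * r ^ (n / 2 : ℝ) *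
              ((r ^ (n / 2 : ℝ) * ρ ^ (n / 2 : ℝ)) * (r * ρ)⁻¹) := by gcongr
        _ = _ := by ring
    calc C * A * (max R r) ^ (n / 2 : ℝ) * (C2 * M * r ^ (n / 2 : ℝ))
        ≤ C * A * (r ^ (n / 2 : ℝ) + R ^ (n / 2 : ℝ)) * (C2 * M * r ^ (n / 2 : ℝ)) := by gcongr
      _ = C * C2 * A * M * ((r ^ (n / 2 : ℝ)) ^ 2 + R ^ (n / 2 : ℝ) * r ^ (n / 2 : ℝ)) := by ring
      _ ≤ C * (C1 + C2) * A * M *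
          (r ^ n + r ^ n * (R ^ (n / 2 : ℝ) * ρ ^ (n / 2 : ℝ) * (r * ρ)⁻¹)) := by
        rw [hsq r hr]
        gcongr
        exact le_add_of_nonneg_left (by positivity)
      _ = _ := by ring

/-- Smooth functions with compact support away from the origin. -/
structure IsAnnular {n : ℕ} (φ : En n → ℂ) : Prop where
  contDiff : ContDiff ℝ (⊤ : ℕ∞) φ
  compact : HasCompactSupport φ
  zero : (0 : En n) ∉ tsupport φ

theorem IsAnnular.mul_left {n : ℕ} {φ ψ : En n → ℂ} (hφ : IsAnnular φ)
    (hψ : ∀ ξ, ξ ≠ 0 → ContDiffAt ℝ (⊤ : ℕ∞) ψ ξ) : IsAnnular fun ξ => ψ ξ * φ ξ := by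
  refine ⟨contDiff_iff_contDiffAt.2 fun ξ => ?_, hφ.compact.mul_left, fun h =>
    hφ.zero (tsupport_mul_subset_right h)⟩
  by_cases hξ : ξ ∈ tsupport φ
  · exact (hψ ξ fun h => hφ.zero (h ▸ hξ)).mul hφ.contDiff.contDiffAt
  · have h1 : φ =ᶠ[𝓝 ξ] 0 := notMem_tsupport_iff_eventuallyEq.1 hξ
    have h2 : (fun ξ => ψ ξ * φ ξ) =ᶠ[𝓝 ξ] fun _ => 0 := by
      filter_upwards [h1] with ζ hζ
      rw [hζ]; simp
    exact contDiffAt_const.congr_of_eventuallyEq h2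

theorem IsAnnular.pderiv {n : ℕ} {φ : En n → ℂ} (hφ : IsAnnular φ) (j : Fin n) :
    IsAnnular (pderiv j φ) :=
  ⟨contDiff_pderiv j hφ.contDiff, hasCompactSupport_pderiv j hφ.compact,
    fun h => hφ.zero (pderiv_support_subset j φ h)⟩

theorem pderiv_eq_of_hasDerivAt {n : ℕ} {j : Fin n} {m : En n → ℂ} {ξ : En n} {d : ℂ}
    (hm : DifferentiableAt ℝ m ξ)
    (h : HasDerivAt (fun s : ℝ => m (ξ + s • EuclideanSpace.single j 1)) d 0) :
    pderiv j m ξ = d := by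
  rw [pderiv, ← hm.lineDeriv_eq_fderiv, lineDeriv, h.deriv]

theorem hasDerivAt_line {n : ℕ} (j : Fin n) {m : En n → ℂ} (ξ : En n)
    (hm : DifferentiableAt ℝ m ξ) :
    HasDerivAt (fun s : ℝ => m (ξ + s • EuclideanSpace.single j 1)) (pderiv j m ξ) 0 :=
  hm.hasFDerivAt.hasLineDerivAt _

theorem hasDerivAt_norm_rpow_line {n : ℕ} (j : Fin n) (ξ : En n) {γ : ℝ} (hγ : 1 < γ) :
    HasDerivAt (fun s : ℝ => ‖ξ + s • (EuclideanSpace.single j 1 : En n)‖ ^ γ)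
      (γ * ‖ξ‖ ^ (γ - 2) * ξ j) 0 := by
  have := (hasFDerivAt_norm_rpow ξ hγ).hasLineDerivAt (EuclideanSpace.single j 1)
  simpa [HasLineDerivAt, EuclideanSpace.inner_single_right] using this

/-- The oscillating symbols `φ(ξ) (a + b|ξ|²)^{-s} (e^{iμ|ξ|^γ} - ε)`. -/
def oscSymbol {n : ℕ} (γ : ℝ) (ε : ℂ) (a b μ : ℝ) (s : ℝ) (φ : En n → ℂ) (ξ : En n) : ℂ :=
  (((a + b * ‖ξ‖ ^ 2) ^ (-s) : ℝ) : ℂ) *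
    (Complex.exp (Complex.I * ((μ * ‖ξ‖ ^ γ : ℝ) : ℂ)) - ε) * φ ξ

/-- Admissible parameters for `oscSymbol`. -/
def AdmParam (a b : ℝ) : Prop := (a = 1 ∧ 0 ≤ b ∧ b ≤ 1) ∨ (b = 1 ∧ 0 ≤ a ∧ a ≤ 1)

theorem AdmParam.min_le {a b : ℝ} (h : AdmParam a b) {c x : ℝ} (hc : 0 ≤ c) (hx : c ≤ x) :
    min 1 (c ^ 2) ≤ a + b * x ^ 2 := by
  rcases h with ⟨rfl, h0, -⟩ | ⟨rfl, h0, -⟩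
  · exact (min_le_left _ _).trans (by nlinarith [sq_nonneg x])
  · refine (min_le_right _ _).trans ?_
    have : c ^ 2 ≤ x ^ 2 := by gcongr
    linarith

theorem AdmParam.pos {a b : ℝ} (h : AdmParam a b) {x : ℝ} (hx : 0 < x) : 0 < a + b * x ^ 2 :=
  lt_of_lt_of_le (by positivity) (h.min_le hx.le le_rfl)

theorem contDiffAt_norm_rpow {n : ℕ} (γ : ℝ) {ξ : En n} (hξ : ξ ≠ 0) :
    ContDiffAt ℝ (⊤ : ℕ∞) (fun ξ : En n => ‖ξ‖ ^ γ) ξ :=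
  (contDiffAt_norm ℝ hξ).rpow_const_of_ne (norm_ne_zero_iff.2 hξ)

theorem contDiffAt_ofReal {n : ℕ} {f : En n → ℝ} {ξ : En n} (hf : ContDiffAt ℝ (⊤ : ℕ∞) f ξ) :
    ContDiffAt ℝ (⊤ : ℕ∞) (fun ξ => (f ξ : ℂ)) ξ :=
  Complex.ofRealCLM.contDiff.contDiffAt.comp ξ hf

theorem isAnnular_oscSymbol {n : ℕ} (γ : ℝ) (ε : ℂ) {a b : ℝ} (hab : AdmParam a b) (μ s : ℝ)
    {φ : En n → ℂ} (hφ : IsAnnular φ) : IsAnnular (oscSymbol γ ε a b μ s φ) := by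
  refine hφ.mul_left fun ξ hξ => ?_
  have h1 : ContDiffAt ℝ (⊤ : ℕ∞) (fun ξ : En n => (a + b * ‖ξ‖ ^ 2) ^ (-s)) ξ :=
    ContDiffAt.rpow_const_of_ne (contDiffAt_const.add
      (contDiffAt_const.mul (contDiff_norm_sq ℝ).contDiffAt))
      (hab.pos (norm_pos_iff.2 hξ)).ne'
  have h2 : ContDiffAt ℝ (⊤ : ℕ∞) (fun ξ : En n => μ * ‖ξ‖ ^ γ) ξ :=
    contDiffAt_const.mul (contDiffAt_norm_rpow γ hξ)
  exact (contDiffAt_ofReal h1).mul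
    ((contDiffAt_const.mul (contDiffAt_ofReal h2)).cexp.sub contDiffAt_const)

theorem pderiv_oscSymbol {n : ℕ} {γ : ℝ} (hγ : 1 < γ) (ε : ℂ) {a b : ℝ} (hab : AdmParam a b)
    (μ s : ℝ) {φ : En n → ℂ} (hφ : IsAnnular φ) (j : Fin n) :
    pderiv j (oscSymbol γ ε a b μ s φ) = fun ξ =>
      oscSymbol γ ε a b μ s (pderiv j φ) ξ +
      ((((-2 * s * b : ℝ) : ℂ) * oscSymbol γ ε a b μ (s + 1) (fun ξ => (ξ j : ℂ) * φ ξ) ξ) +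
      (Complex.I * (μ : ℂ)) * oscSymbol γ 0 a b μ s
        (fun ξ => ((γ * ‖ξ‖ ^ (γ - 2) * ξ j : ℝ) : ℂ) * φ ξ) ξ) := by
  funext ξ
  by_cases hξ : ξ = 0
  · have h0 : ∀ {ψ : En n → ℂ}, IsAnnular ψ → ψ 0 = 0 := fun h =>
      image_eq_zero_of_notMem_tsupport h.zero
    rw [hξ, h0 ((isAnnular_oscSymbol γ ε hab μ s hφ).pderiv j)]
    simp [oscSymbol, h0 hφ, h0 (hφ.pderiv j)]
  have hpos := hab.pos (norm_pos_iff.2 hξ)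
  refine pderiv_eq_of_hasDerivAt
    ((isAnnular_oscSymbol γ ε hab μ s hφ).contDiff.differentiable (by simp) ξ) ?_
  unfold oscSymbol
  have hsq := (hasDerivAt_norm_rpow_line j ξ (γ := 2) (by norm_num))
  simp only [Real.rpow_two, sub_self, Real.rpow_zero, mul_one] at hsq
  have hA := ((hsq.const_mul b).const_add a).rpow_const (p := -s)
    (Or.inl (by simpa using hpos.ne'))
  have hE := ((((hasDerivAt_norm_rpow_line j ξ hγ).const_mul μ).ofReal_comp).const_mul
    Complex.I).cexp.sub_const ε
  have hf := hasDerivAt_line j ξ (hφ.contDiff.differentiable (by simp) ξ)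
  have := (hA.ofReal_comp.mul hE).mul hf
  simp only [zero_smul, add_zero, Pi.mul_apply] at this
  refine this.congr_deriv ?_
  have hs : -s - 1 = -(s + 1) := by ring
  rw [hs]
  push_cast
  ring

theorem pderiv_iterate_add {n : ℕ} (j : Fin n) (i : ℕ) {f g : En n → ℂ}
    (hf : ContDiff ℝ (⊤ : ℕ∞) f) (hg : ContDiff ℝ (⊤ : ℕ∞) g) :
    (pderiv j)^[i] (fun ξ => f ξ + g ξ) = fun ξ => (pderiv j)^[i] f ξ + (pderiv j)^[i] g ξ := by
  induction i generalizing f g with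
  | zero => rfl
  | succ i ih =>
    simp only [Function.iterate_succ, Function.comp]
    rw [← ih (contDiff_pderiv j hf) (contDiff_pderiv j hg)]
    congr 1
    funext ξ
    rw [pderiv, fderiv_fun_add (hf.differentiable (by simp) ξ) (hg.differentiable (by simp) ξ)]
    rfl

theorem pderiv_iterate_const_mul {n : ℕ} (j : Fin n) (i : ℕ) (c : ℂ) {f : En n → ℂ}
    (hf : ContDiff ℝ (⊤ : ℕ∞) f) :
    (pderiv j)^[i] (fun ξ => c * f ξ) = fun ξ => c * (pderiv j)^[i] f ξ := by
  induction i generalizing f with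
  | zero => rfl
  | succ i ih =>
    simp only [Function.iterate_succ, Function.comp]
    rw [← ih (contDiff_pderiv j hf)]
    congr 1
    funext ξ
    rw [pderiv, fderiv_const_mul (hf.differentiable (by simp) ξ)]
    rfl

theorem pderiv_iterate_comp_smul {n : ℕ} (j : Fin n) (i : ℕ) (c : ℝ) {f : En n → ℂ}
    (hf : ContDiff ℝ (⊤ : ℕ∞) f) :
    (pderiv j)^[i] (fun ξ => f (c • ξ)) = fun ξ => (c : ℂ) ^ i * (pderiv j)^[i] f (c • ξ) := by
  induction i generalizing f with
  | zero => simp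
  | succ i ih =>
    have h1 : pderiv j (fun ξ => f (c • ξ)) = fun ξ => (c : ℂ) * pderiv j f (c • ξ) := by
      funext ξ
      rw [pderiv, fderiv_comp_smul (f := f), pderiv]
      simp
    have hs : ContDiff ℝ (⊤ : ℕ∞) fun ξ : En n => pderiv j f (c • ξ) :=
      (contDiff_pderiv j hf).comp (contDiff_const_smul c)
    rw [Function.iterate_succ, Function.comp, h1, pderiv_iterate_const_mul j i _ hs,
      ih (contDiff_pderiv j hf), Function.comp]
    funext ξ
    ring

theorem IsAnnular.amplitude_bound {n : ℕ} {φ : En n → ℂ} (hφ : IsAnnular φ) {s : ℝ} (hs : 0 ≤ s) :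
    ∃ C : ℝ, 0 ≤ C ∧ ∀ a b, AdmParam a b → ∀ ξ : En n, (a + b * ‖ξ‖ ^ 2) ^ (-s) * ‖φ ξ‖ ≤ C := by
  obtain ⟨c, hc, hcs⟩ := Metric.isOpen_iff.1 (isClosed_tsupport φ).isOpen_compl 0 hφ.zero
  obtain ⟨M, hM⟩ := hφ.compact.exists_bound_of_continuous hφ.contDiff.continuous
  have hM0 : 0 ≤ M := (norm_nonneg _).trans (hM 0)
  refine ⟨(min 1 (c ^ 2)) ^ (-s) * M, by positivity, fun a b hab ξ => ?_⟩
  by_cases h : φ ξ = 0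
  · rw [h]; simp; positivity
  have hcξ : c ≤ ‖ξ‖ := by
    by_contra hlt
    exact hcs (show ξ ∈ ball 0 c by simpa using hlt) (subset_tsupport _ h)
  refine mul_le_mul ?_ (hM ξ) (norm_nonneg _) (by positivity)
  exact Real.rpow_le_rpow_of_nonpos (by positivity) (hab.min_le hc.le hcξ) (by linarith)

theorem isAnnular_coord_mul {n : ℕ} {φ : En n → ℂ} (hφ : IsAnnular φ) (j : Fin n) :
    IsAnnular fun ξ => (ξ j : ℂ) * φ ξ := by
  refine hφ.mul_left fun ξ _ => contDiffAt_ofReal (ContDiff.contDiffAt ?_)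
  exact (EuclideanSpace.proj j : En n →L[ℝ] ℝ).contDiff

theorem isAnnular_gradPhase_mul {n : ℕ} (γ : ℝ) {φ : En n → ℂ} (hφ : IsAnnular φ) (j : Fin n) :
    IsAnnular fun ξ => ((γ * ‖ξ‖ ^ (γ - 2) * ξ j : ℝ) : ℂ) * φ ξ := by
  refine hφ.mul_left fun ξ hξ => contDiffAt_ofReal ?_
  exact (contDiffAt_const.mul (contDiffAt_norm_rpow _ hξ)).mul
    (EuclideanSpace.proj j : En n →L[ℝ] ℝ).contDiff.contDiffAt

theorem pderiv_iterate_succ_oscSymbol {n : ℕ} {γ : ℝ} (hγ : 1 < γ) (ε : ℂ) {a b : ℝ}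
    (hab : AdmParam a b) (μ s : ℝ) {φ : En n → ℂ} (hφ : IsAnnular φ) (j : Fin n) (i : ℕ)
    (ξ : En n) :
    ‖(pderiv j)^[i + 1] (oscSymbol γ ε a b μ s φ) ξ‖ ≤
      ‖(pderiv j)^[i] (oscSymbol γ ε a b μ s (pderiv j φ)) ξ‖ +
      (2 * |s| * ‖(pderiv j)^[i] (oscSymbol γ ε a b μ (s + 1) (fun ξ => (ξ j : ℂ) * φ ξ)) ξ‖ +
      |μ| * ‖(pderiv j)^[i] (oscSymbol γ 0 a b μ s
        (fun ξ => ((γ * ‖ξ‖ ^ (γ - 2) * ξ j : ℝ) : ℂ) * φ ξ)) ξ‖) := by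
  have h1 := (isAnnular_oscSymbol γ ε hab μ s (hφ.pderiv j)).contDiff
  have h2 := (isAnnular_oscSymbol γ ε hab μ (s + 1) (isAnnular_coord_mul hφ j)).contDiff
  have h3 := (isAnnular_oscSymbol γ 0 hab μ s (isAnnular_gradPhase_mul γ hφ j)).contDiff
  rw [Function.iterate_succ, Function.comp, pderiv_oscSymbol hγ ε hab μ s hφ j,
    pderiv_iterate_add j i h1 ((contDiff_const.mul h2).add (contDiff_const.mul h3)),
    pderiv_iterate_add j i (contDiff_const.mul h2) (contDiff_const.mul h3),
    pderiv_iterate_const_mul j i _ h2, pderiv_iterate_const_mul j i _ h3]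
  refine (norm_add_le _ _).trans (add_le_add le_rfl ((norm_add_le _ _).trans (add_le_add ?_ ?_)))
  · rw [norm_mul, Complex.norm_real, Real.norm_eq_abs]
    gcongr
    have hb : |b| ≤ 1 := by
      rcases hab with ⟨-, h, h'⟩ | ⟨rfl, -⟩
      · rwa [abs_of_nonneg h]
      · simp
    rw [abs_mul, abs_mul, abs_neg, abs_two]
    exact mul_le_of_le_one_right (by positivity) hb
  · rw [norm_mul, norm_mul, Complex.norm_I, one_mul, Complex.norm_real, Real.norm_eq_abs]

theorem oscSymbol_bound {n : ℕ} {γ : ℝ} (hγ : 1 < γ) (j : Fin n) (i : ℕ) {φ : En n → ℂ}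
    (hφ : IsAnnular φ) {s : ℝ} (hs : 0 ≤ s) :
    ∃ C : ℝ, 0 ≤ C ∧ ∀ a b, AdmParam a b → ∀ (μ : ℝ) (ξ : En n),
      ‖(pderiv j)^[i] (oscSymbol γ 0 a b μ s φ) ξ‖ ≤ C * (1 + |μ|) ^ i := by
  induction i generalizing φ s with
  | zero =>
    obtain ⟨C, hC0, hC⟩ := hφ.amplitude_bound hs
    refine ⟨C, hC0, fun a b hab μ ξ => ?_⟩
    have h0 : 0 ≤ a + b * ‖ξ‖ ^ 2 := le_trans (by positivity) (hab.min_le le_rfl (norm_nonneg ξ))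
    simp only [Function.iterate_zero, id, oscSymbol, sub_zero, pow_zero, mul_one, norm_mul]
    rw [mul_comm Complex.I, Complex.norm_exp_ofReal_mul_I, mul_one, Complex.norm_real,
      Real.norm_eq_abs,
      abs_of_nonneg (by positivity)]
    exact hC a b hab ξ
  | succ i ih =>
    obtain ⟨C1, h10, h1⟩ := ih (hφ.pderiv j) hs
    obtain ⟨C2, h20, h2⟩ := ih (isAnnular_coord_mul hφ j) (s := s + 1) (by linarith)
    obtain ⟨C3, h30, h3⟩ := ih (isAnnular_gradPhase_mul γ hφ j) hs
    refine ⟨C1 + 2 * |s| * C2 + C3, by positivity, fun a b hab μ ξ => ?_⟩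
    refine (pderiv_iterate_succ_oscSymbol hγ 0 hab μ s hφ j i ξ).trans ?_
    have hp : (0:ℝ) ≤ (1 + |μ|) ^ i := by positivity
    calc _ ≤ C1 * (1 + |μ|) ^ i + (2 * |s| * (C2 * (1 + |μ|) ^ i) + |μ| *
        (C3 * (1 + |μ|) ^ i)) := by
          gcongr
          · exact h1 a b hab μ ξ
          · exact h2 a b hab μ ξ
          · exact h3 a b hab μ ξ
      _ ≤ (C1 + 2 * |s| * C2 + C3) * (1 + |μ|) ^ (i + 1) := by
          rw [pow_succ]
          have hμ := abs_nonneg μ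
          have e1 : 0 ≤ C1 * (1 + |μ|) ^ i * |μ| := by positivity
          have e2 : 0 ≤ |s| * C2 * (1 + |μ|) ^ i * |μ| := by positivity
          have e3 : 0 ≤ C3 * (1 + |μ|) ^ i := by positivity
          nlinarith

theorem oscSymbol_sub_one_bound {n : ℕ} {γ : ℝ} (hγ : 1 < γ) (j : Fin n) (i : ℕ) {φ : En n → ℂ}
    (hφ : IsAnnular φ) {s : ℝ} (hs : 0 ≤ s) {T : ℝ} (hT : 0 ≤ T) :
    ∃ C : ℝ, 0 ≤ C ∧ ∀ a b, AdmParam a b → ∀ (μ : ℝ), |μ| ≤ T → ∀ (ξ : En n),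
      ‖(pderiv j)^[i] (oscSymbol γ 1 a b μ s φ) ξ‖ ≤ C * |μ| := by
  induction i generalizing φ s with
  | zero =>
    obtain ⟨C, hC0, hC⟩ := (hφ.mul_left (ψ := fun ξ => ((‖ξ‖ ^ γ : ℝ) : ℂ))
      (fun ξ hξ => contDiffAt_ofReal (contDiffAt_norm_rpow γ hξ))).amplitude_bound hs
    refine ⟨C, hC0, fun a b hab μ _ ξ => ?_⟩
    have h0 : 0 ≤ a + b * ‖ξ‖ ^ 2 := le_trans (by positivity) (hab.min_le le_rfl (norm_nonneg ξ))
    simp only [Function.iterate_zero, id, oscSymbol, norm_mul]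
    rw [Complex.norm_real, Real.norm_eq_abs, abs_of_nonneg (by positivity)]
    have h1 := hC a b hab ξ
    rw [norm_mul, Complex.norm_real, Real.norm_eq_abs, abs_of_nonneg (by positivity)] at h1
    have h2 : ‖Complex.exp (Complex.I * ((μ * ‖ξ‖ ^ γ : ℝ) : ℂ)) - 1‖ ≤ |μ| * ‖ξ‖ ^ γ := by
      refine Real.norm_exp_I_mul_ofReal_sub_one_le.trans_eq ?_
      rw [norm_mul, Real.norm_eq_abs, Real.norm_eq_abs, abs_of_nonneg (by positivity : 0 ≤ ‖ξ‖ ^ γ)]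
    calc _ ≤ (a + b * ‖ξ‖ ^ 2) ^ (-s) * (|μ| * ‖ξ‖ ^ γ) * ‖φ ξ‖ := by gcongr
      _ = ((a + b * ‖ξ‖ ^ 2) ^ (-s) * (‖ξ‖ ^ γ * ‖φ ξ‖)) * |μ| := by ring
      _ ≤ _ := by gcongr
  | succ i ih =>
    obtain ⟨C1, h10, h1⟩ := ih (hφ.pderiv j) hs
    obtain ⟨C2, h20, h2⟩ := ih (isAnnular_coord_mul hφ j) (s := s + 1) (by linarith)
    obtain ⟨C3, h30, h3⟩ := oscSymbol_bound hγ j i (isAnnular_gradPhase_mul γ hφ j) hs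
    refine ⟨C1 + 2 * |s| * C2 + C3 * (1 + T) ^ i, by positivity, fun a b hab μ hμ ξ => ?_⟩
    refine (pderiv_iterate_succ_oscSymbol hγ 1 hab μ s hφ j i ξ).trans ?_
    calc _ ≤ C1 * |μ| + (2 * |s| * (C2 * |μ|) + |μ| * (C3 * (1 + T) ^ i)) := by
          gcongr
          · exact h1 a b hab μ hμ ξ
          · exact h2 a b hab μ hμ ξ
          · refine (h3 a b hab μ ξ).trans ?_
            gcongr
      _ = _ := by ring

/-- A smooth radial cutoff, equal to `1` on the unit ball and to `0` outside the ball of radius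
`2`. -/
def lowCut {n : ℕ} (ξ : En n) : ℝ := Real.smoothTransition (2 - ‖ξ‖ ^ 2)

/-- The associated Littlewood–Paley function. -/
def lpCut {n : ℕ} (ξ : En n) : ℝ := lowCut ξ - lowCut ((2 : ℝ) • ξ)

theorem contDiff_lowCut {n : ℕ} : ContDiff ℝ (⊤ : ℕ∞) (lowCut (n := n)) :=
  Real.smoothTransition.contDiff.comp (contDiff_const.sub (contDiff_norm_sq ℝ))

theorem lowCut_nonneg {n : ℕ} (ξ : En n) : 0 ≤ lowCut ξ := Real.smoothTransition.nonneg _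

theorem lowCut_le_one {n : ℕ} (ξ : En n) : lowCut ξ ≤ 1 := Real.smoothTransition.le_one _

theorem lowCut_eq_one {n : ℕ} {ξ : En n} (h : ‖ξ‖ ≤ 1) : lowCut ξ = 1 :=
  Real.smoothTransition.one_of_one_le (by nlinarith [norm_nonneg ξ])

theorem lowCut_eq_zero {n : ℕ} {ξ : En n} (h : 2 ≤ ‖ξ‖) : lowCut ξ = 0 :=
  Real.smoothTransition.zero_of_nonpos (by nlinarith [norm_nonneg ξ])

theorem lpCut_nonneg {n : ℕ} (ξ : En n) : 0 ≤ lpCut ξ := by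
  refine sub_nonneg.2 (Real.smoothTransition.monotone ?_)
  rw [norm_smul, mul_pow]
  norm_num
  nlinarith [sq_nonneg ‖ξ‖]

theorem contDiff_lpCut {n : ℕ} : ContDiff ℝ (⊤ : ℕ∞) (lpCut (n := n)) :=
  contDiff_lowCut.sub (contDiff_lowCut.comp (contDiff_const_smul (2 : ℝ)))

theorem lpCut_eq_zero_of_le {n : ℕ} {ξ : En n} (h : ‖ξ‖ ≤ 1 / 2) : lpCut ξ = 0 := by
  rw [lpCut, lowCut_eq_one (by linarith), lowCut_eq_one (by rw [norm_smul]; norm_num; linarith),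
    sub_self]

theorem lpCut_eq_zero_of_ge {n : ℕ} {ξ : En n} (h : 2 ≤ ‖ξ‖) : lpCut ξ = 0 := by
  rw [lpCut, lowCut_eq_zero h, lowCut_eq_zero (by rw [norm_smul]; norm_num; linarith), sub_self]

theorem isAnnular_lpCut {n : ℕ} : IsAnnular fun ξ : En n => (lpCut ξ : ℂ) := by
  refine ⟨Complex.ofRealCLM.contDiff.comp contDiff_lpCut,
    HasCompactSupport.intro (isCompact_closedBall (0 : En n) 2) fun ξ hξ => ?_, ?_⟩
  · rw [lpCut_eq_zero_of_ge (by simpa using (le_of_lt (by simpa using hξ))), Complex.ofReal_zero]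
  · rw [notMem_tsupport_iff_eventuallyEq]
    filter_upwards [ball_mem_nhds (0 : En n) (by norm_num : (0:ℝ) < 1 / 2)] with ξ hξ
    rw [lpCut_eq_zero_of_le (by simpa using (le_of_lt (by simpa using hξ)))]
    simp

theorem oscSymbol_comp_smul_high {n : ℕ} (γ : ℝ) (ε : ℂ) (t s : ℝ) (φ : En n → ℂ) {c : ℝ}
    (hc : 0 < c) :
    oscSymbol γ ε 1 1 t s (fun ξ => φ (c • ξ)) = fun ξ =>
      ((c ^ (2 * s) : ℝ) : ℂ) * oscSymbol γ ε (c ^ 2) 1 (t * c ^ (-γ)) s φ (c • ξ) := by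
  funext ξ
  unfold oscSymbol
  have h1 : (1 + 1 * ‖ξ‖ ^ 2) ^ (-s) = c ^ (2 * s) * (c ^ 2 + 1 * ‖c • ξ‖ ^ 2) ^ (-s) := by
    have e : c ^ 2 + 1 * ‖c • ξ‖ ^ 2 = c ^ 2 * (1 + 1 * ‖ξ‖ ^ 2) := by
      rw [norm_smul, Real.norm_of_nonneg hc.le]; ring
    rw [e, Real.mul_rpow (by positivity) (by positivity), ← mul_assoc, ← Real.rpow_natCast c 2,
      ← Real.rpow_mul hc.le, ← Real.rpow_add hc]
    have : 2 * s + ((2 : ℕ) : ℝ) * -s = 0 := by push_cast; ring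
    rw [this, Real.rpow_zero, one_mul (_ ^ (-s))]
  have h2 : t * c ^ (-γ) * ‖c • ξ‖ ^ γ = t * ‖ξ‖ ^ γ := by
    rw [norm_smul, Real.norm_of_nonneg hc.le, Real.mul_rpow hc.le (norm_nonneg _),
      Real.rpow_neg hc.le]
    have : c ^ γ ≠ 0 := by positivity
    field_simp
  rw [h1, h2]
  push_cast
  ring

theorem oscSymbol_comp_smul_low {n : ℕ} (γ : ℝ) (ε : ℂ) (t s : ℝ) (φ : En n → ℂ) {c : ℝ}
    (hc : 0 < c) :
    oscSymbol γ ε 1 1 t s (fun ξ => φ (c • ξ)) = fun ξ =>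
      oscSymbol γ ε 1 (c ^ 2)⁻¹ (t * c ^ (-γ)) s φ (c • ξ) := by
  funext ξ
  unfold oscSymbol
  have h1 : 1 + (c ^ 2)⁻¹ * ‖c • ξ‖ ^ 2 = 1 + 1 * ‖ξ‖ ^ 2 := by
    rw [norm_smul, Real.norm_of_nonneg hc.le]; field_simp
  have h2 : t * c ^ (-γ) * ‖c • ξ‖ ^ γ = t * ‖ξ‖ ^ γ := by
    rw [norm_smul, Real.norm_of_nonneg hc.le, Real.mul_rpow hc.le (norm_nonneg _),
      Real.rpow_neg hc.le]
    have : c ^ γ ≠ 0 := by positivity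
    field_simp
  rw [h1, h2]

theorem continuous_oscSymbol {n : ℕ} {γ : ℝ} (hγ : 0 ≤ γ) (ε : ℂ) (s : ℝ) {φ : En n → ℂ}
    (hφ : Continuous φ) :
    Continuous (Function.uncurry fun t => oscSymbol γ ε 1 1 t s φ) := by
  unfold oscSymbol Function.uncurry
  have h1 : Continuous fun q : ℝ × En n => (1 + 1 * ‖q.2‖ ^ 2) ^ (-s) :=
    Continuous.rpow_const (by fun_prop) fun q => Or.inl (by positivity)
  have h2 : Continuous fun q : ℝ × En n => ‖q.2‖ ^ γ :=
    Continuous.rpow_const (by fun_prop) fun q => Or.inr hγ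
  fun_prop

theorem exists_uniform_bound {n : ℕ} (N : ℕ) {P : Fin n → ℕ → ℝ → Prop}
    (hP : ∀ j i, ∃ C, 0 ≤ C ∧ P j i C) (hmono : ∀ j i C C', C ≤ C' → P j i C → P j i C') :
    ∃ C, 0 ≤ C ∧ ∀ j, ∀ i ≤ N, P j i C := by
  choose C hC0 hC using hP
  refine ⟨∑ j, ∑ i ∈ Finset.range (N + 1), C j i,
    Finset.sum_nonneg fun j _ => Finset.sum_nonneg fun i _ => hC0 j i, fun j i hi => ?_⟩
  refine hmono j i _ _ ?_ (hC j i)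
  calc C j i ≤ ∑ i ∈ Finset.range (N + 1), C j i :=
        Finset.single_le_sum (f := fun i => C j i) (fun i _ => hC0 j i) (by simp; omega)
    _ ≤ _ := Finset.single_le_sum (f := fun j => ∑ i ∈ Finset.range (N + 1), C j i)
        (fun j _ => Finset.sum_nonneg fun i _ => hC0 j i) (Finset.mem_univ j)

theorem symbolBound_high {n : ℕ} (N : ℕ) {γ : ℝ} (hγ : 1 < γ) {s : ℝ} (hs : 0 ≤ s) {a b T : ℝ}
    (hT : ∀ t ∈ Icc a b, |t| ≤ T) :
    ∃ C : ℝ, 0 ≤ C ∧ ∀ c : ℝ, 0 < c → c ≤ 1 → SymbolBound n N (Icc a b)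
      (fun t => oscSymbol γ 0 1 1 t s fun ξ => (lpCut (c • ξ) : ℂ))
      (C * c ^ (2 * s)) ((1 + T) * c ^ (1 - γ)) c⁻¹ := by
  obtain ⟨C, hC0, hC⟩ := exists_uniform_bound (n := n) N
    (P := fun j i C => ∀ a b, AdmParam a b → ∀ (μ : ℝ) (ξ : En n),
      ‖(pderiv j)^[i] (oscSymbol γ 0 a b μ s fun ξ => (lpCut ξ : ℂ)) ξ‖ ≤ C * (1 + |μ|) ^ i)
    (fun j i => oscSymbol_bound hγ j i isAnnular_lpCut hs)
    (fun j i C C' h hP a b hab μ ξ => (hP a b hab μ ξ).trans (by gcongr))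
  refine ⟨C, hC0, fun c hc hc1 => ⟨continuous_oscSymbol (by linarith) _ _ ?_, fun t => ?_,
    fun t ξ hξ => ?_, fun t ht j i hi ξ => ?_⟩⟩
  · have := (contDiff_lpCut (n := n)).continuous
    fun_prop
  · rw [oscSymbol_comp_smul_high γ 0 t s (fun ξ => (lpCut ξ : ℂ)) hc]
    exact contDiff_const.mul ((isAnnular_oscSymbol γ 0
      (Or.inr ⟨rfl, by positivity, pow_le_one₀ hc.le hc1⟩)
      _ s isAnnular_lpCut).contDiff.comp (contDiff_const_smul c))
  · simp only [oscSymbol]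
    rw [lpCut_eq_zero_of_ge, Complex.ofReal_zero, mul_zero]
    rw [norm_smul, Real.norm_of_nonneg hc.le]
    rw [← div_eq_mul_inv, div_lt_iff₀ hc] at hξ
    linarith
  · have hadm : AdmParam (c ^ 2) 1 := Or.inr ⟨rfl, by positivity, pow_le_one₀ hc.le hc1⟩
    have hsm := (isAnnular_oscSymbol (n := n) γ 0 hadm (t * c ^ (-γ)) s isAnnular_lpCut).contDiff
    have hsm' : ContDiff ℝ (⊤ : ℕ∞) fun ξ : En n =>
        oscSymbol γ 0 (c ^ 2) 1 (t * c ^ (-γ)) s (fun ξ => (lpCut ξ : ℂ)) (c • ξ) :=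
      hsm.comp (contDiff_const_smul c)
    rw [oscSymbol_comp_smul_high γ 0 t s (fun ξ => (lpCut ξ : ℂ)) hc,
      pderiv_iterate_const_mul j i _ hsm', pderiv_iterate_comp_smul j i c hsm]
    rw [norm_mul, norm_mul, norm_pow, Complex.norm_real, Complex.norm_real,
      Real.norm_of_nonneg hc.le, Real.norm_of_nonneg (by positivity)]
    have h1 := hC j i hi _ _ hadm (t * c ^ (-γ)) (c • ξ)
    have h2 : (1 + |t * c ^ (-γ)|) * c ≤ (1 + T) * c ^ (1 - γ) := by
      have e1 : c ^ (1 - γ) = c ^ (-γ) * c := by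
        rw [← Real.rpow_add_one hc.ne']; congr 1; ring
      have e2 : 1 ≤ c ^ (-γ) := Real.one_le_rpow_of_pos_of_le_one_of_nonpos hc hc1 (by linarith)
      rw [abs_mul, abs_of_nonneg (by positivity : 0 ≤ c ^ (-γ)), e1, ← mul_assoc]
      gcongr
      have := mul_le_mul_of_nonneg_right (hT t ht) (by positivity : 0 ≤ c ^ (-γ))
      linarith
    calc _ ≤ c ^ (2 * s) * (c ^ i * (C * (1 + |t * c ^ (-γ)|) ^ i)) := by gcongr
      _ = C * c ^ (2 * s) * ((1 + |t * c ^ (-γ)|) * c) ^ i := by rw [mul_pow]; ring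
      _ ≤ _ := by gcongr

theorem symbolBound_low {n : ℕ} (N : ℕ) {γ : ℝ} (hγ : 1 < γ) {s : ℝ} (hs : 0 ≤ s) {a b T : ℝ}
    (hT : ∀ t ∈ Icc a b, |t| ≤ T) (hT0 : 0 ≤ T) :
    ∃ C : ℝ, 0 ≤ C ∧ ∀ c : ℝ, 1 ≤ c → SymbolBound n N (Icc a b)
      (fun t => oscSymbol γ 1 1 1 t s fun ξ => (lpCut (c • ξ) : ℂ)) (C * c ^ (-γ)) c c⁻¹ := by
  obtain ⟨C, hC0, hC⟩ := exists_uniform_bound (n := n) N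
    (P := fun j i C => ∀ a b, AdmParam a b → ∀ (μ : ℝ), |μ| ≤ T → ∀ (ξ : En n),
      ‖(pderiv j)^[i] (oscSymbol γ 1 a b μ s fun ξ => (lpCut ξ : ℂ)) ξ‖ ≤ C * |μ|)
    (fun j i => oscSymbol_sub_one_bound hγ j i isAnnular_lpCut hs hT0)
    (fun j i C C' h hP a b hab μ hμ ξ => (hP a b hab μ hμ ξ).trans (by gcongr))
  refine ⟨C * T, by positivity, fun c hc1 => ?_⟩
  have hc : 0 < c := by linarith
  have hadm : AdmParam 1 (c ^ 2)⁻¹ :=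
    Or.inl ⟨rfl, by positivity, inv_le_one_of_one_le₀ (one_le_pow₀ hc1)⟩
  refine ⟨continuous_oscSymbol (by linarith) _ _ ?_, fun t => ?_,
    fun t ξ hξ => ?_, fun t ht j i hi ξ => ?_⟩
  · have := (contDiff_lpCut (n := n)).continuous
    fun_prop
  · rw [oscSymbol_comp_smul_low γ 1 t s (fun ξ => (lpCut ξ : ℂ)) hc]
    exact (isAnnular_oscSymbol γ 1 hadm _ s isAnnular_lpCut).contDiff.comp (contDiff_const_smul c)
  · simp only [oscSymbol]
    rw [lpCut_eq_zero_of_ge, Complex.ofReal_zero, mul_zero]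
    rw [norm_smul, Real.norm_of_nonneg hc.le]
    rw [← div_eq_mul_inv, div_lt_iff₀ hc] at hξ
    linarith
  · have hsm := (isAnnular_oscSymbol (n := n) γ 1 hadm (t * c ^ (-γ)) s isAnnular_lpCut).contDiff
    rw [oscSymbol_comp_smul_low γ 1 t s (fun ξ => (lpCut ξ : ℂ)) hc,
      pderiv_iterate_comp_smul j i c hsm]
    rw [norm_mul, norm_pow, Complex.norm_real, Real.norm_of_nonneg hc.le]
    have e2 : c ^ (-γ) ≤ 1 := Real.rpow_le_one_of_one_le_of_nonpos hc1 (by linarith)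
    have h3 : |t * c ^ (-γ)| ≤ T * c ^ (-γ) := by
      rw [abs_mul, abs_of_nonneg (by positivity : 0 ≤ c ^ (-γ))]
      gcongr
      exact hT t ht
    have h1 := hC j i hi _ _ hadm (t * c ^ (-γ))
      (h3.trans (mul_le_of_le_one_right hT0 e2)) (c • ξ)
    calc _ ≤ c ^ i * (C * (T * c ^ (-γ))) := by
          gcongr
          exact h1.trans (by gcongr)
      _ = _ := by ring

theorem symbolBound_mid {n : ℕ} (N : ℕ) (s : ℝ) (a b : ℝ) :
    ∃ C : ℝ, 0 ≤ C ∧ SymbolBound n N (Icc a b)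
      (fun _ ξ => (((1 + ‖ξ‖ ^ 2) ^ (-s) : ℝ) : ℂ) * (lowCut ξ : ℂ)) C 1 1 := by
  set m : En n → ℂ := fun ξ => (((1 + ‖ξ‖ ^ 2) ^ (-s) : ℝ) : ℂ) * (lowCut ξ : ℂ) with hm
  have hsm : ContDiff ℝ (⊤ : ℕ∞) m := by
    refine ContDiff.mul (Complex.ofRealCLM.contDiff.comp ?_)
      (Complex.ofRealCLM.contDiff.comp contDiff_lowCut)
    exact ContDiff.rpow_const_of_ne (contDiff_const.add (contDiff_norm_sq ℝ))
      fun ξ => by positivity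
  have hsupp : ∀ ξ, 2 * 1 < ‖ξ‖ → m ξ = 0 := fun ξ hξ => by
    rw [hm]; simp only; rw [lowCut_eq_zero (by linarith), Complex.ofReal_zero, mul_zero]
  have hcs : HasCompactSupport m :=
    HasCompactSupport.intro (isCompact_closedBall (0 : En n) (2 * 1))
      fun ξ hξ => hsupp ξ (by simpa using hξ)
  obtain ⟨C, hC0, hC⟩ := exists_uniform_bound (n := n) N
    (P := fun j i C => ∀ ξ : En n, ‖(pderiv j)^[i] m ξ‖ ≤ C)
    (fun j i => by
      have h1 : HasCompactSupport ((pderiv j)^[i] m) :=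
        hcs.mono' ((subset_tsupport _).trans (pderiv_iterate_support_subset j m i))
      obtain ⟨C, hC⟩ := h1.exists_bound_of_continuous (contDiff_pderiv_iterate j hsm i).continuous
      exact ⟨C, (norm_nonneg _).trans (hC 0), hC⟩)
    (fun j i C C' h hP ξ => (hP ξ).trans h)
  exact ⟨C, hC0, hsm.continuous.comp continuous_snd, fun _ => hsm, fun _ => hsupp,
    fun t _ j i hi ξ => by simpa using hC j i hi ξ⟩

/-- The dyadic pieces of the symbol `(1 + |ξ|²)^{-s} e^{it|ξ|^γ}`: high frequencies, low frequencies
(with the value of the phase factor at the origin removed), and a remaining smooth piece. -/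
def wavePiece (n : ℕ) (γ s : ℝ) : ℕ ⊕ ℕ ⊕ Unit → ℝ → En n → ℂ
  | .inl k => fun t => oscSymbol γ 0 1 1 t s fun ξ => (lpCut ((1 / 2 : ℝ) ^ (k + 1) • ξ) : ℂ)
  | .inr (.inl k) => fun t => oscSymbol γ 1 1 1 t s fun ξ => (lpCut ((2 : ℝ) ^ k • ξ) : ℂ)
  | .inr (.inr _) => fun _ ξ => (((1 + ‖ξ‖ ^ 2) ^ (-s) : ℝ) : ℂ) * (lowCut ξ : ℂ)

/-- The exponent of growth of the kernels of the dyadic pieces. -/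
def waveExponent (d : ℝ) : ℕ ⊕ ℕ ⊕ Unit → ℝ
  | .inl k => (k + 1) * d
  | .inr _ => 0

/-- The first dyadic pieces. -/
def waveIndices (K : ℕ) : Finset (ℕ ⊕ ℕ ⊕ Unit) :=
  (Finset.range K).disjSum ((Finset.range K).disjSum {()})

theorem sum_waveIndices {M : Type*} [AddCommMonoid M] (K : ℕ) (F : ℕ ⊕ ℕ ⊕ Unit → M) :
    ∑ i ∈ waveIndices K, F i = ∑ k ∈ Finset.range K, F (.inl k) +
      (∑ k ∈ Finset.range K, F (.inr (.inl k)) + F (.inr (.inr ()))) := by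
  simp [waveIndices, Finset.sum_disjSum]

theorem sum_lpCut_high {n : ℕ} (K : ℕ) (ξ : En n) :
    ∑ k ∈ Finset.range K, lpCut ((1 / 2 : ℝ) ^ (k + 1) • ξ) =
      lowCut ((1 / 2 : ℝ) ^ K • ξ) - lowCut ξ := by
  have h : ∀ k ∈ Finset.range K, lpCut ((1 / 2 : ℝ) ^ (k + 1) • ξ) =
      lowCut ((1 / 2 : ℝ) ^ (k + 1) • ξ) - lowCut ((1 / 2 : ℝ) ^ k • ξ) := fun k _ => by
    rw [lpCut, smul_smul, pow_succ]
    congr 3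
    ring
  rw [Finset.sum_congr rfl h, Finset.sum_range_sub fun k => lowCut ((1 / 2 : ℝ) ^ k • ξ)]
  simp

theorem sum_lpCut_low {n : ℕ} (K : ℕ) (ξ : En n) :
    ∑ k ∈ Finset.range K, lpCut ((2 : ℝ) ^ k • ξ) = lowCut ξ - lowCut ((2 : ℝ) ^ K • ξ) := by
  have h : ∀ k ∈ Finset.range K, lpCut ((2 : ℝ) ^ k • ξ) =
      lowCut ((2 : ℝ) ^ k • ξ) - lowCut ((2 : ℝ) ^ (k + 1) • ξ) := fun k _ => by
    rw [lpCut, smul_smul, pow_succ, mul_comm]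
  rw [Finset.sum_congr rfl h, Finset.sum_range_sub' fun k => lowCut ((2 : ℝ) ^ k • ξ)]
  simp

theorem one_add_sq_rpow_neg_le_one {s : ℝ} (hs : 0 ≤ s) (x : ℝ) : (1 + x ^ 2) ^ (-s) ≤ 1 :=
  Real.rpow_le_one_of_one_le_of_nonpos (by nlinarith [sq_nonneg x]) (by linarith)

theorem norm_wavePiece_high_le {n : ℕ} {γ d θ : ℝ} (hd : 0 ≤ d) (hθ : 0 ≤ θ) (k : ℕ) (t : ℝ)
    (ξ : En n) :
    2 ^ (waveExponent d (.inl k) * θ) * ‖wavePiece n γ (θ * d / 2) (.inl k) t ξ‖ ≤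
      2 ^ (d * θ) * lpCut ((1 / 2 : ℝ) ^ (k + 1) • ξ) := by
  have hn0 := lpCut_nonneg ((1 / 2 : ℝ) ^ (k + 1) • ξ)
  simp only [wavePiece, oscSymbol, waveExponent, sub_zero, norm_mul, Complex.norm_real,
    norm_exp_I_mul, mul_one, one_mul]
  rw [Real.norm_of_nonneg hn0, Real.norm_of_nonneg (by positivity), ← mul_assoc]
  rcases le_or_gt ‖(1 / 2 : ℝ) ^ (k + 1) • ξ‖ (1 / 2) with h | h
  · rw [lpCut_eq_zero_of_le h]; simp
  · gcongr
    rw [norm_smul, Real.norm_of_nonneg (by positivity), pow_succ] at h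
    have h2 : (2 : ℝ) ^ k ≤ ‖ξ‖ := by
      have : (1 / 2 : ℝ) ^ k * 2 ^ k = 1 := by rw [← mul_pow]; norm_num
      nlinarith [pow_pos (by norm_num : (0 : ℝ) < 2) k]
    have h3 : (1 + ‖ξ‖ ^ 2) ^ (-(θ * d / 2)) ≤ 2 ^ (-(k * d * θ)) := by
      calc _ ≤ (((2 : ℝ) ^ k) ^ 2) ^ (-(θ * d / 2)) := by
            refine Real.rpow_le_rpow_of_nonpos (by positivity) ?_ (by
              have := mul_nonneg hθ hd; linarith)
            nlinarith [pow_le_pow_left₀ (by positivity) h2 2]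
        _ = _ := by
            rw [← pow_mul, ← Real.rpow_natCast, ← Real.rpow_mul (by norm_num)]
            congr 1
            push_cast; ring
    calc (2 : ℝ) ^ ((k + 1) * d * θ) * (1 + ‖ξ‖ ^ 2) ^ (-(θ * d / 2))
        ≤ (2 : ℝ) ^ ((k + 1) * d * θ) * 2 ^ (-(k * d * θ)) := by gcongr
      _ = _ := by
        rw [← Real.rpow_add (by norm_num)]
        congr 1; ring

theorem norm_wavePiece_low_le {n : ℕ} {γ s : ℝ} (hs : 0 ≤ s) (k : ℕ) (t : ℝ) (ξ : En n) :
    ‖wavePiece n γ s (.inr (.inl k)) t ξ‖ ≤ 2 * lpCut ((2 : ℝ) ^ k • ξ) := by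
  have hn0 := lpCut_nonneg ((2 : ℝ) ^ k • ξ)
  simp only [wavePiece, oscSymbol, norm_mul, Complex.norm_real, one_mul]
  rw [Real.norm_of_nonneg hn0, Real.norm_of_nonneg (by positivity)]
  gcongr
  have h1 := one_add_sq_rpow_neg_le_one hs ‖ξ‖
  have h2 : ‖Complex.exp (Complex.I * ((t * ‖ξ‖ ^ γ : ℝ) : ℂ)) - 1‖ ≤ 2 := by
    refine (norm_sub_le _ _).trans ?_
    rw [norm_exp_I_mul]; norm_num
  calc _ ≤ 1 * (2 : ℝ) := by gcongr
    _ = 2 := one_mul _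

theorem sum_norm_wavePiece_le {n : ℕ} {γ d θ : ℝ} (hd : 0 ≤ d) (hθ : 0 ≤ θ) (K : ℕ) (t : ℝ)
    (ξ : En n) :
    ∑ i ∈ waveIndices K, 2 ^ (waveExponent d i * θ) * ‖wavePiece n γ (θ * d / 2) i t ξ‖ ≤
      2 ^ (d * θ) + 3 := by
  have hs : 0 ≤ θ * d / 2 := by positivity
  rw [sum_waveIndices]
  have h1 : ∑ k ∈ Finset.range K, 2 ^ (waveExponent d (.inl k) * θ) *
      ‖wavePiece n γ (θ * d / 2) (.inl k) t ξ‖ ≤ 2 ^ (d * θ) := by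
    refine (Finset.sum_le_sum fun k _ => norm_wavePiece_high_le hd hθ k t ξ).trans ?_
    rw [← Finset.mul_sum, sum_lpCut_high]
    have : lowCut ((1 / 2 : ℝ) ^ K • ξ) - lowCut ξ ≤ 1 := by
      linarith [lowCut_le_one ((1 / 2 : ℝ) ^ K • ξ), lowCut_nonneg ξ]
    exact mul_le_of_le_one_right (by positivity) this
  have h2 : ∑ k ∈ Finset.range K, 2 ^ (waveExponent d (.inr (.inl k)) * θ) *
      ‖wavePiece n γ (θ * d / 2) (.inr (.inl k)) t ξ‖ ≤ 2 := by
    simp only [waveExponent, zero_mul, Real.rpow_zero, one_mul]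
    refine (Finset.sum_le_sum fun k _ => norm_wavePiece_low_le hs k t ξ).trans ?_
    rw [← Finset.mul_sum, sum_lpCut_low]
    linarith [lowCut_le_one ξ, lowCut_nonneg ((2 : ℝ) ^ K • ξ)]
  have h3 : 2 ^ (waveExponent d (.inr (.inr ())) * θ) *
      ‖wavePiece n γ (θ * d / 2) (.inr (.inr ())) t ξ‖ ≤ 1 := by
    simp only [waveExponent, zero_mul, Real.rpow_zero, one_mul, wavePiece, norm_mul,
      Complex.norm_real]
    rw [Real.norm_of_nonneg (lowCut_nonneg ξ), Real.norm_of_nonneg (by positivity)]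
    exact mul_le_one₀ (one_add_sq_rpow_neg_le_one hs _) (lowCut_nonneg ξ) (lowCut_le_one ξ)
  linarith

theorem sum_wavePiece_eventually {n : ℕ} {γ s : ℝ} (t : ℝ) {ξ : En n} (hξ : ξ ≠ 0) :
    ∀ᶠ K in atTop, ∑ i ∈ waveIndices K, wavePiece n γ s i t ξ =
      (((1 + ‖ξ‖ ^ 2) ^ (-s) : ℝ) : ℂ) * Complex.exp (Complex.I * ((t * ‖ξ‖ ^ γ : ℝ) : ℂ)) := by
  have h1 : ∀ᶠ K : ℕ in atTop, lowCut ((1 / 2 : ℝ) ^ K • ξ) = 1 := by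
    have : Tendsto (fun K : ℕ => ‖(1 / 2 : ℝ) ^ K • ξ‖) atTop (𝓝 0) := by
      have := ((tendsto_pow_atTop_nhds_zero_of_lt_one (by norm_num : (0 : ℝ) ≤ 1 / 2)
        (by norm_num)).smul_const ξ).norm
      simpa using this
    filter_upwards [this.eventually (gt_mem_nhds one_pos)] with K hK
    exact lowCut_eq_one hK.le
  have h2 : ∀ᶠ K : ℕ in atTop, lowCut ((2 : ℝ) ^ K • ξ) = 0 := by
    have : Tendsto (fun K : ℕ => (2 : ℝ) ^ K * ‖ξ‖) atTop atTop :=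
      (tendsto_pow_atTop_atTop_of_one_lt (by norm_num)).atTop_mul_const (norm_pos_iff.2 hξ)
    filter_upwards [this.eventually_ge_atTop 2] with K hK
    apply lowCut_eq_zero
    rwa [norm_smul, Real.norm_of_nonneg (by positivity)]
  filter_upwards [h1, h2] with K hK1 hK2
  rw [sum_waveIndices]
  simp only [wavePiece, oscSymbol, ← Finset.mul_sum, ← Complex.ofReal_sum, sum_lpCut_high,
    sum_lpCut_low, hK1, hK2]
  push_cast
  simp only [one_mul]
  ring

theorem min_self_inv_le {s : ℝ} (hs : 0 < s) :
    min s s⁻¹ ≤ 6 * (2 * s / (1 + 2 * s) - s / (1 + s)) := by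
  have e : 2 * s / (1 + 2 * s) - s / (1 + s) = s / ((1 + 2 * s) * (1 + s)) := by
    field_simp; ring
  rw [e]
  rcases le_total s 1 with h | h
  · refine (min_le_left _ _).trans ?_
    rw [← mul_div_assoc, le_div_iff₀ (by positivity)]
    nlinarith [mul_nonneg hs.le (sub_nonneg.2 h), sq_nonneg s, mul_pos hs hs]
  · refine (min_le_right _ _).trans ?_
    rw [← mul_div_assoc, le_div_iff₀ (by positivity), inv_mul_le_iff₀ hs]
    nlinarith

theorem sum_min_self_inv_le {r : ℝ} (hr : 0 < r) (K : ℕ) :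
    ∑ k ∈ Finset.range K, min (r * 2 ^ (k + 1)) (r * 2 ^ (k + 1))⁻¹ ≤ 6 := by
  have h : ∀ k ∈ Finset.range K, min (r * 2 ^ (k + 1)) (r * 2 ^ (k + 1))⁻¹ ≤
      6 * (r * 2 ^ (k + 1 + 1) / (1 + r * 2 ^ (k + 1 + 1)) -
        r * 2 ^ (k + 1) / (1 + r * 2 ^ (k + 1))) := fun k _ => by
    refine (min_self_inv_le (by positivity)).trans_eq ?_
    rw [show 2 * (r * 2 ^ (k + 1)) = r * 2 ^ (k + 1 + 1) by ring]
  refine (Finset.sum_le_sum h).trans ?_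
  rw [← Finset.mul_sum,
    Finset.sum_range_sub fun k => r * 2 ^ (k + 1) / (1 + r * 2 ^ (k + 1))]
  have h1 : r * 2 ^ (K + 1) / (1 + r * 2 ^ (K + 1)) ≤ 1 :=
    div_le_one_of_le₀ (by linarith) (by positivity)
  have h2 : 0 ≤ r * 2 ^ (0 + 1) / (1 + r * 2 ^ (0 + 1)) := by positivity
  linarith

theorem min_self_inv_le_one (s : ℝ) : min s s⁻¹ ≤ 1 := by
  rcases le_total s 1 with h | h
  · exact (min_le_left _ _).trans h
  · exact (min_le_right _ _).trans (inv_le_one_of_one_le₀ h)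

theorem wavePiece_symbolBound {n : ℕ} (N : ℕ) {γ : ℝ} (hγ : 1 < γ) {s : ℝ} (hs : 0 ≤ s)
    {a b T : ℝ} (hT : ∀ t ∈ Icc a b, |t| ≤ T) (hT0 : 0 ≤ T) :
    ∃ C : ℝ, 0 ≤ C ∧
      (∀ k : ℕ, SymbolBound n N (Icc a b) (wavePiece n γ s (.inl k))
        (C * ((1 / 2 : ℝ) ^ (k + 1)) ^ (2 * s)) ((1 + T) * ((1 / 2 : ℝ) ^ (k + 1)) ^ (1 - γ))
        ((1 / 2 : ℝ) ^ (k + 1))⁻¹) ∧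
      (∀ k : ℕ, SymbolBound n N (Icc a b) (wavePiece n γ s (.inr (.inl k)))
        (C * ((2 : ℝ) ^ k) ^ (-γ)) (2 ^ k) (2 ^ k)⁻¹) ∧
      SymbolBound n N (Icc a b) (wavePiece n γ s (.inr (.inr ()))) C 1 1 := by
  obtain ⟨C1, h1, H1⟩ := symbolBound_high (n := n) N hγ hs hT
  obtain ⟨C2, h2, H2⟩ := symbolBound_low (n := n) N hγ hs hT hT0
  obtain ⟨C3, h3, H3⟩ := symbolBound_mid (n := n) N s a b
  have mono : ∀ {m : ℝ → En n → ℂ} {A A' R ρ : ℝ}, SymbolBound n N (Icc a b) m A R ρ → A ≤ A' →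
      0 ≤ R → SymbolBound n N (Icc a b) m A' R ρ := fun h hA hR =>
    ⟨h.continuous, h.contDiff, h.supp, fun t ht j i hi ξ =>
      (h.bound t ht j i hi ξ).trans (by gcongr)⟩
  refine ⟨C1 + C2 + C3, by positivity, fun k => ?_, fun k => ?_, ?_⟩
  · refine mono (H1 _ (by positivity) (pow_le_one₀ (by norm_num) (by norm_num))) ?_ (by positivity)
    gcongr; linarith
  · refine mono (H2 _ (one_le_pow₀ (by norm_num))) ?_ (by positivity)
    gcongr; linarith
  · exact mono H3 (by linarith) zero_le_one

theorem sum_lintegral_wavePiece_atom_le {n : ℕ} (hn : 2 ≤ n) {γ : ℝ} (hγ : 1 < γ) {d θ : ℝ}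
    (hd : d = γ * n / 2) (hθ : 0 ≤ θ) (a b : ℝ) :
    ∃ C : ℝ, 0 ≤ C ∧ ∀ (K : ℕ) (h : En n → ℂ) (M r : ℝ) (c : En n), Measurable h →
      (∀ y, ‖h y‖ ≤ M) → 0 < r → (∀ y, r < ‖y - c‖ → h y = 0) → ∫ y, h y = 0 →
      ∑ i ∈ waveIndices K, ENNReal.ofReal (2 ^ (waveExponent d i * (θ - 1))) *
        ∫⁻ x, (∫⁻ t in Icc a b, ‖mulOp n (wavePiece n γ (θ * d / 2) i t) h x‖ₑ ^ 2) ^ (1 / 2 : ℝ) ≤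
      ENNReal.ofReal (C * M * r ^ n) := by
  have hn' : (2 : ℝ) ≤ n := by exact_mod_cast hn
  have hd1 : 1 ≤ d := by rw [hd]; nlinarith
  set T := max |a| |b| with hTdef
  have hT0 : 0 ≤ T := (abs_nonneg a).trans (le_max_left _ _)
  have hT : ∀ t ∈ Icc a b, |t| ≤ T := fun t ht => abs_le_max_abs_abs ht.1 ht.2
  obtain ⟨C0, hC0, hat⟩ := SymbolBound.lintegral_atom_le (n := n) (N := n) hn (by omega) a b
  obtain ⟨C1, hC1, hhigh, hlow, hmid⟩ :=
    wavePiece_symbolBound (n := n) n hγ (s := θ * d / 2) (by positivity) hT hT0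
  refine ⟨C0 * C1 * (1 + 6 * (1 + T) ^ (n / 2 : ℝ) + 6), by positivity, ?_⟩
  intro K h M r c hm hM hr hsupp hinteg
  have hM0 : 0 ≤ M := (norm_nonneg _).trans (hM 0)
  rw [sum_waveIndices]
  set κ : ℝ → ℝ := fun s => min s s⁻¹ with hκ
  have bhigh : ∀ k : ℕ, ENNReal.ofReal (2 ^ (waveExponent d (.inl k) * (θ - 1))) *
      ∫⁻ x, (∫⁻ t in Icc a b,
        ‖mulOp n (wavePiece n γ (θ * d / 2) (.inl k) t) h x‖ₑ ^ 2) ^ (1 / 2 : ℝ) ≤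
      ENNReal.ofReal (C0 * C1 * M * r ^ n *
        ((1 / 2 : ℝ) ^ (k + 1) + (1 + T) ^ (n / 2 : ℝ) * κ (r * 2 ^ (k + 1)))) := fun k => by
    set q : ℝ := (1 / 2 : ℝ) ^ (k + 1) with hq
    have hq0 : 0 < q := by positivity
    have hq1 : q ≤ 1 := pow_le_one₀ (by norm_num) (by norm_num)
    have hqi : q⁻¹ = 2 ^ (k + 1) := by rw [hq, ← inv_pow]; norm_num
    have hq2 : q = (2 : ℝ) ^ (-((k : ℝ) + 1)) := by
      rw [hq, Real.rpow_neg (by norm_num), one_div, inv_pow]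
      congr 1
      rw [← Real.rpow_natCast]; push_cast; rfl
    have hRρ : (1 + T) * q ^ (1 - γ) * q⁻¹ = (1 + T) * q ^ (-γ) := by
      rw [mul_assoc, ← Real.rpow_neg_one q, ← Real.rpow_add hq0]
      congr 2; ring
    have h1 : 1 ≤ q ^ (-γ) := Real.one_le_rpow_of_pos_of_le_one_of_nonpos hq0 hq1 (by linarith)
    refine (mul_le_mul_right (hat _ _ _ _ (hhigh k) (by positivity) (by positivity) (by positivity)
      (by rw [hRρ]; nlinarith) h M r c hm hM hr hsupp hinteg) _).trans ?_
    rw [← ENNReal.ofReal_mul (by positivity), hRρ]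
    apply ENNReal.ofReal_le_ofReal
    have e1 : (2 : ℝ) ^ (waveExponent d (.inl k) * (θ - 1)) = q ^ (d * (1 - θ)) := by
      rw [hq2, ← Real.rpow_mul (by norm_num)]
      congr 1; simp only [waveExponent]; ring
    have e2 : q ^ (d * (1 - θ)) * q ^ (2 * (θ * d / 2)) = q ^ d := by
      rw [← Real.rpow_add hq0]; congr 1; ring
    have e3 : ((1 + T) * q ^ (-γ)) ^ (n / 2 : ℝ) = (1 + T) ^ (n / 2 : ℝ) * (q ^ d)⁻¹ := by
      rw [Real.mul_rpow (by positivity) (by positivity), ← Real.rpow_mul hq0.le,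
        ← Real.rpow_neg hq0.le]
      congr 2; rw [hd]; ring
    have e4 : q ^ d ≤ q := by
      calc q ^ d ≤ q ^ (1 : ℝ) := Real.rpow_le_rpow_of_exponent_ge hq0 hq1 hd1
        _ = q := Real.rpow_one q
    have hqd : 0 < q ^ d := by positivity
    rw [e1, e3]
    calc _ = C0 * C1 * M * r ^ n * ((q ^ (d * (1 - θ)) * q ^ (2 * (θ * d / 2))) * (1 +
          (1 + T) ^ (n / 2 : ℝ) * (q ^ d)⁻¹ * min (r * q⁻¹) (r * q⁻¹)⁻¹)) := by ring
      _ = C0 * C1 * M * r ^ n * (q ^ d + (1 + T) ^ (n / 2 : ℝ) * κ (r * 2 ^ (k + 1))) := by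
          rw [e2, hqi, hκ]; field_simp
      _ ≤ _ := by gcongr
  have blow : ∀ k : ℕ, ENNReal.ofReal (2 ^ (waveExponent d (.inr (.inl k)) * (θ - 1))) *
      ∫⁻ x, (∫⁻ t in Icc a b,
        ‖mulOp n (wavePiece n γ (θ * d / 2) (.inr (.inl k)) t) h x‖ₑ ^ 2) ^ (1 / 2 : ℝ) ≤
      ENNReal.ofReal (C0 * C1 * M * r ^ n * (2 * (1 / 2 : ℝ) ^ k)) := fun k => by
    simp only [waveExponent, zero_mul, Real.rpow_zero, ENNReal.ofReal_one, one_mul]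
    have h2 : (1 : ℝ) ≤ 2 ^ k := one_le_pow₀ (by norm_num)
    have h3 : (2 : ℝ) ^ k * (2 ^ k)⁻¹ = 1 := by field_simp
    refine (hat _ _ _ _ (hlow k) (by positivity) (by positivity) (by positivity)
      h3.ge h M r c hm hM hr hsupp hinteg).trans (ENNReal.ofReal_le_ofReal ?_)
    have h4 : ((2 : ℝ) ^ k) ^ (-γ) ≤ (1 / 2) ^ k := by
      calc ((2 : ℝ) ^ k) ^ (-γ) ≤ ((2 : ℝ) ^ k) ^ (-1 : ℝ) :=
            Real.rpow_le_rpow_of_exponent_le h2 (by linarith)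
        _ = _ := by rw [Real.rpow_neg_one, ← inv_pow]; norm_num
    rw [h3, Real.one_rpow, one_mul]
    have h5 := min_self_inv_le_one (r * (2 ^ k)⁻¹)
    calc _ ≤ C0 * (C1 * (1 / 2) ^ k) * M * r ^ n * (1 + 1) := by gcongr
      _ = _ := by ring
  have bmid : ENNReal.ofReal (2 ^ (waveExponent d (.inr (.inr ())) * (θ - 1))) *
      ∫⁻ x, (∫⁻ t in Icc a b,
        ‖mulOp n (wavePiece n γ (θ * d / 2) (.inr (.inr ())) t) h x‖ₑ ^ 2) ^ (1 / 2 : ℝ) ≤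
      ENNReal.ofReal (C0 * C1 * M * r ^ n * 2) := by
    simp only [waveExponent, zero_mul, Real.rpow_zero, ENNReal.ofReal_one, one_mul]
    refine (hat _ _ _ _ hmid (by positivity) (by positivity) (by positivity)
      (by norm_num) h M r c hm hM hr hsupp hinteg).trans (ENNReal.ofReal_le_ofReal ?_)
    rw [mul_one 1, Real.one_rpow, one_mul]
    have h5 := min_self_inv_le_one (r * 1)
    calc _ ≤ C0 * C1 * M * r ^ n * (1 + 1) := by gcongr
      _ = _ := by ring
  have hκ0 : ∀ k : ℕ, 0 ≤ κ (r * 2 ^ (k + 1)) := fun k => le_min (by positivity) (by positivity)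
  refine (add_le_add (Finset.sum_le_sum fun k _ => bhigh k)
    (add_le_add (Finset.sum_le_sum fun k _ => blow k) bmid)).trans ?_
  have hG : 0 ≤ C0 * C1 * M * r ^ n := by positivity
  have hs1 : ∑ k ∈ Finset.range K, (1 / 2 : ℝ) ^ k ≤ 2 := by
    have := geom_sum_eq (by norm_num : (1 / 2 : ℝ) ≠ 1) K
    rw [this, div_le_iff_of_neg (by norm_num)]
    have : 0 ≤ (1 / 2 : ℝ) ^ K := by positivity
    linarith
  rw [← ENNReal.ofReal_sum_of_nonneg fun k _ => by have := hκ0 k; positivity,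
    ← ENNReal.ofReal_sum_of_nonneg fun k _ => by positivity,
    ← ENNReal.ofReal_add (Finset.sum_nonneg fun k _ => by positivity) (by positivity),
    ← ENNReal.ofReal_add (Finset.sum_nonneg fun k _ => by have := hκ0 k; positivity)
      (add_nonneg (Finset.sum_nonneg fun k _ => by positivity) (by positivity))]
  apply ENNReal.ofReal_le_ofReal
  rw [← Finset.mul_sum, ← Finset.mul_sum, Finset.sum_add_distrib, ← Finset.mul_sum,
    ← Finset.mul_sum, ← mul_add, ← mul_add]
  have hs2 : ∑ k ∈ Finset.range K, (1 / 2 : ℝ) ^ (k + 1) ≤ 1 := by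
    simp only [pow_succ, ← Finset.sum_mul]
    linarith
  have hs3 := sum_min_self_inv_le hr K
  calc _ ≤ C0 * C1 * M * r ^ n * (1 + (1 + T) ^ (n / 2 : ℝ) * 6 + (2 * 2 + 2)) := by gcongr
    _ = _ := by ring

/-- A decreasing sequence of countable partitions of Euclidean space into cells, which have the size
and shape of dyadic cubes. The set `cell i x` is the cell of generation `i` containing `x`. -/
structure CellSystem (n : ℕ) where
  cell : ℕ → En n → Set (En n)
  diam : ℕ → ℝ
  measurableSet_cell : ∀ i x, MeasurableSet (cell i x)
  mem_cell : ∀ i x, x ∈ cell i x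
  cell_eq : ∀ {i x y}, y ∈ cell i x → cell i y = cell i x
  cell_succ_subset : ∀ i x, cell (i + 1) x ⊆ cell i x
  countable_range : ∀ i, (range (cell i)).Countable
  volume_pos : ∀ i x, 0 < volume (cell i x)
  volume_lt_top : ∀ i x, volume (cell i x) < ∞
  volume_le : ∀ i x, volume (cell i x) ≤ 2 ^ n * volume (cell (i + 1) x)
  diam_pos : ∀ i, 0 < diam i
  norm_sub_le : ∀ {i x y}, y ∈ cell i x → ‖y - x‖ ≤ diam i
  tendsto_diam : Tendsto diam atTop (𝓝 0)
  diam_pow_le : ∀ i x, ENNReal.ofReal (diam i ^ n) ≤ n ^ n * volume (cell i x)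

theorem volume_floor_cell {n : ℕ} {δ : ℝ} (hδ : 0 < δ) (k : Fin n → ℤ) :
    volume {y : En n | ∀ a, ⌊y a / δ⌋ = k a} = ENNReal.ofReal (δ ^ n) := by
  have h : {y : En n | ∀ a, ⌊y a / δ⌋ = k a} =
      (MeasurableEquiv.toLp 2 (Fin n → ℝ)).symm ⁻¹'
        (Set.univ.pi fun a => Ico (k a * δ) ((k a + 1) * δ)) := by
    ext y
    simp only [mem_ofPred_eq, mem_preimage, Set.mem_pi, mem_univ, true_imp_iff, Int.floor_eq_iff,
      le_div_iff₀ hδ, div_lt_iff₀ hδ, mem_Ico]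
    rfl
  rw [h, (EuclideanSpace.volume_preserving_symm_measurableEquiv_toLp
    (Fin n)).measure_preimage_equiv,
    Real.volume_pi_Ico]
  simp only [add_mul, one_mul, add_sub_cancel_left, Finset.prod_const, Finset.card_univ,
    Fintype.card_fin]
  rw [ENNReal.ofReal_pow hδ.le]

theorem norm_le_card_mul {n : ℕ} {δ : ℝ} {z : En n} (h : ∀ a, |z a| ≤ δ) : ‖z‖ ≤ n * δ := by
  rcases Nat.eq_zero_or_pos n with rfl | hn
  · simp [EuclideanSpace.norm_eq]
  have hδ : 0 ≤ δ := (abs_nonneg _).trans (h ⟨0, hn⟩)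
  have hn1 : (1 : ℝ) ≤ n := by exact_mod_cast hn
  rw [EuclideanSpace.norm_eq]
  apply Real.sqrt_le_iff.2 ⟨by positivity, ?_⟩
  calc ∑ a, ‖z a‖ ^ 2 ≤ ∑ _a : Fin n, δ ^ 2 := by
        gcongr with a
        exact h a
    _ = n * δ ^ 2 := by simp
    _ ≤ (n * δ) ^ 2 := by nlinarith [sq_nonneg δ]

/-- The cubes of side length `l / 2 ^ i`. -/
def dyadicCells {n : ℕ} (hn : 0 < n) {l : ℝ} (hl : 0 < l) : CellSystem n where
  cell i x := {y | ∀ a, ⌊y a / (l / 2 ^ i)⌋ = ⌊x a / (l / 2 ^ i)⌋}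
  diam i := n * (l / 2 ^ i)
  measurableSet_cell i x := by
    have : {y : En n | ∀ a, ⌊y a / (l / 2 ^ i)⌋ = ⌊x a / (l / 2 ^ i)⌋} =
        ⋂ a, (fun y : En n => ⌊y a / (l / 2 ^ i)⌋) ⁻¹' {⌊x a / (l / 2 ^ i)⌋} := by
      ext y; simp
    rw [this]
    refine MeasurableSet.iInter fun a => ?_
    have h : Measurable fun y : En n => y a := by fun_prop
    exact (Int.measurable_floor.comp (h.div_const _)) (measurableSet_singleton _)
  mem_cell i x := fun a => rfl
  cell_eq {i x y} h := by
    ext z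
    simp only [mem_ofPred_eq] at h ⊢
    simp only [h]
  cell_succ_subset i x y h a := by
    have key : ∀ u : ℝ, ⌊u / (l / 2 ^ i)⌋ = ⌊u / (l / 2 ^ (i + 1))⌋ / 2 := fun u => by
      have := Int.floor_div_natCast (u / (l / 2 ^ (i + 1))) 2
      rw [show u / (l / 2 ^ i) = u / (l / 2 ^ (i + 1)) / ((2 : ℕ) : ℝ) by
        push_cast; rw [pow_succ]; field_simp, this]
      rfl
    rw [key, key, h a]
  countable_range i := by
    have : range (fun x : En n => {y : En n | ∀ a, ⌊y a / (l / 2 ^ i)⌋ = ⌊x a / (l / 2 ^ i)⌋}) ⊆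
        range fun k : Fin n → ℤ => {y : En n | ∀ a, ⌊y a / (l / 2 ^ i)⌋ = k a} := by
      rintro _ ⟨x, rfl⟩
      exact ⟨fun a => ⌊x a / (l / 2 ^ i)⌋, rfl⟩
    exact (countable_range _).mono this
  volume_pos i x := by
    rw [volume_floor_cell (by positivity)]
    simp only [ENNReal.ofReal_pos]; positivity
  volume_lt_top i x := by
    rw [volume_floor_cell (by positivity)]
    exact ENNReal.ofReal_lt_top
  volume_le i x := by
    rw [volume_floor_cell (by positivity), volume_floor_cell (by positivity)]
    have : (2 : ℝ≥0∞) ^ n = ENNReal.ofReal (2 ^ n) := by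
      rw [ENNReal.ofReal_pow (by norm_num)]; simp
    rw [this, ← ENNReal.ofReal_mul (by positivity), ← mul_pow]
    apply ENNReal.ofReal_le_ofReal
    rw [show 2 * (l / 2 ^ (i + 1)) = l / 2 ^ i by rw [pow_succ]; field_simp]
  diam_pos i := by positivity
  norm_sub_le {i x y} h := by
    refine norm_le_card_mul fun a => ?_
    have := Int.abs_sub_lt_one_of_floor_eq_floor (h a)
    rw [← sub_div, abs_div, abs_of_pos (by positivity : 0 < l / 2 ^ i),
      div_lt_one (by positivity)] at this
    simpa using this.le
  tendsto_diam := by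
    have : Tendsto (fun i : ℕ => (n * l) * (1 / 2 : ℝ) ^ i) atTop (𝓝 (n * l * 0)) :=
      (tendsto_pow_atTop_nhds_zero_of_lt_one (by norm_num) (by norm_num)).const_mul _
    rw [mul_zero] at this
    refine this.congr fun i => ?_
    rw [div_pow, one_pow]; ring
  diam_pow_le i x := by
    rw [volume_floor_cell (by positivity), mul_pow, ENNReal.ofReal_mul (by positivity),
      ENNReal.ofReal_pow (by positivity), ENNReal.ofReal_natCast]

theorem dyadicCells_volume {n : ℕ} (hn : 0 < n) {l : ℝ} (hl : 0 < l) (x : En n) :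
    volume ((dyadicCells hn hl).cell 0 x) = ENNReal.ofReal (l ^ n) := by
  have := volume_floor_cell (n := n) (δ := l / 2 ^ 0) (by positivity)
    fun a => ⌊x a / (l / 2 ^ 0)⌋
  rw [pow_zero, div_one] at this
  simpa [dyadicCells] using this

namespace CellSystem

/-- The average of `|g|` over the cell of generation `i` containing `x`. -/
def avg {n : ℕ} (Q : CellSystem n) (g : En n → ℂ) (i : ℕ) (x : En n) : ℝ :=
  ⨍ y in Q.cell i x, ‖g y‖

/-- The set where some average of `|g|` exceeds the level `l`. -/
def stopSet {n : ℕ} (Q : CellSystem n) (g : En n → ℂ) (l : ℝ) : Set (En n) :=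
  {x | ∃ i, l < Q.avg g i x}

/-- The first generation for which the average of `|g|` exceeds the level `l`. -/
def stopTime {n : ℕ} (Q : CellSystem n) (g : En n → ℂ) (l : ℝ) (x : En n) : ℕ :=
  sInf {i | l < Q.avg g i x}

/-- The largest cell containing `x` over which the average of `|g|` exceeds the level `l`. -/
def stopCell {n : ℕ} (Q : CellSystem n) (g : En n → ℂ) (l : ℝ) (x : En n) : Set (En n) :=
  Q.cell (Q.stopTime g l x) x

open Classical in
/-- The good part of `g` at level `l` in the Calderón–Zygmund decomposition. -/
def stopped {n : ℕ} (Q : CellSystem n) (g : En n → ℂ) (l : ℝ) (x : En n) : ℂ :=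
  if x ∈ Q.stopSet g l then ⨍ y in Q.stopCell g l x, g y else g x

/-- The collection of the stopping cells at level `l`. -/
def stopCells {n : ℕ} (Q : CellSystem n) (g : En n → ℂ) (l : ℝ) : Set (Set (En n)) :=
  Q.stopCell g l '' Q.stopSet g l

theorem cell_subset_of_le {n : ℕ} (Q : CellSystem n) {i i' : ℕ} (h : i ≤ i') (x : En n) :
    Q.cell i' x ⊆ Q.cell i x :=
  antitone_nat_of_succ_le (f := fun i => Q.cell i x) (fun i => Q.cell_succ_subset i x) h

theorem cell_eq_of_le {n : ℕ} (Q : CellSystem n) {i i' : ℕ} (h : i ≤ i') {x y : En n}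
    (hy : y ∈ Q.cell i' x) : Q.cell i y = Q.cell i x :=
  Q.cell_eq (Q.cell_subset_of_le h x hy)

theorem avg_stopTime {n : ℕ} {Q : CellSystem n} {g : En n → ℂ} {l : ℝ} {x : En n}
    (hx : x ∈ Q.stopSet g l) : l < Q.avg g (Q.stopTime g l x) x :=
  Nat.sInf_mem (s := {i | l < Q.avg g i x}) hx

theorem mem_stopCell {n : ℕ} (Q : CellSystem n) (g : En n → ℂ) (l : ℝ) (x : En n) :
    x ∈ Q.stopCell g l x := Q.mem_cell _ _

theorem stopTime_eq_of_mem {n : ℕ} {Q : CellSystem n} {g : En n → ℂ} {l : ℝ} {x y : En n}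
    (hx : x ∈ Q.stopSet g l) (hy : y ∈ Q.stopCell g l x) :
    y ∈ Q.stopSet g l ∧ Q.stopTime g l y = Q.stopTime g l x := by
  have havg : ∀ i ≤ Q.stopTime g l x, Q.avg g i y = Q.avg g i x := fun i hi => by
    rw [avg, avg, Q.cell_eq_of_le hi hy]
  have h1 : l < Q.avg g (Q.stopTime g l x) y := by
    rw [havg _ le_rfl]; exact avg_stopTime hx
  refine ⟨⟨_, h1⟩, le_antisymm (Nat.sInf_le h1) ?_⟩
  by_contra! hlt
  have h2 := avg_stopTime (Q := Q) (g := g) (l := l) (x := y) ⟨_, h1⟩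
  rw [havg _ hlt.le] at h2
  exact absurd (Nat.sInf_le h2) (not_le.2 hlt)

theorem stopCell_eq_of_mem {n : ℕ} {Q : CellSystem n} {g : En n → ℂ} {l : ℝ} {x y : En n}
    (hx : x ∈ Q.stopSet g l) (hy : y ∈ Q.stopCell g l x) :
    Q.stopCell g l y = Q.stopCell g l x := by
  rw [stopCell, (stopTime_eq_of_mem hx hy).2]
  exact Q.cell_eq hy

theorem countable_stopCells {n : ℕ} (Q : CellSystem n) (g : En n → ℂ) (l : ℝ) :
    (Q.stopCells g l).Countable := by
  refine (countable_iUnion Q.countable_range).mono ?_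
  rintro _ ⟨x, -, rfl⟩
  exact mem_iUnion.2 ⟨_, x, rfl⟩

theorem measurableSet_of_mem_stopCells {n : ℕ} {Q : CellSystem n} {g : En n → ℂ} {l : ℝ}
    {S : Set (En n)} (hS : S ∈ Q.stopCells g l) : MeasurableSet S := by
  obtain ⟨x, -, rfl⟩ := hS
  exact Q.measurableSet_cell _ _

theorem pairwiseDisjoint_stopCells {n : ℕ} (Q : CellSystem n) (g : En n → ℂ) (l : ℝ) :
    (Q.stopCells g l).PairwiseDisjoint id := by
  rintro _ ⟨x, hx, rfl⟩ _ ⟨y, hy, rfl⟩ hne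
  rw [Function.onFun, Set.disjoint_left]
  intro z hz hz'
  exact hne ((stopCell_eq_of_mem hx hz).symm.trans (stopCell_eq_of_mem hy hz'))

theorem sUnion_stopCells {n : ℕ} (Q : CellSystem n) (g : En n → ℂ) (l : ℝ) :
    ⋃₀ Q.stopCells g l = Q.stopSet g l := by
  ext z
  constructor
  · rintro ⟨_, ⟨x, hx, rfl⟩, hz⟩
    exact (stopTime_eq_of_mem hx hz).1
  · exact fun hz => ⟨_, ⟨z, hz, rfl⟩, Q.mem_stopCell g l z⟩

theorem measurableSet_stopSet {n : ℕ} (Q : CellSystem n) (g : En n → ℂ) (l : ℝ) :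
    MeasurableSet (Q.stopSet g l) := by
  rw [← sUnion_stopCells]
  exact MeasurableSet.sUnion (Q.countable_stopCells g l) fun S hS =>
    measurableSet_of_mem_stopCells hS

theorem stopSet_mono {n : ℕ} (Q : CellSystem n) (g : En n → ℂ) {l l' : ℝ} (h : l ≤ l') :
    Q.stopSet g l' ⊆ Q.stopSet g l := fun _ ⟨i, hi⟩ => ⟨i, h.trans_lt hi⟩

theorem stopCell_subset {n : ℕ} {Q : CellSystem n} {g : En n → ℂ} {l l' : ℝ} (h : l ≤ l')
    {x : En n} (hx : x ∈ Q.stopSet g l') : Q.stopCell g l' x ⊆ Q.stopCell g l x :=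
  Q.cell_subset_of_le (Nat.sInf_le (h.trans_lt (avg_stopTime hx))) x

theorem stopped_eq_of_mem {n : ℕ} {Q : CellSystem n} {g : En n → ℂ} {l : ℝ} {x : En n}
    (hx : x ∈ Q.stopSet g l) : Q.stopped g l x = ⨍ y in Q.stopCell g l x, g y := if_pos hx

theorem stopped_eq_of_notMem {n : ℕ} {Q : CellSystem n} {g : En n → ℂ} {l : ℝ} {x : En n}
    (hx : x ∉ Q.stopSet g l) : Q.stopped g l x = g x := if_neg hx

theorem measurable_stopped {n : ℕ} (Q : CellSystem n) {g : En n → ℂ} (hg : Measurable g) (l : ℝ) :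
    Measurable (Q.stopped g l) := by
  classical
  intro B hB
  have h : Q.stopped g l ⁻¹' B = ((Q.stopSet g l)ᶜ ∩ g ⁻¹' B) ∪
      ⋃₀ {S ∈ Q.stopCells g l | S ⊆ Q.stopped g l ⁻¹' B} := by
    ext x
    constructor
    · intro hx
      by_cases hxs : x ∈ Q.stopSet g l
      · refine Or.inr ⟨_, ⟨⟨x, hxs, rfl⟩, fun y hy => ?_⟩, Q.mem_stopCell g l x⟩
        rw [mem_preimage, stopped_eq_of_mem (stopTime_eq_of_mem hxs hy).1,
          stopCell_eq_of_mem hxs hy, ← stopped_eq_of_mem hxs]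
        exact hx
      · refine Or.inl ⟨hxs, ?_⟩
        rwa [mem_preimage, stopped_eq_of_notMem hxs] at hx
    · rintro (⟨h1, h2⟩ | ⟨S, ⟨-, h1⟩, h2⟩)
      · rwa [mem_preimage, stopped_eq_of_notMem h1]
      · exact h1 h2
  rw [h]
  refine ((Q.measurableSet_stopSet g l).compl.inter (hg hB)).union (MeasurableSet.sUnion
    ((Q.countable_stopCells g l).mono fun S hS => hS.1) fun S hS =>
    measurableSet_of_mem_stopCells hS.1)

theorem measureReal_cell_pos {n : ℕ} (Q : CellSystem n) (i : ℕ) (x : En n) :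
    0 < volume.real (Q.cell i x) :=
  ENNReal.toReal_pos (Q.volume_pos i x).ne' (Q.volume_lt_top i x).ne

theorem avg_succ_le {n : ℕ} (Q : CellSystem n) {g : En n → ℂ} (hg : Integrable g) (i : ℕ)
    (x : En n) : Q.avg g (i + 1) x ≤ 2 ^ n * Q.avg g i x := by
  rw [avg, avg, setAverage_eq, setAverage_eq, smul_eq_mul, smul_eq_mul]
  have h1 := Q.measureReal_cell_pos i x
  have h2 := Q.measureReal_cell_pos (i + 1) x
  have h3 : volume.real (Q.cell i x) ≤ 2 ^ n * volume.real (Q.cell (i + 1) x) := by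
    have := ENNReal.toReal_mono (ENNReal.mul_ne_top (by simp) (Q.volume_lt_top _ _).ne)
      (Q.volume_le i x)
    simpa [Measure.real, ENNReal.toReal_mul] using this
  have h4 : ∫ y in Q.cell (i + 1) x, ‖g y‖ ≤ ∫ y in Q.cell i x, ‖g y‖ :=
    setIntegral_mono_set hg.norm.integrableOn (ae_of_all _ fun _ => norm_nonneg _)
      (ae_of_all _ (Q.cell_succ_subset i x))
  have h0 : 0 ≤ ∫ y in Q.cell i x, ‖g y‖ := integral_nonneg fun _ => norm_nonneg _
  rw [inv_mul_le_iff₀ h2]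
  refine h4.trans ?_
  have h5 : 1 ≤ volume.real (Q.cell (i + 1) x) * (2 ^ n * (volume.real (Q.cell i x))⁻¹) := by
    rw [← mul_assoc, mul_comm _ ((2 : ℝ) ^ n), ← div_eq_mul_inv, one_le_div h1]
    exact h3
  calc _ ≤ (volume.real (Q.cell (i + 1) x) * (2 ^ n * (volume.real (Q.cell i x))⁻¹)) *
        ∫ y in Q.cell i x, ‖g y‖ := le_mul_of_one_le_left h0 h5
    _ = _ := by ring

theorem norm_le_of_avg_le {n : ℕ} (Q : CellSystem n) {g : En n → ℂ} (hg : Integrable g)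
    (hc : Continuous g) {l : ℝ} {x : En n} (h : ∀ i, Q.avg g i x ≤ l) : ‖g x‖ ≤ l := by
  refine le_of_forall_pos_le_add fun ε hε => ?_
  obtain ⟨δ, hδ, hδ'⟩ := Metric.continuousAt_iff.1 (hc.continuousAt (x := x)) ε hε
  obtain ⟨i, hi⟩ := (Q.tendsto_diam.eventually (gt_mem_nhds hδ)).exists
  have hlow : ∀ y ∈ Q.cell i x, ‖g x‖ - ε ≤ ‖g y‖ := fun y hy => by
    have h1 : dist (g y) (g x) < ε := hδ' (by
      rw [dist_eq_norm]; exact (Q.norm_sub_le hy).trans_lt hi)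
    rw [dist_eq_norm] at h1
    have h2 := norm_sub_norm_le (g x) (g y)
    rw [norm_sub_rev] at h2
    linarith
  have h1 := Q.measureReal_cell_pos i x
  have h2 : (‖g x‖ - ε) * volume.real (Q.cell i x) ≤ ∫ y in Q.cell i x, ‖g y‖ := by
    have := setIntegral_mono_on (μ := volume) (f := fun _ : En n => ‖g x‖ - ε)
      (g := fun y => ‖g y‖) (s := Q.cell i x)
      (integrableOn_const (Q.volume_lt_top i x).ne) hg.norm.integrableOn
      (Q.measurableSet_cell i x) hlow
    rw [setIntegral_const, smul_eq_mul] at this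
    linarith
  have h3 := h i
  rw [avg, setAverage_eq, smul_eq_mul, inv_mul_le_iff₀ h1] at h3
  nlinarith

theorem norm_stopped_le {n : ℕ} (Q : CellSystem n) {g : En n → ℂ} (hg : Integrable g)
    (hc : Continuous g) {l : ℝ} (hl : 0 ≤ l) (h0 : ∀ x, Q.avg g 0 x ≤ l) (x : En n) :
    ‖Q.stopped g l x‖ ≤ 2 ^ n * l := by
  by_cases hx : x ∈ Q.stopSet g l
  · rw [stopped_eq_of_mem hx]
    have h1 : ‖⨍ y in Q.stopCell g l x, g y‖ ≤ Q.avg g (Q.stopTime g l x) x := by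
      rw [avg, setAverage_eq, setAverage_eq, norm_smul, norm_inv, smul_eq_mul, stopCell,
        Real.norm_of_nonneg measureReal_nonneg]
      gcongr
      exact norm_integral_le_integral_norm _
    refine h1.trans ?_
    obtain ⟨k, hk⟩ : ∃ k, Q.stopTime g l x = k + 1 := by
      refine Nat.exists_eq_succ_of_ne_zero fun hzero => ?_
      have := avg_stopTime hx
      rw [hzero] at this
      exact absurd this (not_lt.2 (h0 x))
    have h2 : Q.avg g k x ≤ l := by
      by_contra! hlt
      have := Nat.sInf_le (s := {i | l < Q.avg g i x}) hlt
      rw [stopTime] at hk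
      omega
    rw [hk]
    exact (Q.avg_succ_le hg k x).trans (by gcongr)
  · rw [stopped_eq_of_notMem hx]
    refine (Q.norm_le_of_avg_le hg hc fun i => ?_).trans
      (le_mul_of_one_le_left hl (one_le_pow₀ (by norm_num)))
    by_contra! h
    exact hx ⟨i, h⟩

theorem lintegral_stopSet_mono {n : ℕ} {Q : CellSystem n} {g : En n → ℂ} {l : ℝ}
    {F G : En n → ℝ≥0∞}
    (h : ∀ S ∈ Q.stopCells g l, ∫⁻ x in S, F x ≤ ∫⁻ x in S, G x) :
    ∫⁻ x in Q.stopSet g l, F x ≤ ∫⁻ x in Q.stopSet g l, G x := by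
  rw [← sUnion_stopCells, sUnion_eq_biUnion,
    lintegral_biUnion (Q.countable_stopCells g l) (fun S hS => measurableSet_of_mem_stopCells hS)
      (Q.pairwiseDisjoint_stopCells g l),
    lintegral_biUnion (Q.countable_stopCells g l) (fun S hS => measurableSet_of_mem_stopCells hS)
      (Q.pairwiseDisjoint_stopCells g l)]
  exact ENNReal.tsum_le_tsum fun S => h S S.2

theorem volume_stopCell_le {n : ℕ} {Q : CellSystem n} {g : En n → ℂ} (hg : Integrable g) {l : ℝ}
    {S : Set (En n)} (hS : S ∈ Q.stopCells g l) :
    ENNReal.ofReal l * volume S ≤ ∫⁻ x in S, ‖g x‖ₑ := by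
  obtain ⟨x, hx, rfl⟩ := hS
  have h1 := avg_stopTime hx
  have h2 := Q.measureReal_cell_pos (Q.stopTime g l x) x
  rw [avg, setAverage_eq, smul_eq_mul, lt_inv_mul_iff₀ h2] at h1
  rw [← ofReal_integral_norm_eq_lintegral_enorm hg.integrableOn]
  calc ENNReal.ofReal l * volume (Q.stopCell g l x)
      = ENNReal.ofReal l * ENNReal.ofReal (volume.real (Q.stopCell g l x)) := by
        rw [ofReal_measureReal (s := Q.stopCell g l x) (Q.volume_lt_top _ _).ne]
    _ = ENNReal.ofReal (volume.real (Q.stopCell g l x) * l) := by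
        rw [ENNReal.ofReal_mul measureReal_nonneg, mul_comm]
    _ ≤ _ := ENNReal.ofReal_le_ofReal h1.le

theorem volume_stopSet_le {n : ℕ} (Q : CellSystem n) {g : En n → ℂ} (hg : Integrable g) {l : ℝ}
    (hl : 0 ≤ l) :
    ENNReal.ofReal (l / 2) * volume (Q.stopSet g l) ≤
      ∫⁻ x, {x | l / 2 < ‖g x‖}.indicator (fun x => ‖g x‖ₑ) x := by
  set F : En n → ℝ≥0∞ := {x | l / 2 < ‖g x‖}.indicator fun x => ‖g x‖ₑ with hF
  have hpt : ∀ x, ‖g x‖ₑ ≤ ENNReal.ofReal (l / 2) + F x := fun x => by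
    by_cases hx : l / 2 < ‖g x‖
    · rw [hF, indicator_of_mem (by exact hx)]
      exact le_add_self
    · refine le_add_right ?_
      rw [← ofReal_norm]
      exact ENNReal.ofReal_le_ofReal (not_lt.1 hx)
  have hcell : ∀ S ∈ Q.stopCells g l,
      ∫⁻ _ in S, ENNReal.ofReal (l / 2) ≤ ∫⁻ x in S, F x := fun S hS => by
    have h1 := volume_stopCell_le hg hS
    have hfin : ENNReal.ofReal (l / 2) * volume S ≠ ∞ := by
      obtain ⟨x, -, rfl⟩ := hS
      exact ENNReal.mul_ne_top ENNReal.ofReal_ne_top (Q.volume_lt_top _ _).ne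
    have h2 : ∫⁻ x in S, ‖g x‖ₑ ≤ ENNReal.ofReal (l / 2) * volume S + ∫⁻ x in S, F x := by
      refine (lintegral_mono hpt).trans ?_
      rw [lintegral_add_left measurable_const, setLIntegral_const]
    have h3 : ENNReal.ofReal l = ENNReal.ofReal (l / 2) + ENNReal.ofReal (l / 2) := by
      rw [← ENNReal.ofReal_add (by positivity) (by positivity)]; congr 1; ring
    rw [h3, add_mul] at h1
    rw [setLIntegral_const]
    exact (ENNReal.add_le_add_iff_left hfin).1 (h1.trans h2)
  rw [← setLIntegral_const]
  exact (lintegral_stopSet_mono hcell).trans (setLIntegral_le_lintegral _ _)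

theorem lintegral_stopped_le {n : ℕ} (Q : CellSystem n) (g : En n → ℂ) (l : ℝ) :
    ∫⁻ x, ‖Q.stopped g l x‖ₑ ≤ ∫⁻ x, ‖g x‖ₑ := by
  have hm := Q.measurableSet_stopSet g l
  rw [← lintegral_add_compl _ hm, ← lintegral_add_compl (fun x => ‖g x‖ₑ) hm]
  refine add_le_add (lintegral_stopSet_mono ?_) (setLIntegral_mono' hm.compl fun x hx => by
    rw [stopped_eq_of_notMem hx])
  rintro S hS
  obtain ⟨x, hx, rfl⟩ := id hS
  have h1 : ∫⁻ y in Q.stopCell g l x, ‖Q.stopped g l y‖ₑ =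
      ∫⁻ _ in Q.stopCell g l x, ‖⨍ y in Q.stopCell g l x, g y‖ₑ :=
    setLIntegral_congr_fun (measurableSet_of_mem_stopCells hS) fun y hy => by
      rw [stopped_eq_of_mem (stopTime_eq_of_mem hx hy).1, stopCell_eq_of_mem hx hy]
  rw [h1, setLIntegral_const, mul_comm,
    ← ofReal_measureReal (s := Q.stopCell g l x) (Q.volume_lt_top _ _).ne]
  have h2 : 0 < volume.real (Q.stopCell g l x) := Q.measureReal_cell_pos _ _
  calc _ = ‖volume.real (Q.stopCell g l x) • ⨍ y in Q.stopCell g l x, g y‖ₑ := by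
        rw [enorm_smul, Real.enorm_of_nonneg h2.le]
    _ = ‖∫ y in Q.stopCell g l x, g y‖ₑ := by
        rw [setAverage_eq, smul_smul, mul_inv_cancel₀ h2.ne', one_smul]
    _ ≤ _ := enorm_integral_le_lintegral_enorm _

theorem integrable_stopped {n : ℕ} (Q : CellSystem n) {g : En n → ℂ} (hg : Integrable g)
    (hgm : Measurable g) (l : ℝ) : Integrable (Q.stopped g l) :=
  ⟨(Q.measurable_stopped hgm l).aestronglyMeasurable,
    (Q.lintegral_stopped_le g l).trans_lt hg.2⟩

theorem setIntegral_stopped {n : ℕ} (Q : CellSystem n) {g : En n → ℂ} (hg : Integrable g)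
    (hgm : Measurable g) {l : ℝ} {U : Set (En n)} (hU : MeasurableSet U)
    (hsat : ∀ x ∈ U, x ∈ Q.stopSet g l → Q.stopCell g l x ⊆ U) :
    ∫ x in U, Q.stopped g l x = ∫ x in U, g x := by
  have hi := Q.integrable_stopped hg hgm l
  rw [← sub_eq_zero, ← integral_sub hi.integrableOn hg.integrableOn]
  have h1 : ∫ x in U ∩ Q.stopSet g l, (Q.stopped g l x - g x) =
      ∫ x in U, (Q.stopped g l x - g x) := by
    rw [← setIntegral_eq_of_subset_of_forall_sdiff_eq_zero hU inter_subset_left]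
    intro x hx
    rw [stopped_eq_of_notMem fun h => hx.2 ⟨hx.1, h⟩, sub_self]
  set T : Set (Set (En n)) := {S ∈ Q.stopCells g l | S ⊆ U}
  have h2 : U ∩ Q.stopSet g l = ⋃ S ∈ T, S := by
    ext x
    simp only [mem_iUnion, exists_prop]
    constructor
    · rintro ⟨hx, hxs⟩
      exact ⟨_, ⟨⟨x, hxs, rfl⟩, hsat x hx hxs⟩, Q.mem_stopCell g l x⟩
    · rintro ⟨S, ⟨hS, hSU⟩, hxS⟩
      refine ⟨hSU hxS, ?_⟩
      rw [← sUnion_stopCells]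
      exact ⟨S, hS, hxS⟩
  have hcount : T.Countable :=
    (Q.countable_stopCells g l).mono fun S hS => hS.1
  have := hcount.to_subtype
  have h4 : ∫ x in ⋃ S : T, (S : Set (En n)), (Q.stopped g l x - g x) =
      ∑' S : T, ∫ x in (S : Set (En n)), (Q.stopped g l x - g x) := integral_iUnion
    (fun S => measurableSet_of_mem_stopCells S.2.1)
    (fun S S' hne => Q.pairwiseDisjoint_stopCells g l S.2.1 S'.2.1 fun h => hne (Subtype.ext h))
    (hi.sub hg).integrableOn
  rw [← h1, h2, biUnion_eq_iUnion, h4]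
  have h3 : ∀ S : T,
      ∫ x in (S : Set (En n)), (Q.stopped g l x - g x) = 0 := by
    rintro ⟨S, ⟨hS, hSU⟩⟩
    obtain ⟨x, hx, rfl⟩ := id hS
    have hv : volume.real (Q.stopCell g l x) ≠ 0 := (Q.measureReal_cell_pos _ _).ne'
    rw [integral_sub hi.integrableOn hg.integrableOn,
      setIntegral_congr_fun (measurableSet_of_mem_stopCells hS)
        (g := fun _ => ⨍ y in Q.stopCell g l x, g y) fun y hy => by
          simp only
          rw [stopped_eq_of_mem (stopTime_eq_of_mem hx hy).1, stopCell_eq_of_mem hx hy],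
      setIntegral_const, setAverage_eq, smul_smul,
      mul_inv_cancel₀ hv, one_smul, sub_self]
  simp [h3]

end CellSystem

theorem lintegral_mul_le_sq {α : Type*} [MeasurableSpace α] {μ : Measure α} {F G : α → ℝ≥0∞}
    (hF : AEMeasurable F μ) (hG : AEMeasurable G μ) :
    ∫⁻ t, F t * G t ∂μ ≤
      (∫⁻ t, F t ^ 2 ∂μ) ^ (1 / 2 : ℝ) * (∫⁻ t, G t ^ 2 ∂μ) ^ (1 / 2 : ℝ) := by
  simpa using ENNReal.lintegral_mul_le_Lp_mul_Lq μ Real.HolderConjugate.two_two hF hG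

theorem ENNReal_rpow_half_mul_self (x : ℝ≥0∞) : x ^ (1 / 2 : ℝ) * x ^ (1 / 2 : ℝ) = x := by
  rw [← ENNReal.rpow_add_of_nonneg _ _ (by norm_num) (by norm_num)]
  norm_num

/-- Minkowski's inequality for countable sums in `L²`. -/
theorem lintegral_tsum_sq_le {α ι : Type*} [MeasurableSpace α] {μ : Measure α} [Countable ι]
    {F : ι → α → ℝ≥0∞} (hF : ∀ i, AEMeasurable (F i) μ) :
    (∫⁻ t, (∑' i, F i t) ^ 2 ∂μ) ^ (1 / 2 : ℝ) ≤ ∑' i, (∫⁻ t, F i t ^ 2 ∂μ) ^ (1 / 2 : ℝ) := by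
  have h : ∫⁻ t, (∑' i, F i t) ^ 2 ∂μ ≤ (∑' i, (∫⁻ t, F i t ^ 2 ∂μ) ^ (1 / 2 : ℝ)) ^ 2 := by
    calc ∫⁻ t, (∑' i, F i t) ^ 2 ∂μ = ∫⁻ t, ∑' i, ∑' j, F i t * F j t ∂μ := by
          simp only [sq, ENNReal.tsum_mul_left, ENNReal.tsum_mul_right]
      _ = ∑' i, ∑' j, ∫⁻ t, F i t * F j t ∂μ := by
          have hm : ∀ i j, AEMeasurable (fun t => F i t * F j t) μ := fun i j => (hF i).mul (hF j)
          rw [lintegral_tsum fun i => AEMeasurable.tsum (hm i)]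
          exact tsum_congr fun i => lintegral_tsum (hm i)
      _ ≤ ∑' i, ∑' j, (∫⁻ t, F i t ^ 2 ∂μ) ^ (1 / 2 : ℝ) * (∫⁻ t, F j t ^ 2 ∂μ) ^ (1 / 2 : ℝ) :=
          ENNReal.tsum_le_tsum fun i => ENNReal.tsum_le_tsum fun j =>
            lintegral_mul_le_sq (hF i) (hF j)
      _ = _ := by simp only [sq, ENNReal.tsum_mul_left, ENNReal.tsum_mul_right]
  refine (ENNReal.rpow_le_rpow h (by norm_num)).trans_eq ?_
  rw [sq, ENNReal.mul_rpow_of_nonneg _ _ (by norm_num), ENNReal_rpow_half_mul_self]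

theorem enorm_mulOp_le_tsum {n : ℕ} {m b : En n → ℂ} (hm : Integrable m) (hb : Integrable b)
    {T : Set (Set (En n))} (hT : T.Countable) (hTm : ∀ S ∈ T, MeasurableSet S)
    (hTd : T.PairwiseDisjoint id) (hsupp : ∀ x ∉ ⋃₀ T, b x = 0) (x : En n) :
    ‖mulOp n m b x‖ₑ ≤ ∑' S : T, ‖mulOp n m ((S : Set (En n)).indicator b) x‖ₑ := by
  have := hT.to_subtype
  have hi : Integrable fun y => mulKer n m (x - y) * b y :=
    hb.bdd_mul (((continuous_mulKer hm).comp (by fun_prop)).aestronglyMeasurable)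
      (ae_of_all _ fun y => norm_mulKer_le m (x - y))
  have h1 : mulOp n m b x = ∑' S : T, mulOp n m ((S : Set (En n)).indicator b) x := by
    rw [mulOp_eq_mulKer hm hb,
      ← setIntegral_eq_integral_of_forall_compl_eq_zero (s := ⋃₀ T) fun y hy => by
        rw [hsupp y hy, mul_zero], sUnion_eq_iUnion]
    refine (integral_iUnion (s := fun S : T => (S : Set (En n))) (fun S => hTm S S.2)
      (fun S S' hne => hTd S.2 S'.2 fun h => hne (Subtype.ext h)) hi.integrableOn).trans ?_
    refine tsum_congr fun S => ?_
    rw [mulOp_eq_mulKer hm (hb.indicator (hTm S S.2)), ← integral_indicator (hTm S S.2)]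
    congr 1
    funext y
    by_cases hy : y ∈ (S : Set (En n)) <;> simp [hy]
  rw [h1]
  exact enorm_tsum_le_tsum_enorm

theorem sum_lintegral_mulOp_le_tsum {n : ℕ} {ι : Type*} (s : Finset ι) (w : ι → ℝ≥0∞)
    {m : ι → ℝ → En n → ℂ} (hm : ∀ i, Continuous (Function.uncurry (m i))) {r : ι → ℝ}
    (hms : ∀ i t ξ, r i < ‖ξ‖ → m i t ξ = 0) {b : En n → ℂ} (hb : Integrable b) (I : Set ℝ)
    {T : Set (Set (En n))} (hT : T.Countable) (hTm : ∀ S ∈ T, MeasurableSet S)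
    (hTd : T.PairwiseDisjoint id) (hsupp : ∀ x ∉ ⋃₀ T, b x = 0) :
    ∑ i ∈ s, w i * ∫⁻ x, (∫⁻ t in I, ‖mulOp n (m i t) b x‖ₑ ^ 2) ^ (1 / 2 : ℝ) ≤
      ∑' S : T, ∑ i ∈ s, w i * ∫⁻ x,
        (∫⁻ t in I, ‖mulOp n (m i t) ((S : Set (En n)).indicator b) x‖ₑ ^ 2) ^ (1 / 2 : ℝ) := by
  have := hT.to_subtype
  have hc : ∀ i (S : T), Measurable fun q : En n × ℝ =>
      ‖mulOp n (m i q.2) ((S : Set (En n)).indicator b) q.1‖ₑ := fun i S =>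
    (continuous_mulOp_param (hm i) (hms i) (hb.indicator (hTm S S.2))).enorm.measurable
  have hmi : ∀ i t, Integrable (m i t) := fun i t => by
    have hc : Continuous (m i t) := (hm i).comp (by fun_prop : Continuous fun ξ => (t, ξ))
    refine hc.integrable_of_hasCompactSupport (HasCompactSupport.intro
      (isCompact_closedBall (0 : En n) (r i)) fun ξ hξ => hms i t ξ (by simpa using hξ))
  rw [Summable.tsum_finsetSum fun i _ => ENNReal.summable]
  refine Finset.sum_le_sum fun i _ => ?_
  rw [ENNReal.tsum_mul_left, ← lintegral_tsum fun S =>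
    ((((hc i S).pow_const 2).lintegral_prod_right').pow_const _).aemeasurable]
  gcongr with x
  refine le_trans ?_ (lintegral_tsum_sq_le fun S =>
    (Measurable.comp (g := fun q : En n × ℝ =>
      ‖mulOp n (m i q.2) ((S : Set (En n)).indicator b) q.1‖ₑ) (f := fun t : ℝ => (x, t))
      (hc i S) measurable_prodMk_left).aemeasurable)
  gcongr with t
  exact enorm_mulOp_le_tsum (hmi i t) hb hT hTm hTd hsupp x

theorem wavePiece_continuous_support {n : ℕ} {γ : ℝ} (hγ : 1 < γ) {s : ℝ} (hs : 0 ≤ s)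
    (i : ℕ ⊕ ℕ ⊕ Unit) : Continuous (Function.uncurry (wavePiece n γ s i)) ∧
      ∃ r, ∀ t ξ, r < ‖ξ‖ → wavePiece n γ s i t ξ = 0 := by
  obtain ⟨C, -, h1, h2, h3⟩ := wavePiece_symbolBound (n := n) 0 hγ hs (a := 0) (b := 0) (T := 0)
    (fun t ht => by rw [le_antisymm ht.2 ht.1]; simp) le_rfl
  rcases i with k | k | ⟨⟩
  · exact ⟨(h1 k).continuous, _, (h1 k).supp⟩
  · exact ⟨(h2 k).continuous, _, (h2 k).supp⟩
  · exact ⟨h3.continuous, _, h3.supp⟩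

namespace CellSystem

/-- The difference of the good parts at the levels `2 l` and `l`. -/
def layer {n : ℕ} (Q : CellSystem n) (g : En n → ℂ) (l : ℝ) (x : En n) : ℂ :=
  Q.stopped g (2 * l) x - Q.stopped g l x

theorem measurable_layer {n : ℕ} (Q : CellSystem n) {g : En n → ℂ} (hg : Measurable g) (l : ℝ) :
    Measurable (Q.layer g l) :=
  (Q.measurable_stopped hg _).sub (Q.measurable_stopped hg _)

theorem integrable_layer {n : ℕ} (Q : CellSystem n) {g : En n → ℂ} (hg : Integrable g)
    (hgm : Measurable g) (l : ℝ) : Integrable (Q.layer g l) :=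
  (Q.integrable_stopped hg hgm _).sub (Q.integrable_stopped hg hgm _)

theorem layer_eq_zero {n : ℕ} {Q : CellSystem n} {g : En n → ℂ} {l : ℝ} (hl : 0 ≤ l) {x : En n}
    (hx : x ∉ Q.stopSet g l) : Q.layer g l x = 0 := by
  rw [layer, stopped_eq_of_notMem hx,
    stopped_eq_of_notMem fun h => hx (Q.stopSet_mono g (by linarith) h), sub_self]

theorem norm_layer_le {n : ℕ} (Q : CellSystem n) {g : En n → ℂ} (hg : Integrable g)
    (hc : Continuous g) {l : ℝ} (hl : 0 ≤ l) (h0 : ∀ x, Q.avg g 0 x ≤ l) (x : En n) :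
    ‖Q.layer g l x‖ ≤ 3 * 2 ^ n * l := by
  have h1 := Q.norm_stopped_le hg hc hl h0 x
  have h2 := Q.norm_stopped_le hg hc (l := 2 * l) (by positivity)
    (fun x => (h0 x).trans (by linarith)) x
  rw [layer]
  refine (_root_.norm_sub_le _ _).trans ?_
  linarith

theorem setIntegral_layer {n : ℕ} (Q : CellSystem n) {g : En n → ℂ} (hg : Integrable g)
    (hgm : Measurable g) {l : ℝ} (hl : 0 ≤ l) {S : Set (En n)} (hS : S ∈ Q.stopCells g l) :
    ∫ x in S, Q.layer g l x = 0 := by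
  have hSm := measurableSet_of_mem_stopCells hS
  have h1 : ∀ x ∈ S, x ∈ Q.stopSet g l → Q.stopCell g l x ⊆ S := fun x hx hxs => by
    obtain ⟨z, hz, rfl⟩ := hS
    rw [stopCell_eq_of_mem hz hx]
  have h2 : ∀ x ∈ S, x ∈ Q.stopSet g (2 * l) → Q.stopCell g (2 * l) x ⊆ S := fun x hx hxs =>
    (stopCell_subset (by linarith) hxs).trans
      (h1 x hx (Q.stopSet_mono g (by linarith) hxs))
  simp only [layer]
  rw [integral_sub (Q.integrable_stopped hg hgm _).integrableOn
    (Q.integrable_stopped hg hgm _).integrableOn, Q.setIntegral_stopped hg hgm hSm h1,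
    Q.setIntegral_stopped hg hgm hSm h2, sub_self]

theorem sum_lintegral_wavePiece_layer_le {n : ℕ} (hn : 2 ≤ n) {γ : ℝ} (hγ : 1 < γ) {d θ : ℝ}
    (hd : d = γ * n / 2) (hθ : 0 ≤ θ) (a b : ℝ) :
    ∃ C : ℝ, 0 ≤ C ∧ ∀ (K : ℕ) (Q : CellSystem n) (g : En n → ℂ) (l : ℝ), Integrable g →
      Continuous g → 0 ≤ l → (∀ x, Q.avg g 0 x ≤ l) →
      ∑ i ∈ waveIndices K, ENNReal.ofReal (2 ^ (waveExponent d i * (θ - 1))) *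
        ∫⁻ x, (∫⁻ t in Icc a b,
          ‖mulOp n (wavePiece n γ (θ * d / 2) i t) (Q.layer g l) x‖ₑ ^ 2) ^ (1 / 2 : ℝ) ≤
      ENNReal.ofReal (C * l) * volume (Q.stopSet g l) := by
  obtain ⟨C, hC0, hC⟩ := sum_lintegral_wavePiece_atom_le hn hγ hd hθ a b
  have hd0 : 0 ≤ d := by rw [hd]; positivity
  refine ⟨C * (3 * 2 ^ n) * n ^ n, by positivity, fun K Q g l hg hc hl h0 => ?_⟩
  have hpiece := wavePiece_continuous_support (n := n) hγ (s := θ * d / 2) (by positivity)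
  choose hcont r hr using hpiece
  have hTm : ∀ S ∈ Q.stopCells g l, MeasurableSet S := fun S hS =>
    measurableSet_of_mem_stopCells hS
  refine (sum_lintegral_mulOp_le_tsum (waveIndices K) _ hcont hr
    (Q.integrable_layer hg hc.measurable l) (Icc a b) (Q.countable_stopCells g l) hTm
    (Q.pairwiseDisjoint_stopCells g l) fun x hx => layer_eq_zero hl (by
      rwa [sUnion_stopCells] at hx)).trans ?_
  have hatom : ∀ S : Q.stopCells g l, ∑ i ∈ waveIndices K,
      ENNReal.ofReal (2 ^ (waveExponent d i * (θ - 1))) * ∫⁻ x, (∫⁻ t in Icc a b,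
        ‖mulOp n (wavePiece n γ (θ * d / 2) i t)
          ((S : Set (En n)).indicator (Q.layer g l)) x‖ₑ ^ 2) ^ (1 / 2 : ℝ) ≤
      ENNReal.ofReal (C * (3 * 2 ^ n) * n ^ n * l) * volume (S : Set (En n)) := by
    rintro ⟨S, hS⟩
    obtain ⟨z, hz, rfl⟩ := id hS
    refine (hC K _ (3 * 2 ^ n * l) (Q.diam (Q.stopTime g l z)) z
      ((Q.measurable_layer hc.measurable l).indicator (hTm _ hS)) (fun y => ?_)
      (Q.diam_pos _) (fun y hy => ?_) ?_).trans ?_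
    · exact (norm_indicator_le_norm_self _ _).trans (Q.norm_layer_le hg hc hl h0 y)
    · exact indicator_of_notMem (fun hy' => absurd (Q.norm_sub_le hy') (not_le.2 hy)) _
    · rw [integral_indicator (hTm _ hS), Q.setIntegral_layer hg hc.measurable hl hS]
    · have h1 := Q.diam_pow_le (Q.stopTime g l z) z
      rw [ENNReal.ofReal_mul (by positivity)]
      calc _ ≤ ENNReal.ofReal (C * (3 * 2 ^ n * l)) * (n ^ n * volume (Q.stopCell g l z)) := by
            gcongr
            exact h1
        _ = _ := by
            have : (n : ℝ≥0∞) ^ n = ENNReal.ofReal ((n : ℝ) ^ n) := by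
              rw [ENNReal.ofReal_pow (by positivity), ENNReal.ofReal_natCast]
            rw [this, ← mul_assoc, ← ENNReal.ofReal_mul (by positivity)]
            congr 2
            ring
  refine (ENNReal.tsum_le_tsum hatom).trans_eq ?_
  rw [ENNReal.tsum_mul_left, ← sUnion_stopCells, measure_sUnion (Q.countable_stopCells g l)
    (Q.pairwiseDisjoint_stopCells g l) hTm]

theorem stopSet_eq_empty {n : ℕ} (Q : CellSystem n) {g : En n → ℂ} (hg : Integrable g) {l : ℝ}
    (h : ∀ x, ‖g x‖ ≤ l) : Q.stopSet g l = ∅ := by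
  refine eq_empty_of_forall_notMem fun x ⟨i, hi⟩ => absurd hi (not_lt.2 ?_)
  rw [avg, setAverage_eq, smul_eq_mul, inv_mul_le_iff₀ (Q.measureReal_cell_pos i x)]
  have := setIntegral_mono_on (μ := volume) (f := fun y => ‖g y‖) (g := fun _ : En n => l)
    (s := Q.cell i x) hg.norm.integrableOn (integrableOn_const (Q.volume_lt_top i x).ne)
    (Q.measurableSet_cell i x) fun y _ => h y
  rwa [setIntegral_const, smul_eq_mul] at this

theorem sum_layer {n : ℕ} (Q : CellSystem n) {g : En n → ℂ} (hg : Integrable g) {l : ℝ} {J : ℕ}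
    (h : ∀ x, ‖g x‖ ≤ l * 2 ^ J) (x : En n) :
    g x = Q.stopped g l x + ∑ k ∈ Finset.range J, Q.layer g (l * 2 ^ k) x := by
  have h1 : ∀ k, Q.layer g (l * 2 ^ k) x =
      Q.stopped g (l * 2 ^ (k + 1)) x - Q.stopped g (l * 2 ^ k) x := fun k => by
    rw [layer]; congr 2; ring
  rw [Finset.sum_congr rfl fun k _ => h1 k,
    Finset.sum_range_sub fun k => Q.stopped g (l * 2 ^ k) x]
  have h2 : Q.stopped g (l * 2 ^ J) x = g x := stopped_eq_of_notMem (by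
    rw [Q.stopSet_eq_empty hg h]; simp)
  rw [h2]
  simp

end CellSystem

/-- The three lines theorem for a finite exponential sum. -/
theorem norm_exp_sum_le_interp {ι : Type*} (s : Finset ι) (a b : ι → ℝ) (w : ι → ℂ) {A B θ : ℝ}
    (hθ0 : 0 ≤ θ) (hθ1 : θ ≤ 1)
    (hA : ∀ z : ℂ, z.re = 0 → ‖∑ i ∈ s, Complex.exp (a i * z + b i) * w i‖ ≤ A)
    (hB : ∀ z : ℂ, z.re = 1 → ‖∑ i ∈ s, Complex.exp (a i * z + b i) * w i‖ ≤ B) :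
    ‖∑ i ∈ s, Complex.exp (a i * θ + b i) * w i‖ ≤ A ^ (1 - θ) * B ^ θ := by
  have hd : Differentiable ℂ fun z : ℂ => ∑ i ∈ s, Complex.exp (a i * z + b i) * w i := by
    fun_prop
  have h := Complex.HadamardThreeLines.norm_le_interp_of_mem_verticalClosedStrip₀₁'
    (fun z : ℂ => ∑ i ∈ s, Complex.exp (a i * z + b i) * w i) (z := (θ : ℂ)) (a := A) (b := B)
    (by simp [Complex.HadamardThreeLines.verticalClosedStrip, hθ0, hθ1]) hd.diffContOnCl ?_ hA hB
  · simpa using h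
  · refine ⟨∑ i ∈ s, Real.exp (|a i| + b i) * ‖w i‖, ?_⟩
    rintro _ ⟨z, hz, rfl⟩
    simp only [Complex.HadamardThreeLines.verticalClosedStrip, mem_preimage, mem_Icc] at hz
    refine (norm_sum_le _ _).trans (Finset.sum_le_sum fun i _ => ?_)
    rw [norm_mul, Complex.norm_exp]
    gcongr
    simp only [Complex.add_re, Complex.mul_re, Complex.ofReal_re, Complex.ofReal_im, zero_mul,
      sub_zero]
    have : a i * z.re ≤ |a i| := by
      calc a i * z.re ≤ |a i| * z.re := mul_le_mul_of_nonneg_right (le_abs_self _) hz.1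
        _ ≤ |a i| * 1 := by gcongr; exact hz.2
        _ = |a i| := mul_one _
    linarith

theorem lintegral_prod_mul_le {X T : Type*} [MeasurableSpace X] [MeasurableSpace T]
    {μ : Measure X} {ν : Measure T} [SFinite μ] [SFinite ν] {f G : X × T → ℂ}
    (hf : Measurable f) (hG : Measurable G) (hG1 : ∀ x, ∫⁻ t, ‖G (x, t)‖ₑ ^ 2 ∂ν ≤ 1) :
    ∫⁻ q, ‖f q‖ₑ * ‖G q‖ₑ ∂(μ.prod ν) ≤ ∫⁻ x, (∫⁻ t, ‖f (x, t)‖ₑ ^ 2 ∂ν) ^ (1 / 2 : ℝ) ∂μ := by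
  rw [lintegral_prod (fun q => ‖f q‖ₑ * ‖G q‖ₑ) (hf.enorm.mul hG.enorm).aemeasurable]
  refine lintegral_mono fun x => ?_
  refine (lintegral_mul_le_sq (hf.comp measurable_prodMk_left).enorm.aemeasurable
    (hG.comp measurable_prodMk_left).enorm.aemeasurable).trans ?_
  refine (mul_le_mul_right (ENNReal.rpow_le_rpow (hG1 x) (by norm_num)) _).trans_eq ?_
  rw [ENNReal.one_rpow, mul_one]
  rfl

theorem sum_indicator_eq_zero_or {X κ : Type*} (L : Finset κ) {E : κ → Set X}
    (hE : Pairwise fun l l' => Disjoint (E l) (E l')) (w : κ → ℂ) (x : X) :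
    ∑ l ∈ L, (E l).indicator (fun _ => w l) x = 0 ∨
      ∃ l ∈ L, x ∈ E l ∧ ∑ l ∈ L, (E l).indicator (fun _ => w l) x = w l := by
  by_cases h : ∃ l ∈ L, x ∈ E l
  · obtain ⟨l, hl, hx⟩ := h
    refine Or.inr ⟨l, hl, hx, ?_⟩
    rw [Finset.sum_eq_single_of_mem l hl fun k _ hk => indicator_of_notMem
      (fun hx' => (hE hk).le_bot ⟨hx', hx⟩) _, indicator_of_mem hx]
  · push Not at h
    exact Or.inl (Finset.sum_eq_zero fun l hl => indicator_of_notMem (h l hl) _)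

theorem norm_sum_dual_le_interp {X T ι κ : Type*} [MeasurableSpace X] [MeasurableSpace T]
    {μ : Measure X} {ν : Measure T} [SFinite μ] [SFinite ν] (s : Finset ι) {u : ι → X × T → ℂ}
    (hu : ∀ i, Measurable (u i)) (c : ι → ℝ) {p θ A Y : ℝ} (hp1 : 1 < p) (hp2 : p ≤ 2)
    (hθ : θ = 2 / p - 1) (hA : 0 ≤ A) (hY : 0 ≤ Y)
    (h0 : ∀ z : ℂ, z.re = 0 →
      ∫⁻ q, ‖∑ i ∈ s, Complex.exp (c i * (z - θ)) * u i q‖ₑ ^ 2 ∂(μ.prod ν) ≤ ENNReal.ofReal A)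
    (h1 : ∑ i ∈ s, ENNReal.ofReal (Real.exp (c i * (1 - θ))) *
      ∫⁻ x, (∫⁻ t, ‖u i (x, t)‖ₑ ^ 2 ∂ν) ^ (1 / 2 : ℝ) ∂μ ≤ ENNReal.ofReal A)
    {G : X × T → ℂ} (hG : Measurable G) (hG1 : ∀ x, ∫⁻ t, ‖G (x, t)‖ₑ ^ 2 ∂ν ≤ 1)
    (L : Finset κ) {E : κ → Set X} (hEm : ∀ l, MeasurableSet (E l))
    (hE : Pairwise fun l l' => Disjoint (E l) (E l')) {v : κ → ℝ} (hv : ∀ l, 0 < v l)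
    (hEY : ∑ l ∈ L, ENNReal.ofReal (v l ^ p) * μ (E l) ≤ ENNReal.ofReal Y) :
    ‖∑ l ∈ L, ((v l ^ (p - 1) : ℝ) : ℂ) *
      ∫ q, (E l).indicator (fun _ => (1 : ℂ)) q.1 * ((∑ i ∈ s, u i q) * G q) ∂(μ.prod ν)‖ ≤
      (A ^ (1 / 2 : ℝ) * Y ^ (1 / 2 : ℝ)) ^ (1 - θ) * A ^ θ := by
  have hp0 : 0 < p := by linarith
  have hθp : (1 - θ) * (p / 2) = p - 1 := by rw [hθ]; field_simp; ring
  have hθ0 : 0 ≤ θ := by rw [hθ, sub_nonneg, le_div_iff₀ hp0]; linarith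
  have hθ1 : θ ≤ 1 := by
    rw [hθ, sub_le_iff_le_add, div_le_iff₀ hp0]; linarith
  have hfin : ∀ i ∈ s, ∫⁻ x, (∫⁻ t, ‖u i (x, t)‖ₑ ^ 2 ∂ν) ^ (1 / 2 : ℝ) ∂μ < ⊤ := by
    intro i hi
    by_contra hcon
    rw [not_lt, top_le_iff] at hcon
    have := (Finset.single_le_sum (f := fun i => ENNReal.ofReal (Real.exp (c i * (1 - θ))) *
      ∫⁻ x, (∫⁻ t, ‖u i (x, t)‖ₑ ^ 2 ∂ν) ^ (1 / 2 : ℝ) ∂μ) (fun _ _ => zero_le) hi).trans h1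
    simp only [hcon] at this
    rw [ENNReal.mul_top (by simpa using Real.exp_pos _)] at this
    exact absurd this (by simp)
  have hinteg : ∀ i ∈ s, ∀ l, Integrable
      (fun q : X × T => (E l).indicator (fun _ => (1 : ℂ)) q.1 * (u i q * G q)) (μ.prod ν) := by
    intro i hi l
    have h : Integrable (fun q : X × T => u i q * G q) (μ.prod ν) := by
      refine ⟨((hu i).mul hG).aestronglyMeasurable, ?_⟩
      rw [HasFiniteIntegral]
      simp only [enorm_mul]
      exact (lintegral_prod_mul_le (hu i) hG hG1).trans_lt (hfin i hi)
    refine h.bdd_mul (c := 1) ((measurable_const.indicator (hEm l)).comp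
      measurable_fst).aestronglyMeasurable (ae_of_all _ fun q => ?_)
    exact (norm_indicator_le_norm_self _ _).trans (by simp)
  set w : ι × κ → ℂ := fun j =>
    ∫ q, (E j.2).indicator (fun _ => (1 : ℂ)) q.1 * (u j.1 q * G q) ∂(μ.prod ν) with hw
  set α : ι × κ → ℝ := fun j => c j.1 - Real.log (v j.2) * (p / 2) with hα
  set β : ι × κ → ℝ := fun j => Real.log (v j.2) * (p / 2) - c j.1 * θ with hβ
  set W : ℂ → X → ℂ := fun z x =>
    ∑ l ∈ L, (E l).indicator (fun _ => Complex.exp (Real.log (v l) * (p / 2) * (1 - z))) x with hW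
  have hWm : ∀ z, Measurable (W z) := fun z =>
    Finset.measurable_sum _ fun l _ => measurable_const.indicator (hEm l)
  have hrep : ∀ z : ℂ, ∑ j ∈ s ×ˢ L, Complex.exp (α j * z + β j) * w j =
      ∫ q, (∑ i ∈ s, Complex.exp (c i * (z - θ)) * u i q) * (W z q.1 * G q) ∂(μ.prod ν) := by
    intro z
    have hexp : ∀ i l, Complex.exp (α (i, l) * z + β (i, l)) =
        Complex.exp (c i * (z - θ)) * Complex.exp (Real.log (v l) * (p / 2) * (1 - z)) := by
      intro i l
      rw [← Complex.exp_add]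
      congr 1
      simp only [hα, hβ]
      push_cast
      ring
    have hpt : ∀ q : X × T, (∑ i ∈ s, Complex.exp (c i * (z - θ)) * u i q) * (W z q.1 * G q) =
        ∑ j ∈ s ×ˢ L, Complex.exp (α j * z + β j) *
          ((E j.2).indicator (fun _ => (1 : ℂ)) q.1 * (u j.1 q * G q)) := by
      intro q
      rw [Finset.sum_product, hW, Finset.sum_mul]
      refine Finset.sum_congr rfl fun i _ => ?_
      rw [Finset.sum_mul, Finset.mul_sum]
      refine Finset.sum_congr rfl fun l _ => ?_
      rw [hexp]
      by_cases hq : q.1 ∈ E l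
      · simp only [indicator_of_mem hq]; ring
      · simp only [indicator_of_notMem hq]; ring
    simp_rw [hpt]
    rw [integral_finsetSum _ fun j hj =>
      (hinteg j.1 (Finset.mem_product.1 hj).1 j.2).const_mul _]
    exact Finset.sum_congr rfl fun j _ => (integral_const_mul _ _).symm
  have hnormW : ∀ (z : ℂ) l, ‖Complex.exp (Real.log (v l) * (p / 2) * (1 - z))‖ₑ =
      ENNReal.ofReal (v l ^ (p / 2 * (1 - z.re))) := by
    intro z l
    rw [← ofReal_norm, Complex.norm_exp, Real.rpow_def_of_pos (hv l)]
    congr 2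
    have : (Real.log (v l) * (p / 2) * (1 - z) : ℂ) = ((Real.log (v l) * (p / 2) : ℝ) : ℂ) * (1 - z)
      := by push_cast; ring
    rw [this, Complex.re_ofReal_mul]
    simp
    ring
  have hmain := norm_exp_sum_le_interp (s ×ˢ L) α β w (A := A ^ (1 / 2 : ℝ) * Y ^ (1 / 2 : ℝ))
    (B := A) hθ0 hθ1 ?_ ?_
  · convert hmain using 2
    rw [hrep θ]
    have hpt : ∀ q : X × T, (∑ i ∈ s, Complex.exp (c i * ((θ : ℂ) - θ)) * u i q) *
        (W θ q.1 * G q) = ∑ l ∈ L, ((v l ^ (p - 1) : ℝ) : ℂ) *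
          ((E l).indicator (fun _ => (1 : ℂ)) q.1 * ((∑ i ∈ s, u i q) * G q)) := by
      intro q
      simp only [sub_self, mul_zero, Complex.exp_zero, one_mul, hW]
      rw [Finset.sum_mul (s := L), Finset.mul_sum]
      refine Finset.sum_congr rfl fun l _ => ?_
      have : Complex.exp (Real.log (v l) * (p / 2) * (1 - θ)) = ((v l ^ (p - 1) : ℝ) : ℂ) := by
        rw [Real.rpow_def_of_pos (hv l), ← hθp]
        push_cast
        congr 1
        ring
      rw [this]
      by_cases hq : q.1 ∈ E l
      · simp only [indicator_of_mem hq]; ring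
      · simp only [indicator_of_notMem hq]; ring
    simp_rw [hpt]
    rw [integral_finsetSum]
    · exact Finset.sum_congr rfl fun j _ => (integral_const_mul _ _).symm
    · intro l _
      refine Integrable.const_mul ?_ _
      simp_rw [Finset.sum_mul, Finset.mul_sum]
      exact integrable_finsetSum _ fun i hi => hinteg i hi l
  · intro z hz
    rw [hrep z, ← ENNReal.ofReal_le_ofReal_iff (by positivity), ofReal_norm]
    refine (enorm_integral_le_lintegral_enorm _).trans ?_
    have hFm : Measurable fun q => ∑ i ∈ s, Complex.exp (c i * (z - θ)) * u i q :=
      Finset.measurable_sum _ fun i _ => (hu i).const_mul _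
    have hGm : Measurable fun q : X × T => W z q.1 * G q :=
      ((hWm z).comp measurable_fst).mul hG
    simp_rw [enorm_mul (∑ i ∈ s, Complex.exp (c i * (z - θ)) * u i _)]
    refine (lintegral_mul_le_sq hFm.enorm.aemeasurable hGm.enorm.aemeasurable).trans ?_
    rw [ENNReal.ofReal_mul (by positivity), ← ENNReal.ofReal_rpow_of_nonneg hA (by norm_num),
      ← ENNReal.ofReal_rpow_of_nonneg hY (by norm_num)]
    gcongr
    · exact h0 z hz
    · rw [lintegral_prod _ (hGm.enorm.pow_const 2).aemeasurable]
      calc ∫⁻ x, ∫⁻ t, ‖W z x * G (x, t)‖ₑ ^ 2 ∂ν ∂μ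
          ≤ ∫⁻ x, ‖W z x‖ₑ ^ 2 ∂μ := by
            refine lintegral_mono fun x => ?_
            simp_rw [enorm_mul, mul_pow]
            have hm : Measurable fun t => ‖G (x, t)‖ₑ ^ 2 :=
              (hG.comp measurable_prodMk_left).enorm.pow_const 2
            rw [lintegral_const_mul _ hm]
            exact (mul_le_mul_right (hG1 x) _).trans_eq (mul_one _)
        _ ≤ ∫⁻ x, ∑ l ∈ L, (E l).indicator (fun _ => ENNReal.ofReal (v l ^ p)) x ∂μ := by
            refine lintegral_mono fun x => ?_
            rcases sum_indicator_eq_zero_or L hE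
              (fun l => Complex.exp (Real.log (v l) * (p / 2) * (1 - z))) x with h | ⟨l, hl, hx, h⟩
            · simp [hW, h]
            refine le_trans (le_of_eq ?_) (Finset.single_le_sum (f := fun l =>
              (E l).indicator (fun _ => ENNReal.ofReal (v l ^ p)) x) (fun _ _ => zero_le) hl)
            simp only [hW]
            rw [h, indicator_of_mem hx, hnormW, hz,
              ← ENNReal.ofReal_pow (by have := hv l; positivity),
              ← Real.rpow_natCast (v l ^ (p / 2 * (1 - 0))), ← Real.rpow_mul (hv l).le]
            congr 2
            push_cast
            ring
        _ = ∑ l ∈ L, ENNReal.ofReal (v l ^ p) * μ (E l) := by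
            rw [lintegral_finsetSum _ fun l _ => measurable_const.indicator (hEm l)]
            exact Finset.sum_congr rfl fun l _ => lintegral_indicator_const (hEm l) _
        _ ≤ _ := hEY
  · intro z hz
    rw [hrep z, ← ENNReal.ofReal_le_ofReal_iff hA, ofReal_norm]
    refine (enorm_integral_le_lintegral_enorm _).trans (le_trans ?_ h1)
    have hW1 : ∀ x, ‖W z x‖ₑ ≤ 1 := by
      intro x
      rcases sum_indicator_eq_zero_or L hE
        (fun l => Complex.exp (Real.log (v l) * (p / 2) * (1 - z))) x with h | ⟨l, hl, hx, h⟩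
      · simp [hW, h]
      · simp only [hW]
        rw [h, hnormW, hz]
        simp
    calc ∫⁻ q, ‖(∑ i ∈ s, Complex.exp (c i * (z - θ)) * u i q) * (W z q.1 * G q)‖ₑ ∂(μ.prod ν)
        ≤ ∫⁻ q, ∑ i ∈ s, ENNReal.ofReal (Real.exp (c i * (1 - θ))) *
            (‖u i q‖ₑ * ‖G q‖ₑ) ∂(μ.prod ν) := by
          refine lintegral_mono fun q => ?_
          rw [Finset.sum_mul]
          refine (enorm_sum_le _ _).trans (Finset.sum_le_sum fun i _ => ?_)
          rw [enorm_mul, enorm_mul, enorm_mul, mul_assoc]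
          have : ‖Complex.exp (c i * (z - θ))‖ₑ = ENNReal.ofReal (Real.exp (c i * (1 - θ))) := by
            rw [← ofReal_norm, Complex.norm_exp, Complex.re_ofReal_mul]
            simp [hz]
          rw [this]
          gcongr
          exact (mul_le_mul_left (hW1 q.1) _).trans_eq (one_mul _)
      _ ≤ _ := by
          have hm : ∀ i, Measurable fun q => ‖u i q‖ₑ * ‖G q‖ₑ := fun i =>
            (hu i).enorm.mul hG.enorm
          rw [lintegral_finsetSum _ fun i _ => (hm i).const_mul _]
          refine Finset.sum_le_sum fun i _ => ?_
          rw [lintegral_const_mul _ (hm i)]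
          gcongr
          exact lintegral_prod_mul_le (hu i) hG hG1

theorem le_of_le_interp {A Y θ : ℝ} (hA : 0 ≤ A) (hθ0 : 0 ≤ θ) (hθ1 : θ < 1)
    (h : Y ≤ (A ^ (1 / 2 : ℝ) * Y ^ (1 / 2 : ℝ)) ^ (1 - θ) * A ^ θ) : Y ≤ A := by
  by_contra! hlt
  have hY : 0 < Y := hA.trans_lt hlt
  have h1 : A ^ (1 / 2 : ℝ) * Y ^ (1 / 2 : ℝ) < Y := by
    calc _ < Y ^ (1 / 2 : ℝ) * Y ^ (1 / 2 : ℝ) := by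
          gcongr
      _ = Y := by rw [← Real.rpow_add hY]; norm_num
  have h2 : (A ^ (1 / 2 : ℝ) * Y ^ (1 / 2 : ℝ)) ^ (1 - θ) < Y ^ (1 - θ) :=
    Real.rpow_lt_rpow (by positivity) h1 (by linarith)
  have h3 : (A ^ (1 / 2 : ℝ) * Y ^ (1 / 2 : ℝ)) ^ (1 - θ) * A ^ θ < Y :=
    calc _ ≤ (A ^ (1 / 2 : ℝ) * Y ^ (1 / 2 : ℝ)) ^ (1 - θ) * Y ^ θ := by gcongr
      _ < Y ^ (1 - θ) * Y ^ θ := by gcongr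
      _ = Y := by rw [← Real.rpow_add hY]; simp
  linarith

/-- Interpolation between an `L²` bound and an `L¹(L²)` bound for a finite family. -/
theorem lintegral_rpow_le_of_interp {X T ι : Type*} [MeasurableSpace X] [MeasurableSpace T]
    {μ : Measure X} {ν : Measure T} [SFinite μ] [SFinite ν] (s : Finset ι) {u : ι → X × T → ℂ}
    (hu : ∀ i, Measurable (u i)) (c : ι → ℝ) {p θ A : ℝ} (hp1 : 1 < p) (hp2 : p ≤ 2)
    (hθ : θ = 2 / p - 1) (hA : 0 ≤ A)
    (h0 : ∀ z : ℂ, z.re = 0 →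
      ∫⁻ q, ‖∑ i ∈ s, Complex.exp (c i * (z - θ)) * u i q‖ₑ ^ 2 ∂(μ.prod ν) ≤ ENNReal.ofReal A)
    (h1 : ∑ i ∈ s, ENNReal.ofReal (Real.exp (c i * (1 - θ))) *
      ∫⁻ x, (∫⁻ t, ‖u i (x, t)‖ₑ ^ 2 ∂ν) ^ (1 / 2 : ℝ) ∂μ ≤ ENNReal.ofReal A) :
    ∫⁻ x, (∫⁻ t, ‖∑ i ∈ s, u i (x, t)‖ₑ ^ 2 ∂ν) ^ (p / 2) ∂μ ≤ 4 * ENNReal.ofReal A := by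
  have hp0 : 0 < p := by linarith
  have hθ0 : 0 ≤ θ := by rw [hθ, sub_nonneg, le_div_iff₀ hp0]; linarith
  have hθ1 : θ < 1 := by
    rw [hθ, sub_lt_iff_lt_add, div_lt_iff₀ hp0]; linarith
  set U : X × T → ℂ := fun q => ∑ i ∈ s, u i q with hU
  have hUm : Measurable U := Finset.measurable_sum _ fun i _ => hu i
  set N : X → ℝ≥0∞ := fun x => (∫⁻ t, ‖U (x, t)‖ₑ ^ 2 ∂ν) ^ (1 / 2 : ℝ) with hN
  have hNm : Measurable N := (hUm.enorm.pow_const 2).lintegral_prod_right'.pow_const _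
  have hNsq : ∀ x, ∫⁻ t, ‖U (x, t)‖ₑ ^ 2 ∂ν = N x ^ 2 := fun x => by
    rw [hN, sq, ENNReal_rpow_half_mul_self]
  have hNint : ∫⁻ x, N x ∂μ < ⊤ := by
    have hle : ∀ x, N x ≤ ∑ i ∈ s, (∫⁻ t, ‖u i (x, t)‖ₑ ^ 2 ∂ν) ^ (1 / 2 : ℝ) := fun x => by
      have hm : ∀ i, AEMeasurable (fun t => ‖u i (x, t)‖ₑ) ν := fun i =>
        ((hu i).comp measurable_prodMk_left).enorm.aemeasurable
      have := lintegral_tsum_sq_le (ι := s) (μ := ν) (F := fun i t => ‖u i (x, t)‖ₑ)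
        fun i => hm i
      rw [tsum_fintype, Finset.sum_coe_sort s
        fun i => (∫⁻ t, ‖u i (x, t)‖ₑ ^ 2 ∂ν) ^ (1 / 2 : ℝ)] at this
      refine le_trans (ENNReal.rpow_le_rpow (lintegral_mono fun t => ?_) (by norm_num)) this
      rw [tsum_fintype, Finset.sum_coe_sort s fun i => ‖u i (x, t)‖ₑ]
      gcongr
      exact enorm_sum_le _ _
    refine (lintegral_mono hle).trans_lt ?_
    rw [lintegral_finsetSum _ fun i _ =>
      ((hu i).enorm.pow_const 2).lintegral_prod_right'.pow_const _]
    refine ENNReal.sum_lt_top.2 fun i hi => ?_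
    by_contra hcon
    rw [not_lt, top_le_iff] at hcon
    have := (Finset.single_le_sum (f := fun i => ENNReal.ofReal (Real.exp (c i * (1 - θ))) *
      ∫⁻ x, (∫⁻ t, ‖u i (x, t)‖ₑ ^ 2 ∂ν) ^ (1 / 2 : ℝ) ∂μ) (fun _ _ => zero_le) hi).trans h1
    simp only [hcon] at this
    rw [ENNReal.mul_top (by simpa using Real.exp_pos _)] at this
    exact absurd this (by simp)
  set G : X × T → ℂ := fun q => (starRingEnd ℂ) (U q) * (((N q.1).toReal⁻¹ : ℝ) : ℂ) with hGdef
  have hG : Measurable G := (Complex.continuous_conj.measurable.comp hUm).mul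
    (Complex.measurable_ofReal.comp (hNm.comp measurable_fst).ennreal_toReal.inv)
  have hG1 : ∀ x, ∫⁻ t, ‖G (x, t)‖ₑ ^ 2 ∂ν ≤ 1 := by
    intro x
    have hm : Measurable fun t => ‖U (x, t)‖ₑ ^ 2 :=
      (hUm.comp measurable_prodMk_left).enorm.pow_const 2
    have : ∀ t, ‖G (x, t)‖ₑ ^ 2 = ‖U (x, t)‖ₑ ^ 2 * ENNReal.ofReal ((N x).toReal⁻¹) ^ 2 := by
      intro t
      rw [hGdef]
      simp only [enorm_mul, mul_pow]
      rw [← ofReal_norm, RCLike.norm_conj, ofReal_norm,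
        ← ofReal_norm (((N x).toReal⁻¹ : ℝ) : ℂ), Complex.norm_real, Real.norm_of_nonneg
          (by positivity)]
    simp_rw [this]
    rw [lintegral_mul_const _ hm, hNsq]
    by_cases hz : N x = 0
    · simp [hz]
    by_cases ht : N x = ⊤
    · simp [ht]
    rw [ENNReal.ofReal_inv_of_pos (ENNReal.toReal_pos hz ht), ENNReal.ofReal_toReal ht, ← mul_pow,
      ENNReal.mul_inv_cancel hz ht, one_pow]
  set E : ℤ → Set X := fun l => N ⁻¹' Ico ((2 : ℝ≥0∞) ^ l) (2 ^ (l + 1)) with hEdef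
  have hEm : ∀ l, MeasurableSet (E l) := fun l => hNm measurableSet_Ico
  have hE : Pairwise fun l l' => Disjoint (E l) (E l') := by
    have key : ∀ l l' : ℤ, l < l' → Disjoint (E l) (E l') := fun l l' h => by
      refine Set.disjoint_left.2 fun x hx hx' => ?_
      have : (2 : ℝ≥0∞) ^ (l + 1) ≤ 2 ^ l' := ENNReal.zpow_le_of_le (by norm_num) (by omega)
      exact absurd (hx.2.trans_le this) (not_lt.2 hx'.1)
    intro l l' h
    rcases lt_or_gt_of_ne h with h | h
    · exact key _ _ h
    · exact (key _ _ h).symm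
  set v : ℤ → ℝ := fun l => 2 ^ l with hvdef
  have hv : ∀ l, 0 < v l := fun l => by positivity
  have hvE : ∀ l, ENNReal.ofReal (v l) = 2 ^ l := fun l => by
    have h2 : Real.toNNReal 2 = 2 := by simp
    rw [hvdef, ENNReal.ofReal, Real.toNNReal_zpow (by norm_num), h2, ENNReal.coe_zpow (by norm_num)]
    rfl
  have hne : ∀ l, ∀ x ∈ E l, N x ≠ 0 ∧ N x ≠ ⊤ := fun l x hx =>
    ⟨fun h => by
      have := hx.1
      rw [h, ← hvE l, nonpos_iff_eq_zero, ENNReal.ofReal_eq_zero] at this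
      exact absurd (hv l) (not_lt.2 this), (hx.2.trans_le le_top).ne⟩
  have hR : ∀ l, ∫⁻ q, ENNReal.ofReal ((E l).indicator (fun _ => (1 : ℝ)) q.1 *
      (‖U q‖ ^ 2 * (N q.1).toReal⁻¹)) ∂(μ.prod ν) = ∫⁻ x in E l, N x ∂μ := by
    intro l
    have hm : Measurable fun q : X × T => ENNReal.ofReal ((E l).indicator (fun _ => (1 : ℝ)) q.1 *
      (‖U q‖ ^ 2 * (N q.1).toReal⁻¹)) :=
      (((measurable_const.indicator (hEm l)).comp measurable_fst).mul
        ((hUm.norm.pow_const 2).mul (hNm.comp measurable_fst).ennreal_toReal.inv)).ennreal_ofReal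
    rw [lintegral_prod _ hm.aemeasurable, ← lintegral_indicator (hEm l)]
    refine lintegral_congr fun x => ?_
    by_cases hx : x ∈ E l
    · simp only [indicator_of_mem hx, one_mul]
      have hmU : Measurable fun t => ‖U (x, t)‖ₑ ^ 2 :=
        (hUm.comp measurable_prodMk_left).enorm.pow_const 2
      obtain ⟨hz, ht⟩ := hne l x hx
      calc ∫⁻ t, ENNReal.ofReal (‖U (x, t)‖ ^ 2 * (N x).toReal⁻¹) ∂ν
          = ∫⁻ t, ‖U (x, t)‖ₑ ^ 2 * (N x)⁻¹ ∂ν := lintegral_congr fun t => by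
            rw [ENNReal.ofReal_mul (by positivity), ENNReal.ofReal_pow (norm_nonneg _), ofReal_norm,
              ENNReal.ofReal_inv_of_pos (ENNReal.toReal_pos hz ht), ENNReal.ofReal_toReal ht]
        _ = N x := by
            rw [lintegral_mul_const _ hmU, hNsq, sq, mul_assoc, ENNReal.mul_inv_cancel hz ht,
              mul_one]
    · simp [indicator_of_notMem hx]
  have hRlow : ∀ l, ENNReal.ofReal (v l) * μ (E l) ≤ ∫⁻ x in E l, N x ∂μ := fun l => by
    rw [← setLIntegral_const, hvE]
    exact setLIntegral_mono' (hEm l) fun x hx => hx.1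
  have hRtop : ∀ l, ∫⁻ x in E l, N x ∂μ ≠ ⊤ := fun l =>
    ((setLIntegral_le_lintegral _ _).trans_lt hNint).ne
  have hEfin : ∀ l, μ (E l) ≠ ⊤ := fun l h => by
    have := hRlow l
    rw [h, ENNReal.mul_top (by simpa using hv l), top_le_iff] at this
    exact hRtop l this
  have hfinite : ∀ L : Finset ℤ, ∑ l ∈ L, ENNReal.ofReal (v l ^ p) * μ (E l) ≤
      ENNReal.ofReal A := by
    intro L
    set Z := ∑ l ∈ L, ENNReal.ofReal (v l ^ p) * μ (E l) with hZ
    have hZt : Z ≠ ⊤ := ENNReal.sum_ne_top.2 fun l _ =>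
      ENNReal.mul_ne_top ENNReal.ofReal_ne_top (hEfin l)
    have hdual := norm_sum_dual_le_interp (μ := μ) (ν := ν) s hu c hp1 hp2 hθ hA
      (Y := Z.toReal) ENNReal.toReal_nonneg h0 h1 hG hG1 L hEm hE hv
      (by rw [ENNReal.ofReal_toReal hZt])
    have hinteg : ∀ l, ∫ q, (E l).indicator (fun _ => (1 : ℂ)) q.1 * ((∑ i ∈ s, u i q) * G q)
        ∂(μ.prod ν) = (((∫⁻ x in E l, N x ∂μ).toReal : ℝ) : ℂ) := by
      intro l
      rw [← hR l, ← integral_eq_lintegral_of_nonneg_ae, ← integral_complex_ofReal]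
      · refine integral_congr_ae (ae_of_all _ fun q => ?_)
        have h2 : (∑ i ∈ s, u i q) * G q = ((‖U q‖ ^ 2 * (N q.1).toReal⁻¹ : ℝ) : ℂ) := by
          rw [hGdef]
          simp only
          rw [← mul_assoc]
          have : (∑ i ∈ s, u i q) * (starRingEnd ℂ) (U q) = ((‖U q‖ ^ 2 : ℝ) : ℂ) := by
            rw [Complex.ofReal_pow]
            exact Complex.mul_conj' _
          rw [this]
          push_cast
          rfl
        simp only
        rw [h2]
        by_cases hq : q.1 ∈ E l
        · simp [indicator_of_mem hq]
        · simp [indicator_of_notMem hq]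
      · refine ae_of_all _ fun q => mul_nonneg (indicator_nonneg (fun _ _ => zero_le_one) _) ?_
        positivity
      · exact (((measurable_const.indicator (hEm l)).comp measurable_fst).mul
          ((hUm.norm.pow_const 2).mul
            (hNm.comp measurable_fst).ennreal_toReal.inv)).aestronglyMeasurable
    simp_rw [hinteg] at hdual
    have hlow : Z.toReal ≤ ‖∑ l ∈ L, ((v l ^ (p - 1) : ℝ) : ℂ) *
        (((∫⁻ x in E l, N x ∂μ).toReal : ℝ) : ℂ)‖ := by
      simp_rw [← Complex.ofReal_mul]
      rw [← Complex.ofReal_sum, Complex.norm_real]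
      refine le_trans ?_ (le_abs_self _)
      rw [hZ, ENNReal.toReal_sum fun l _ =>
        ENNReal.mul_ne_top ENNReal.ofReal_ne_top (hEfin l)]
      refine Finset.sum_le_sum fun l _ => ?_
      have h3 := ENNReal.toReal_mono (hRtop l) (hRlow l)
      rw [ENNReal.toReal_mul, ENNReal.toReal_ofReal (hv l).le] at h3
      rw [ENNReal.toReal_mul, ENNReal.toReal_ofReal (Real.rpow_nonneg (hv l).le _)]
      calc v l ^ p * (μ (E l)).toReal = v l ^ (p - 1) * (v l * (μ (E l)).toReal) := by
            rw [← mul_assoc, ← Real.rpow_add_one (hv l).ne']; ring_nf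
        _ ≤ _ := mul_le_mul_of_nonneg_left h3 (Real.rpow_nonneg (hv l).le _)
    have := le_of_le_interp hA hθ0 hθ1 (hlow.trans hdual)
    rw [← ENNReal.ofReal_toReal hZt]
    exact ENNReal.ofReal_le_ofReal this
  have hae : ∀ᵐ x ∂μ, N x < ⊤ := ae_lt_top hNm hNint.ne
  calc ∫⁻ x, (∫⁻ t, ‖U (x, t)‖ₑ ^ 2 ∂ν) ^ (p / 2) ∂μ
      ≤ ∫⁻ x, ∑' l, (E l).indicator (fun _ => 4 * ENNReal.ofReal (v l ^ p)) x ∂μ := by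
        refine lintegral_mono_ae (hae.mono fun x hx => ?_)
        have : (∫⁻ t, ‖U (x, t)‖ₑ ^ 2 ∂ν) ^ (p / 2) = N x ^ p := by
          rw [hN]
          simp only
          rw [← ENNReal.rpow_mul]
          congr 1
          ring
        rw [this]
        by_cases hz : N x = 0
        · rw [hz, ENNReal.zero_rpow_of_pos hp0]; exact zero_le
        obtain ⟨l, hl⟩ := ENNReal.exists_mem_Ico_zpow hz hx.ne (y := 2) (by norm_num) (by norm_num)
        refine le_trans ?_ (ENNReal.le_tsum l)
        rw [indicator_of_mem (show x ∈ E l from hl)]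
        calc N x ^ p ≤ (2 * ENNReal.ofReal (v l)) ^ p := by
              refine ENNReal.rpow_le_rpow (hl.2.le.trans_eq ?_) hp0.le
              rw [hvE, ENNReal.zpow_add (by norm_num) (by norm_num), zpow_one, mul_comm]
          _ = 2 ^ p * ENNReal.ofReal (v l ^ p) := by
              rw [ENNReal.mul_rpow_of_nonneg _ _ hp0.le,
                ENNReal.ofReal_rpow_of_nonneg (hv l).le hp0.le]
          _ ≤ 4 * ENNReal.ofReal (v l ^ p) := by
              gcongr
              calc (2 : ℝ≥0∞) ^ p ≤ 2 ^ (2 : ℝ) :=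
                    ENNReal.rpow_le_rpow_of_exponent_le (by norm_num) hp2
                _ = 4 := by norm_num
    _ = ∑' l, 4 * (ENNReal.ofReal (v l ^ p) * μ (E l)) := by
        rw [lintegral_tsum fun l => (measurable_const.indicator (hEm l)).aemeasurable]
        refine tsum_congr fun l => ?_
        rw [lintegral_indicator_const (hEm l), mul_assoc]
    _ ≤ _ := by
        rw [ENNReal.tsum_mul_left, ENNReal.tsum_eq_iSup_sum]
        gcongr
        exact iSup_le hfinite

theorem sum_dyadic_rpow_le {q l : ℝ} (hq : 0 < q) (hl : 0 < l) (J : ℕ) :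
    ∑ k ∈ Finset.range J, (l * 2 ^ k) ^ q ≤ (2 ^ q - 1)⁻¹ * (l * 2 ^ J) ^ q := by
  have h2 : (0 : ℝ) < 2 ^ q - 1 := by
    have := Real.one_lt_rpow (by norm_num : (1 : ℝ) < 2) hq
    linarith
  induction J with
  | zero => simp only [Finset.range_zero, Finset.sum_empty]; positivity
  | succ J ih =>
    rw [Finset.sum_range_succ]
    have h3 : (l * 2 ^ (J + 1)) ^ q = 2 ^ q * (l * 2 ^ J) ^ q := by
      rw [← Real.mul_rpow (by norm_num) (by positivity)]
      congr 1
      ring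
    rw [h3]
    calc _ ≤ (2 ^ q - 1)⁻¹ * (l * 2 ^ J) ^ q + (l * 2 ^ J) ^ q := by gcongr
      _ = (2 ^ q - 1)⁻¹ * (2 ^ q * (l * 2 ^ J) ^ q) := by field_simp; ring

theorem sum_dyadic_rpow_indicator_le {q l : ℝ} (hq : 0 < q) (hl : 0 < l) (J : ℕ) {y : ℝ}
    (hy : 0 ≤ y) :
    ∑ k ∈ Finset.range J, (if l * 2 ^ k < y then (l * 2 ^ k) ^ q else 0) ≤
      ((2 ^ q - 1)⁻¹ + 1) * y ^ q := by
  have h2 : (0 : ℝ) < 2 ^ q - 1 := by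
    have := Real.one_lt_rpow (by norm_num : (1 : ℝ) < 2) hq
    linarith
  induction J with
  | zero => simp only [Finset.range_zero, Finset.sum_empty]; positivity
  | succ J ih =>
    by_cases hJ : l * 2 ^ J < y
    · calc _ ≤ ∑ k ∈ Finset.range (J + 1), (l * 2 ^ k) ^ q := by
            refine Finset.sum_le_sum fun k _ => ?_
            split_ifs
            · exact le_rfl
            · positivity
        _ ≤ ((2 ^ q - 1)⁻¹ + 1) * (l * 2 ^ J) ^ q := by
            rw [Finset.sum_range_succ, add_mul, one_mul]
            gcongr
            exact sum_dyadic_rpow_le hq hl J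
        _ ≤ _ := by gcongr
    · rw [Finset.sum_range_succ, if_neg hJ, add_zero]
      exact ih

/-- A sum dominated by dyadically growing terms is square-controlled by its diagonal. -/
theorem sq_sum_dyadic_le {p l : ℝ} (hp : 0 < p) (hl : 0 < l) (P : ℕ → Prop) [DecidablePred P]
    (J : ℕ) :
    (∑ k ∈ Finset.range J, (if P k then (l * 2 ^ k) ^ (p / 2) else 0)) ^ 2 ≤
      (2 * (2 ^ (p / 2) - 1)⁻¹ + 1) * ∑ k ∈ Finset.range J,
          (if P k then (l * 2 ^ k) ^ p else 0) := by
  have h2 : (0 : ℝ) < 2 ^ (p / 2) - 1 := by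
    have := Real.one_lt_rpow (by norm_num : (1 : ℝ) < 2) (half_pos hp)
    linarith
  induction J with
  | zero => simp
  | succ J ih =>
    rw [Finset.sum_range_succ, Finset.sum_range_succ]
    by_cases hJ : P J
    · rw [if_pos hJ, if_pos hJ]
      set S := ∑ k ∈ Finset.range J, (if P k then (l * 2 ^ k) ^ (p / 2) else 0)
      have hS : S ≤ (2 ^ (p / 2) - 1)⁻¹ * (l * 2 ^ J) ^ (p / 2) := by
        refine le_trans (Finset.sum_le_sum fun k _ => ?_) (sum_dyadic_rpow_le (half_pos hp) hl J)
        split_ifs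
        · exact le_rfl
        · positivity
      have ha : (l * 2 ^ J) ^ p = (l * 2 ^ J) ^ (p / 2) * (l * 2 ^ J) ^ (p / 2) := by
        rw [← Real.rpow_add (by positivity)]
        congr 1
        ring
      rw [ha]
      set a := (l * 2 ^ J) ^ (p / 2)
      have ha0 : 0 ≤ a := by positivity
      nlinarith [mul_le_mul_of_nonneg_right hS ha0]
    · rw [if_neg hJ, if_neg hJ, add_zero, add_zero]
      exact ih

namespace CellSystem

theorem sum_volume_stopSet_le {n : ℕ} {p : ℝ} (hp : 1 < p) (Q : CellSystem n) {g : En n → ℂ}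
    (hg : Integrable g) (hgm : Measurable g) {l : ℝ} (hl : 0 < l) (J : ℕ) :
    ∑ k ∈ Finset.range J, ENNReal.ofReal ((l * 2 ^ k) ^ p) * volume (Q.stopSet g (l * 2 ^ k)) ≤
      ENNReal.ofReal (2 * ((2 ^ (p - 1) - 1)⁻¹ + 1) * 2 ^ (p - 1)) * ∫⁻ x, ‖g x‖ₑ ^ p := by
  have h2 : (0 : ℝ) < 2 ^ (p - 1) - 1 := by
    have := Real.one_lt_rpow (by norm_num : (1 : ℝ) < 2) (sub_pos.2 hp)
    linarith
  have hset : ∀ r : ℝ, MeasurableSet {x | r / 2 < ‖g x‖} := fun r =>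
    measurableSet_lt measurable_const hgm.norm
  calc _ ≤ ∑ k ∈ Finset.range J, ENNReal.ofReal (2 * (l * 2 ^ k) ^ (p - 1)) *
        ∫⁻ x, {x | l * 2 ^ k / 2 < ‖g x‖}.indicator (fun x => ‖g x‖ₑ) x := by
        refine Finset.sum_le_sum fun k _ => ?_
        have hk : 0 < l * 2 ^ k := by positivity
        refine le_trans (le_of_eq ?_) (mul_le_mul_right (Q.volume_stopSet_le hg hk.le) _)
        rw [← mul_assoc, ← ENNReal.ofReal_mul (by positivity)]
        congr 2
        have : (l * 2 ^ k) ^ p = (l * 2 ^ k) ^ (p - 1) * (l * 2 ^ k) := by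
          rw [← Real.rpow_add_one hk.ne']; congr 1; ring
        rw [this]
        ring
    _ = ∫⁻ x, ∑ k ∈ Finset.range J, ENNReal.ofReal (2 * (l * 2 ^ k) ^ (p - 1)) *
          {x | l * 2 ^ k / 2 < ‖g x‖}.indicator (fun x => ‖g x‖ₑ) x := by
        have hm : ∀ k : ℕ, Measurable ({x | l * 2 ^ k / 2 < ‖g x‖}.indicator fun x => ‖g x‖ₑ) :=
          fun k => hgm.enorm.indicator (hset _)
        rw [lintegral_finsetSum _ fun k _ => (hm k).const_mul _]
        exact Finset.sum_congr rfl fun k _ => (lintegral_const_mul _ (hm k)).symm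
    _ ≤ ∫⁻ x, ENNReal.ofReal (2 * ((2 ^ (p - 1) - 1)⁻¹ + 1) * 2 ^ (p - 1)) * ‖g x‖ₑ ^ p := by
        refine lintegral_mono fun x => ?_
        have hterm : ∀ k : ℕ, ENNReal.ofReal (2 * (l * 2 ^ k) ^ (p - 1)) *
            {x | l * 2 ^ k / 2 < ‖g x‖}.indicator (fun x => ‖g x‖ₑ) x =
            ENNReal.ofReal (2 * ‖g x‖ *
              (if l * 2 ^ k < 2 * ‖g x‖ then (l * 2 ^ k) ^ (p - 1) else 0)) := by
          intro k
          by_cases hk : l * 2 ^ k / 2 < ‖g x‖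
          · rw [indicator_of_mem (by exact hk), if_pos (by linarith), ← ofReal_norm,
              ← ENNReal.ofReal_mul (by positivity)]
            congr 1
            ring
          · rw [indicator_of_notMem (by exact hk), if_neg (by linarith)]
            simp
        rw [Finset.sum_congr rfl fun k _ => hterm k, ← ENNReal.ofReal_sum_of_nonneg,
          ← Finset.mul_sum,
          ← ofReal_norm, ENNReal.ofReal_rpow_of_nonneg (norm_nonneg _) (by linarith),
          ← ENNReal.ofReal_mul (by positivity)]
        · refine ENNReal.ofReal_le_ofReal ?_
          refine (mul_le_mul_of_nonneg_left (sum_dyadic_rpow_indicator_le (sub_pos.2 hp) hl J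
            (by positivity : 0 ≤ 2 * ‖g x‖)) (by positivity)).trans_eq ?_
          rw [Real.mul_rpow (by norm_num) (norm_nonneg _)]
          have : ‖g x‖ ^ p = ‖g x‖ ^ (p - 1) * ‖g x‖ := by
            rw [← Real.rpow_add_one' (norm_nonneg _) (by linarith)]; congr 1; ring
          rw [this]
          ring
        · intro k _
          split_ifs <;> positivity
    _ = _ := lintegral_const_mul _ (hgm.enorm.pow_const _)

theorem norm_sum_layer_sq_le {n : ℕ} {p : ℝ} (hp : 0 < p) (Q : CellSystem n) {g : En n → ℂ}
    (hg : Integrable g) (hc : Continuous g) {l : ℝ} (hl : 0 < l) (h0 : ∀ x, Q.avg g 0 x ≤ l)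
    (J : ℕ) {w : ℕ → ℂ} (hw : ∀ k, ‖w k‖ ≤ (l * 2 ^ k) ^ (p / 2 - 1)) (x : En n) :
    ‖∑ k ∈ Finset.range J, w k * Q.layer g (l * 2 ^ k) x‖ₑ ^ 2 ≤
      ENNReal.ofReal ((3 * 2 ^ n) ^ 2 * (2 * (2 ^ (p / 2) - 1)⁻¹ + 1)) *
      ∑ k ∈ Finset.range J, (Q.stopSet g (l * 2 ^ k)).indicator
        (fun _ => ENNReal.ofReal ((l * 2 ^ k) ^ p)) x := by
  classical
  have h2 : (0 : ℝ) < 2 ^ (p / 2) - 1 := by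
    have := Real.one_lt_rpow (by norm_num : (1 : ℝ) < 2) (half_pos hp)
    linarith
  have hb : ‖∑ k ∈ Finset.range J, w k * Q.layer g (l * 2 ^ k) x‖ ≤ 3 * 2 ^ n *
      ∑ k ∈ Finset.range J,
        (if x ∈ Q.stopSet g (l * 2 ^ k) then (l * 2 ^ k) ^ (p / 2) else 0) := by
    rw [Finset.mul_sum]
    refine (norm_sum_le _ _).trans (Finset.sum_le_sum fun k _ => ?_)
    have hk : 0 < l * 2 ^ k := by positivity
    split_ifs with hx
    · have h1 : l ≤ l * 2 ^ k := le_mul_of_one_le_right hl.le (one_le_pow₀ (by norm_num))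
      rw [norm_mul]
      calc ‖w k‖ * ‖Q.layer g (l * 2 ^ k) x‖
          ≤ (l * 2 ^ k) ^ (p / 2 - 1) * (3 * 2 ^ n * (l * 2 ^ k)) :=
            mul_le_mul (hw k) (Q.norm_layer_le hg hc hk.le (fun y => (h0 y).trans h1) x)
              (norm_nonneg _) (by positivity)
        _ = 3 * 2 ^ n * ((l * 2 ^ k) ^ (p / 2 - 1) * (l * 2 ^ k)) := by ring
        _ = _ := by rw [← Real.rpow_add_one hk.ne']; ring_nf
    · rw [layer_eq_zero hk.le hx]
      simp
  rw [← ofReal_norm, ← ENNReal.ofReal_pow (norm_nonneg _)]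
  have hind : ∀ k : ℕ, (Q.stopSet g (l * 2 ^ k)).indicator
      (fun _ => ENNReal.ofReal ((l * 2 ^ k) ^ p)) x = ENNReal.ofReal
        (if x ∈ Q.stopSet g (l * 2 ^ k) then (l * 2 ^ k) ^ p else 0) := fun k => by
    rw [indicator_apply]
    split_ifs <;> simp
  rw [Finset.sum_congr rfl fun k _ => hind k, ← ENNReal.ofReal_sum_of_nonneg,
    ← ENNReal.ofReal_mul (by positivity)]
  · refine ENNReal.ofReal_le_ofReal ?_
    calc _ ≤ (3 * 2 ^ n * ∑ k ∈ Finset.range J,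
          (if x ∈ Q.stopSet g (l * 2 ^ k) then (l * 2 ^ k) ^ (p / 2) else 0)) ^ 2 := by gcongr
      _ ≤ _ := by
          rw [mul_pow, mul_assoc]
          exact mul_le_mul_of_nonneg_left (sq_sum_dyadic_le hp hl _ J) (by positivity)
  · intro k _
    split_ifs <;> positivity

end CellSystem

theorem ftP_sum {n : ℕ} {κ : Type*} (r : Finset κ) {h : κ → En n → ℂ} (hh : ∀ k, Integrable (h k))
    (η : κ → ℂ) (ξ : En n) :
    ftP n (fun y => ∑ k ∈ r, η k * h k y) ξ = ∑ k ∈ r, η k * ftP n (h k) ξ := by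
  simp only [ftP]
  have : ∀ x : En n, Complex.exp (-Complex.I * ((⟪x, ξ⟫ : ℝ) : ℂ)) * ∑ k ∈ r, η k * h k x =
      ∑ k ∈ r, η k * (Complex.exp (-Complex.I * ((⟪x, ξ⟫ : ℝ) : ℂ)) * h k x) := fun x => by
    rw [Finset.mul_sum]
    exact Finset.sum_congr rfl fun k _ => by ring
  simp_rw [this]
  rw [integral_finsetSum _ fun k _ => (integrable_exp_mul (hh k) ξ).const_mul _]
  exact Finset.sum_congr rfl fun k _ => integral_const_mul _ _

theorem mulOp_sum_sum {n : ℕ} {ι κ : Type*} (s : Finset ι) (r : Finset κ) {m : ι → En n → ℂ}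
    {h : κ → En n → ℂ} (hm : ∀ i, Continuous (m i)) (hmc : ∀ i, HasCompactSupport (m i))
    (hh : ∀ k, Integrable (h k)) (ω : ι → ℂ) (η : κ → ℂ) (x : En n) :
    mulOp n (fun ξ => ∑ i ∈ s, ω i * m i ξ) (fun y => ∑ k ∈ r, η k * h k y) x =
      ∑ j ∈ s ×ˢ r, ω j.1 * η j.2 * mulOp n (m j.1) (h j.2) x := by
  have hinteg : ∀ i k, Integrable fun ξ : En n =>
      Complex.exp (Complex.I * ((⟪x, ξ⟫ : ℝ) : ℂ)) * (m i ξ * ftP n (h k) ξ) := fun i k =>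
    integrable_exp_I_mul (((hm i).mul (continuous_ftP (hh k))).integrable_of_hasCompactSupport
      (hmc i).mul_right) x
  unfold mulOp
  have : ∀ ξ : En n, Complex.exp (Complex.I * ((⟪x, ξ⟫ : ℝ) : ℂ)) * ((∑ i ∈ s, ω i * m i ξ) *
      ftP n (fun y => ∑ k ∈ r, η k * h k y) ξ) = ∑ j ∈ s ×ˢ r, ω j.1 * η j.2 *
        (Complex.exp (Complex.I * ((⟪x, ξ⟫ : ℝ) : ℂ)) * (m j.1 ξ * ftP n (h j.2) ξ)) := fun ξ => by
    rw [ftP_sum r hh, Finset.sum_mul_sum, ← Finset.sum_product', Finset.mul_sum]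
    exact Finset.sum_congr rfl fun j _ => by ring
  simp_rw [this]
  rw [integral_finsetSum _ fun j _ => (hinteg j.1 j.2).const_mul _]
  exact Finset.sum_congr rfl fun j _ => integral_const_mul _ _

theorem lintegral_mulOp_sq_le {n : ℕ} {m h : En n → ℂ} (hm : Continuous m)
    (hmc : HasCompactSupport m) {D : ℝ} (hD : ∀ ξ, ‖m ξ‖ ≤ D) (hh : Integrable h)
    (hh2 : MemLp h 2 volume) :
    ∫⁻ x, ‖mulOp n m h x‖ₑ ^ 2 ≤
      ENNReal.ofReal ((2 * Real.pi) ^ n * (D ^ 2 * (2 * Real.pi) ^ n)) * ∫⁻ x, ‖h x‖ₑ ^ 2 := by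
  have hD0 : 0 ≤ D := (norm_nonneg _).trans (hD 0)
  rw [mulOp_L2 hm hmc hh, ENNReal.ofReal_mul (by positivity), ENNReal.ofReal_mul (by positivity),
    mul_assoc, mul_assoc, ← lintegral_enorm_ftP_sq hh hh2]
  gcongr
  rw [← lintegral_const_mul _ ((continuous_ftP hh).measurable.enorm.pow_const 2)]
  refine lintegral_mono fun ξ => ?_
  rw [enorm_mul, mul_pow, ENNReal.ofReal_pow hD0]
  gcongr
  rw [← ofReal_norm]
  exact ENNReal.ofReal_le_ofReal (hD ξ)

theorem hasCompactSupport_of_norm_le {n : ℕ} {m : En n → ℂ} {r : ℝ}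
    (h : ∀ ξ, r < ‖ξ‖ → m ξ = 0) : HasCompactSupport m :=
  HasCompactSupport.intro (isCompact_closedBall (0 : En n) r) fun ξ hξ => h ξ (by simpa using hξ)

theorem memLp_two_of_bounded {n : ℕ} {h : En n → ℂ} (hh : Integrable h) {M : ℝ}
    (hM : ∀ x, ‖h x‖ ≤ M) : MemLp h 2 volume := by
  rw [memLp_two_iff_integrable_sq_norm hh.aestronglyMeasurable]
  refine (hh.norm.const_mul M).mono' (hh.aestronglyMeasurable.norm.pow 2) (ae_of_all _ fun x => ?_)
  rw [Real.norm_of_nonneg (by positivity), sq]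
  exact mul_le_mul_of_nonneg_right (hM x) (norm_nonneg _)

namespace CellSystem

theorem lintegral_wave_layers_le {n : ℕ} (hn : 2 ≤ n) {γ p : ℝ} (hγ : 1 < γ) (hp1 : 1 < p)
    (hp2 : p ≤ 2) {d θ : ℝ} (hd : d = γ * n / 2) (hθ : θ = 2 / p - 1) (a b : ℝ) :
    ∃ C : ℝ, 0 ≤ C ∧ ∀ (K J : ℕ) (Q : CellSystem n) (g : En n → ℂ) (l P : ℝ), Integrable g →
      Continuous g → 0 < l → (∀ x, Q.avg g 0 x ≤ l) → 0 ≤ P →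
      ∫⁻ x, ‖g x‖ₑ ^ p ≤ ENNReal.ofReal P →
      ∫⁻ x, (∫⁻ t in Icc a b, ‖mulOp n (fun ξ => ∑ i ∈ waveIndices K,
        wavePiece n γ (θ * d / 2) i t ξ) (fun y => ∑ k ∈ Finset.range J, Q.layer g (l * 2 ^ k) y)
          x‖ₑ ^ 2) ^ (p / 2) ≤ ENNReal.ofReal (C * P) := by
  have hp0 : 0 < p := by linarith
  have hθ0 : 0 ≤ θ := by rw [hθ, sub_nonneg, le_div_iff₀ hp0]; linarith
  have hd0 : 0 ≤ d := by rw [hd]; positivity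
  have hθp : p / 2 * (1 - θ) = p - 1 := by rw [hθ]; field_simp; ring
  have hθp' : -(p / 2 * θ) = p / 2 - 1 := by rw [hθ]; field_simp; ring
  obtain ⟨C₁, hC₁, hH1⟩ := sum_lintegral_wavePiece_layer_le hn hγ hd hθ0 a b
  have hpiece := wavePiece_continuous_support (n := n) hγ (s := θ * d / 2) (by positivity)
  choose hcont r hr using hpiece
  have h21 : (0 : ℝ) < 2 ^ (p - 1) - 1 := by
    have := Real.one_lt_rpow (by norm_num : (1 : ℝ) < 2) (sub_pos.2 hp1)
    linarith
  have h22 : (0 : ℝ) < 2 ^ (p / 2) - 1 := by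
    have := Real.one_lt_rpow (by norm_num : (1 : ℝ) < 2) (half_pos hp0)
    linarith
  set V : ℝ := 2 * ((2 ^ (p - 1) - 1)⁻¹ + 1) * 2 ^ (p - 1) with hV
  set B : ℝ := (3 * 2 ^ n) ^ 2 * (2 * (2 ^ (p / 2) - 1)⁻¹ + 1) with hB
  set D : ℝ := (2 * Real.pi) ^ n * ((2 ^ (d * θ) + 3) ^ 2 * (2 * Real.pi) ^ n) with hD
  have hV0 : 0 ≤ V := by positivity
  have hB0 : 0 ≤ B := by positivity
  have hD0 : 0 ≤ D := by positivity
  refine ⟨4 * (D * B * V * |b - a| + C₁ * V), by positivity,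
    fun K J Q g l P hg hc hl h0 hP hgP => ?_⟩
  have hS := (Q.sum_volume_stopSet_le hp1 hg hc.measurable hl J).trans (mul_le_mul_right hgP _)
  rw [← hV, ← ENNReal.ofReal_mul hV0] at hS
  set u : (ℕ ⊕ ℕ ⊕ Unit) × ℕ → En n × ℝ → ℂ := fun j q =>
    mulOp n (wavePiece n γ (θ * d / 2) j.1 q.2) (Q.layer g (l * 2 ^ j.2)) q.1 with hu
  have hlayer : ∀ k : ℕ, Integrable (Q.layer g (l * 2 ^ k)) := fun k =>
    Q.integrable_layer hg hc.measurable _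
  have hum : ∀ j, Measurable (u j) := fun j =>
    (continuous_mulOp_param (hcont j.1) (hr j.1) (hlayer j.2)).measurable
  have hmc : ∀ i t, Continuous (wavePiece n γ (θ * d / 2) i t) := fun i t =>
    (hcont i).comp (by fun_prop : Continuous fun ξ : En n => (t, ξ))
  have hms : ∀ i t, HasCompactSupport (wavePiece n γ (θ * d / 2) i t) := fun i t =>
    hasCompactSupport_of_norm_le (hr i t)
  set c : (ℕ ⊕ ℕ ⊕ Unit) × ℕ → ℝ := fun j =>
    -(waveExponent d j.1 * Real.log 2) + p / 2 * Real.log (l * 2 ^ j.2) with hcdef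
  set A : ℝ := (D * B * V * |b - a| + C₁ * V) * P with hA
  have hA0 : 0 ≤ A := by positivity
  have hU : ∀ x t, mulOp n (fun ξ => ∑ i ∈ waveIndices K, wavePiece n γ (θ * d / 2) i t ξ)
      (fun y => ∑ k ∈ Finset.range J, Q.layer g (l * 2 ^ k) y) x =
      ∑ j ∈ waveIndices K ×ˢ Finset.range J, u j (x, t) := fun x t => by
    have := mulOp_sum_sum (waveIndices K) (Finset.range J) (fun i => hmc i t) (fun i => hms i t)
      hlayer (fun _ => 1) (fun _ => 1) x
    simpa only [one_mul] using this
  simp_rw [hU]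
  refine (lintegral_rpow_le_of_interp (ν := volume.restrict (Icc a b)) _ hum c hp1 hp2 hθ hA0
    ?_ ?_).trans_eq ?_
  · intro z hz
    set ω : ℕ ⊕ ℕ ⊕ Unit → ℂ := fun i =>
      Complex.exp (((-(waveExponent d i * Real.log 2) : ℝ) : ℂ) * (z - θ)) with hω
    set η : ℕ → ℂ := fun k =>
      Complex.exp (((p / 2 * Real.log (l * 2 ^ k) : ℝ) : ℂ) * (z - θ)) with hη
    have hωn : ∀ i, ‖ω i‖ = 2 ^ (waveExponent d i * θ) := fun i => by
      rw [hω, Complex.norm_exp, Complex.re_ofReal_mul, Real.rpow_def_of_pos (by norm_num)]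
      simp only [Complex.sub_re, hz, Complex.ofReal_re]
      congr 1
      ring
    have hηn : ∀ k, ‖η k‖ = (l * 2 ^ k) ^ (p / 2 - 1) := fun k => by
      rw [hη, Complex.norm_exp, Complex.re_ofReal_mul, Real.rpow_def_of_pos (by positivity),
        ← hθp']
      simp only [Complex.sub_re, hz, Complex.ofReal_re]
      congr 1
      ring
    have hsum : ∀ q : En n × ℝ, ∑ j ∈ waveIndices K ×ˢ Finset.range J,
        Complex.exp (c j * (z - θ)) * u j q =
        mulOp n (fun ξ => ∑ i ∈ waveIndices K, ω i * wavePiece n γ (θ * d / 2) i q.2 ξ)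
          (fun y => ∑ k ∈ Finset.range J, η k * Q.layer g (l * 2 ^ k) y) q.1 := fun q => by
      rw [mulOp_sum_sum (waveIndices K) (Finset.range J) (fun i => hmc i q.2)
        (fun i => hms i q.2) hlayer]
      refine Finset.sum_congr rfl fun j _ => ?_
      rw [hω, hη, ← Complex.exp_add, ← add_mul, ← Complex.ofReal_add]
    have hsm : Measurable fun q : En n × ℝ => ‖∑ j ∈ waveIndices K ×ˢ Finset.range J,
        Complex.exp (c j * (z - θ)) * u j q‖ₑ ^ 2 :=
      (Finset.measurable_sum _ fun j _ => (hum j).const_mul _).enorm.pow_const 2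
    rw [lintegral_prod_symm _ hsm.aemeasurable]
    simp_rw [hsum]
    set h : En n → ℂ := fun y => ∑ k ∈ Finset.range J, η k * Q.layer g (l * 2 ^ k) y with hh
    have hhi : Integrable h := integrable_finsetSum _ fun k _ => (hlayer k).const_mul _
    have hhM : ∀ y, ‖h y‖ ≤ ∑ k ∈ Finset.range J, ‖η k‖ * (3 * 2 ^ n * (l * 2 ^ k)) := fun y => by
      refine (norm_sum_le _ _).trans (Finset.sum_le_sum fun k _ => ?_)
      rw [norm_mul]
      have h1 : l ≤ l * 2 ^ k := le_mul_of_one_le_right hl.le (one_le_pow₀ (by norm_num))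
      gcongr
      exact Q.norm_layer_le hg hc (by positivity) (fun y => (h0 y).trans h1) y
    have hh2 : ∫⁻ y, ‖h y‖ₑ ^ 2 ≤ ENNReal.ofReal (B * (V * P)) := by
      calc ∫⁻ y, ‖h y‖ₑ ^ 2 ≤ ∫⁻ y, ENNReal.ofReal B * ∑ k ∈ Finset.range J,
            (Q.stopSet g (l * 2 ^ k)).indicator (fun _ => ENNReal.ofReal ((l * 2 ^ k) ^ p)) y :=
            lintegral_mono fun y => Q.norm_sum_layer_sq_le hp0 hg hc hl h0 J
              (fun k => (hηn k).le) y
        _ = ENNReal.ofReal B * ∑ k ∈ Finset.range J, ENNReal.ofReal ((l * 2 ^ k) ^ p) *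
              volume (Q.stopSet g (l * 2 ^ k)) := by
            have hm : ∀ k ∈ Finset.range J, Measurable ((Q.stopSet g (l * 2 ^ k)).indicator
                fun _ => ENNReal.ofReal ((l * 2 ^ k) ^ p)) := fun k _ =>
              measurable_const.indicator (Q.measurableSet_stopSet g _)
            rw [lintegral_const_mul _ (Finset.measurable_sum _ hm), lintegral_finsetSum _ hm]
            congr 1
            exact Finset.sum_congr rfl fun k _ =>
              lintegral_indicator_const (Q.measurableSet_stopSet g _) _
        _ ≤ ENNReal.ofReal B * ENNReal.ofReal (V * P) := by gcongr
        _ = _ := (ENNReal.ofReal_mul hB0).symm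
    calc ∫⁻ t in Icc a b, ∫⁻ x, ‖mulOp n (fun ξ => ∑ i ∈ waveIndices K,
            ω i * wavePiece n γ (θ * d / 2) i t ξ) h x‖ₑ ^ 2
        ≤ ∫⁻ _ in Icc a b, ENNReal.ofReal D * ENNReal.ofReal (B * (V * P)) := by
          refine lintegral_mono fun t => ?_
          have hcs : Continuous fun ξ => ∑ i ∈ waveIndices K,
              ω i * wavePiece n γ (θ * d / 2) i t ξ :=
            continuous_finsetSum _ fun i _ => continuous_const.mul (hmc i t)
          refine (lintegral_mulOp_sq_le (D := 2 ^ (d * θ) + 3) hcs ?_ (fun ξ => ?_) hhi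
            (memLp_two_of_bounded hhi hhM)).trans (mul_le_mul_right hh2 _)
          · refine hasCompactSupport_of_norm_le (r := ∑ i ∈ waveIndices K, |r i|) fun ξ hξ => ?_
            refine Finset.sum_eq_zero fun i hi => ?_
            rw [hr i t ξ, mul_zero]
            refine lt_of_le_of_lt (le_abs_self _) (lt_of_le_of_lt ?_ hξ)
            exact Finset.single_le_sum (f := fun i => |r i|) (fun _ _ => abs_nonneg _) hi
          · refine (norm_sum_le _ _).trans (le_trans (le_of_eq ?_)
              (sum_norm_wavePiece_le (n := n) (γ := γ) hd0 hθ0 K t ξ))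
            exact Finset.sum_congr rfl fun i _ => by rw [norm_mul, hωn]
      _ = ENNReal.ofReal D * ENNReal.ofReal (B * (V * P)) * ENNReal.ofReal (b - a) := by
          rw [setLIntegral_const, Real.volume_Icc]
      _ ≤ ENNReal.ofReal D * ENNReal.ofReal (B * (V * P)) * ENNReal.ofReal |b - a| := by
          gcongr
          exact le_abs_self _
      _ ≤ ENNReal.ofReal A := by
          rw [← ENNReal.ofReal_mul hD0, ← ENNReal.ofReal_mul (by positivity)]
          refine ENNReal.ofReal_le_ofReal ?_
          rw [hA]
          have : 0 ≤ C₁ * V * P := by positivity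
          linarith
  · have hexp : ∀ j, ENNReal.ofReal (Real.exp (c j * (1 - θ))) =
        ENNReal.ofReal ((l * 2 ^ j.2) ^ (p - 1)) *
          ENNReal.ofReal (2 ^ (waveExponent d j.1 * (θ - 1))) := fun j => by
      rw [← ENNReal.ofReal_mul (by positivity), Real.rpow_def_of_pos (by positivity),
        Real.rpow_def_of_pos (by norm_num), ← Real.exp_add, ← hθp]
      congr 2
      rw [hcdef]
      ring
    simp_rw [hexp]
    rw [Finset.sum_product_right]
    calc _ ≤ ∑ k ∈ Finset.range J, ENNReal.ofReal ((l * 2 ^ k) ^ (p - 1)) *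
          (ENNReal.ofReal (C₁ * (l * 2 ^ k)) * volume (Q.stopSet g (l * 2 ^ k))) := by
          refine Finset.sum_le_sum fun k _ => ?_
          simp_rw [mul_assoc]
          rw [← Finset.mul_sum]
          have h1 : l ≤ l * 2 ^ k := le_mul_of_one_le_right hl.le (one_le_pow₀ (by norm_num))
          have := hH1 K Q g (l * 2 ^ k) hg hc (by positivity) fun x => (h0 x).trans h1
          exact mul_le_mul_right this _
      _ = ENNReal.ofReal C₁ * ∑ k ∈ Finset.range J, ENNReal.ofReal ((l * 2 ^ k) ^ p) *
            volume (Q.stopSet g (l * 2 ^ k)) := by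
          rw [Finset.mul_sum]
          refine Finset.sum_congr rfl fun k _ => ?_
          have hk : 0 < l * 2 ^ k := by positivity
          rw [← mul_assoc (ENNReal.ofReal ((l * 2 ^ k) ^ (p - 1))),
            ← mul_assoc (ENNReal.ofReal C₁), ← ENNReal.ofReal_mul (by positivity),
            ← ENNReal.ofReal_mul hC₁]
          congr 2
          have : (l * 2 ^ k) ^ p = (l * 2 ^ k) ^ (p - 1) * (l * 2 ^ k) := by
            rw [← Real.rpow_add_one hk.ne']; congr 1; ring
          rw [this]
          ring
      _ ≤ ENNReal.ofReal C₁ * ENNReal.ofReal (V * P) := by gcongr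
      _ ≤ _ := by
          rw [← ENNReal.ofReal_mul hC₁]
          refine ENNReal.ofReal_le_ofReal ?_
          rw [hA]
          have : 0 ≤ D * B * V * |b - a| * P := by positivity
          linarith
  · rw [mul_assoc (4 : ℝ), ← hA, ENNReal.ofReal_mul (p := 4) (by norm_num)]
    simp

end CellSystem

/-- Fatou's lemma for a mixed norm. -/
theorem lintegral_rpow_lintegral_le_of_tendsto {α : Type*} [MeasurableSpace α] {μ : Measure α}
    {ν : Measure ℝ} [SFinite ν] {F : ℕ → α × ℝ → ℂ} {G : α × ℝ → ℂ} (hF : ∀ j, Measurable (F j))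
    (hFG : ∀ q, Tendsto (fun j => F j q) atTop (𝓝 (G q))) {s : ℝ} (hs : 0 < s) {B : ℝ≥0∞}
    (hB : ∀ j, ∫⁻ x, (∫⁻ t, ‖F j (x, t)‖ₑ ^ 2 ∂ν) ^ s ∂μ ≤ B) :
    ∫⁻ x, (∫⁻ t, ‖G (x, t)‖ₑ ^ 2 ∂ν) ^ s ∂μ ≤ B := by
  have hm : ∀ j, Measurable fun q => ‖F j q‖ₑ ^ 2 := fun j => (hF j).enorm.pow_const 2
  have hG : ∀ q, ‖G q‖ₑ ^ 2 = liminf (fun j => ‖F j q‖ₑ ^ 2) atTop := fun q =>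
    ((ENNReal.continuous_pow 2).tendsto _ |>.comp (hFG q).enorm).liminf_eq.symm
  calc ∫⁻ x, (∫⁻ t, ‖G (x, t)‖ₑ ^ 2 ∂ν) ^ s ∂μ
      ≤ ∫⁻ x, liminf (fun j => (∫⁻ t, ‖F j (x, t)‖ₑ ^ 2 ∂ν) ^ s) atTop ∂μ := by
        refine lintegral_mono fun x => ?_
        have h1 : ∫⁻ t, ‖G (x, t)‖ₑ ^ 2 ∂ν ≤
            liminf (fun j => ∫⁻ t, ‖F j (x, t)‖ₑ ^ 2 ∂ν) atTop := by
          simp_rw [hG]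
          exact lintegral_liminf_le fun j => (hm j).comp measurable_prodMk_left
        refine (ENNReal.rpow_le_rpow h1 hs.le).trans_eq ?_
        exact (ENNReal.orderIsoRpow s hs).liminf_apply
    _ ≤ liminf (fun j => ∫⁻ x, (∫⁻ t, ‖F j (x, t)‖ₑ ^ 2 ∂ν) ^ s ∂μ) atTop :=
        lintegral_liminf_le fun j => (hm j).lintegral_prod_right'.pow_const s
    _ ≤ B := liminf_le_of_le (by isBoundedDefault) fun c hc => by
        obtain ⟨j, hj⟩ := hc.exists
        exact hj.trans (hB j)

theorem ftP_add {n : ℕ} {h₁ h₂ : En n → ℂ} (hh₁ : Integrable h₁) (hh₂ : Integrable h₂) (ξ : En n) :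
    ftP n (fun y => h₁ y + h₂ y) ξ = ftP n h₁ ξ + ftP n h₂ ξ := by
  simp only [ftP, mul_add]
  exact integral_add (integrable_exp_mul hh₁ ξ) (integrable_exp_mul hh₂ ξ)

theorem mulOp_add_right {n : ℕ} {m h₁ h₂ : En n → ℂ} (hm : Continuous m)
    (hmc : HasCompactSupport m) (hh₁ : Integrable h₁) (hh₂ : Integrable h₂) (x : En n) :
    mulOp n m (fun y => h₁ y + h₂ y) x = mulOp n m h₁ x + mulOp n m h₂ x := by
  have hi : ∀ {h : En n → ℂ}, Integrable h → Integrable fun ξ => m ξ * ftP n h ξ := fun hh =>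
    (hm.mul (continuous_ftP hh)).integrable_of_hasCompactSupport hmc.mul_right
  simp only [mulOp, ftP_add hh₁ hh₂, mul_add]
  exact integral_add (integrable_exp_I_mul (hi hh₁) x) (integrable_exp_I_mul (hi hh₂) x)

theorem enorm_mulOp_le {n : ℕ} {m h : En n → ℂ} (hm : Continuous m) (hh : Integrable h)
    (hh2 : MemLp h 2 volume) (x : En n) :
    ‖mulOp n m h x‖ₑ ≤ (∫⁻ ξ, ‖m ξ‖ₑ ^ 2) ^ (1 / 2 : ℝ) *
      (ENNReal.ofReal ((2 * Real.pi) ^ n) * ∫⁻ y, ‖h y‖ₑ ^ 2) ^ (1 / 2 : ℝ) := by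
  rw [← lintegral_enorm_ftP_sq hh hh2]
  have h1 : ‖mulOp n m h x‖ₑ ≤ ∫⁻ ξ, ‖m ξ‖ₑ * ‖ftP n h ξ‖ₑ := by
    refine (enorm_integral_le_lintegral_enorm _).trans_eq (lintegral_congr fun ξ => ?_)
    rw [enorm_mul, enorm_mul, ← ofReal_norm (Complex.exp _), norm_exp_I_mul, ENNReal.ofReal_one,
      one_mul]
  exact h1.trans (lintegral_mul_le_sq hm.measurable.enorm.aemeasurable
    (continuous_ftP hh).measurable.enorm.aemeasurable)

theorem lintegral_enorm_sq_le_mul {n : ℕ} {h : En n → ℂ} (hm : Measurable h) {M : ℝ}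
    (hM : ∀ y, ‖h y‖ ≤ M) : ∫⁻ y, ‖h y‖ₑ ^ 2 ≤ ENNReal.ofReal M * ∫⁻ y, ‖h y‖ₑ := by
  rw [← lintegral_const_mul _ hm.enorm]
  refine lintegral_mono fun y => ?_
  rw [sq, ← ofReal_norm]
  gcongr
  exact hM y

namespace CellSystem

theorem exists_avg_zero_le {n : ℕ} (hn : 0 < n) {g : En n → ℂ} (hg : Integrable g) {l : ℝ}
    (hl : 0 < l) : ∃ Q : CellSystem n, ∀ x, Q.avg g 0 x ≤ l := by
  set N : ℝ := ∫ y, ‖g y‖ with hN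
  have hN0 : 0 ≤ N := integral_nonneg fun _ => norm_nonneg _
  set L : ℝ := 1 + N / l with hL
  have hL1 : 1 ≤ L := le_add_of_nonneg_right (by positivity)
  have hL0 : 0 < L := by linarith
  refine ⟨dyadicCells hn hL0, fun x => ?_⟩
  rw [avg, setAverage_eq, Measure.real, dyadicCells_volume,
    ENNReal.toReal_ofReal (by positivity), smul_eq_mul, inv_mul_le_iff₀ (by positivity)]
  calc ∫ y in (dyadicCells hn hL0).cell 0 x, ‖g y‖ ≤ N :=
        setIntegral_le_integral hg.norm (ae_of_all _ fun _ => norm_nonneg _)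
    _ ≤ L * l := by rw [hL, add_mul, div_mul_cancel₀ _ hl.ne']; linarith
    _ ≤ L ^ n * l := by
        gcongr
        exact le_self_pow₀ hL1 hn.ne'

end CellSystem

theorem lintegral_wave_sum_le {n : ℕ} (hn : 2 ≤ n) {γ p : ℝ} (hγ : 1 < γ) (hp1 : 1 < p)
    (hp2 : p ≤ 2) {d θ : ℝ} (hd : d = γ * n / 2) (hθ : θ = 2 / p - 1) (a b : ℝ) :
    ∃ C : ℝ, 0 ≤ C ∧ ∀ (K : ℕ) (g : En n → ℂ) (M P : ℝ), Integrable g → Continuous g →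
      (∀ x, ‖g x‖ ≤ M) → 0 ≤ P → ∫⁻ x, ‖g x‖ₑ ^ p ≤ ENNReal.ofReal P →
      ∫⁻ x, (∫⁻ t in Icc a b, ‖mulOp n (fun ξ => ∑ i ∈ waveIndices K,
        wavePiece n γ (θ * d / 2) i t ξ) g x‖ₑ ^ 2) ^ (p / 2) ≤ ENNReal.ofReal (C * P) := by
  obtain ⟨C, hC, H⟩ := CellSystem.lintegral_wave_layers_le hn hγ hp1 hp2 hd hθ a b
  refine ⟨C, hC, fun K g M P hg hc hM hP hgP => ?_⟩
  have hs : 0 ≤ θ * d / 2 := by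
    have : 0 ≤ θ := by rw [hθ, sub_nonneg, le_div_iff₀ (by linarith)]; linarith
    rw [hd]
    positivity
  choose hcont r hr using wavePiece_continuous_support (n := n) hγ hs
  set m : ℝ → En n → ℂ := fun t ξ => ∑ i ∈ waveIndices K, wavePiece n γ (θ * d / 2) i t ξ with hm
  have hmc : Continuous (Function.uncurry m) := continuous_finsetSum _ fun i _ => hcont i
  have hms : ∀ t ξ, ∑ i ∈ waveIndices K, |r i| < ‖ξ‖ → m t ξ = 0 := fun t ξ hξ =>
    Finset.sum_eq_zero fun i hi => hr i t ξ <| lt_of_le_of_lt (le_abs_self _) <|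
      lt_of_le_of_lt (Finset.single_le_sum (f := fun i => |r i|) (fun _ _ => abs_nonneg _) hi) hξ
  have hmt : ∀ t, Continuous (m t) := fun t =>
    hmc.comp (by fun_prop : Continuous fun ξ : En n => (t, ξ))
  have hmcs : ∀ t, HasCompactSupport (m t) := fun t => hasCompactSupport_of_norm_le (hms t)
  set l : ℕ → ℝ := fun j => 1 / ((j : ℝ) + 1) with hl
  have hl0 : ∀ j, 0 < l j := fun j => by positivity
  have hlt : Tendsto l atTop (𝓝 0) := tendsto_one_div_add_atTop_nhds_zero_nat
  choose Q hQ using fun j => CellSystem.exists_avg_zero_le (by omega : 0 < n) hg (hl0 j)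
  have hJ : ∀ j, ∃ J : ℕ, M ≤ l j * 2 ^ J := fun j => by
    obtain ⟨J, hJ⟩ := pow_unbounded_of_one_lt (M / l j) (by norm_num : (1 : ℝ) < 2)
    exact ⟨J, by rw [mul_comm]; exact ((div_lt_iff₀ (hl0 j)).1 hJ).le⟩
  choose J hJ using hJ
  have hlay : ∀ j, Integrable fun y => ∑ k ∈ Finset.range (J j), (Q j).layer g (l j * 2 ^ k) y :=
    fun j => integrable_finsetSum _ fun k _ => (Q j).integrable_layer hg hc.measurable _
  have hst : ∀ j, Integrable ((Q j).stopped g (l j)) := fun j =>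
    (Q j).integrable_stopped hg hc.measurable _
  refine lintegral_rpow_lintegral_le_of_tendsto (F := fun j q => mulOp n (m q.2)
    (fun y => ∑ k ∈ Finset.range (J j), (Q j).layer g (l j * 2 ^ k) y) q.1)
    (G := fun q => mulOp n (m q.2) g q.1)
    (fun j => (continuous_mulOp_param hmc hms (hlay j)).measurable) (fun q => ?_)
    (by linarith) fun j => H K (J j) (Q j) g (l j) P hg hc (hl0 j) (hQ j) hP hgP
  have hdec : ∀ j, mulOp n (m q.2) (fun y => ∑ k ∈ Finset.range (J j),
      (Q j).layer g (l j * 2 ^ k) y) q.1 =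
      mulOp n (m q.2) g q.1 - mulOp n (m q.2) ((Q j).stopped g (l j)) q.1 := fun j => by
    have hgj : g = fun y => (Q j).stopped g (l j) y +
        ∑ k ∈ Finset.range (J j), (Q j).layer g (l j * 2 ^ k) y :=
      funext fun y => (Q j).sum_layer hg (fun x => (hM x).trans (hJ j)) y
    have := mulOp_add_right (hmt q.2) (hmcs q.2) (hst j) (hlay j) q.1
    rw [← hgj] at this
    rw [this, add_sub_cancel_left]
  simp_rw [hdec]
  suffices h : Tendsto (fun j => mulOp n (m q.2) ((Q j).stopped g (l j)) q.1) atTop (𝓝 0) by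
    simpa using tendsto_const_nhds.sub h
  rw [tendsto_zero_iff_enorm_tendsto_zero]
  set N : ℝ≥0∞ := (∫⁻ ξ, ‖m q.2 ξ‖ₑ ^ 2) ^ (1 / 2 : ℝ) with hN
  have hNtop : N ≠ ∞ := by
    refine ENNReal.rpow_ne_top_of_nonneg (by norm_num) ?_
    have := (hmt q.2).memLp_of_hasCompactSupport (p := 2) (μ := volume) (hmcs q.2)
    have h2 := lintegral_rpow_enorm_lt_top_of_eLpNorm_lt_top (by norm_num) (by norm_num) this.2
    simpa using h2.ne
  set R : ℝ≥0∞ := ENNReal.ofReal ((2 * Real.pi) ^ n) * ∫⁻ y, ‖g y‖ₑ with hR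
  have hRtop : R ≠ ∞ := ENNReal.mul_ne_top ENNReal.ofReal_ne_top hg.2.ne
  have hlim : Tendsto (fun j => N * (R * ENNReal.ofReal (2 ^ n * l j)) ^ (1 / 2 : ℝ)) atTop
      (𝓝 0) := by
    have h1 : Tendsto (fun j => ENNReal.ofReal (2 ^ n * l j)) atTop (𝓝 0) := by
      have := ENNReal.tendsto_ofReal (hlt.const_mul (2 ^ n))
      simpa using this
    have h2 := ENNReal.Tendsto.const_mul h1 (Or.inr hRtop)
    rw [mul_zero] at h2
    have h3 := (ENNReal.continuous_rpow_const (y := 1 / 2)).tendsto _ |>.comp h2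
    rw [ENNReal.zero_rpow_of_pos (by norm_num)] at h3
    simpa using ENNReal.Tendsto.const_mul h3 (Or.inr hNtop)
  refine tendsto_of_tendsto_of_tendsto_of_le_of_le tendsto_const_nhds hlim (fun _ => zero_le)
    fun j => ?_
  have hb := (Q j).norm_stopped_le hg hc (hl0 j).le (hQ j)
  refine (enorm_mulOp_le (hmt q.2) (hst j) (memLp_two_of_bounded (hst j) hb) q.1).trans ?_
  refine mul_le_mul_right (ENNReal.rpow_le_rpow ?_ (by norm_num)) _
  rw [hR, mul_assoc, mul_comm (∫⁻ y, ‖g y‖ₑ)]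
  refine mul_le_mul_right ((lintegral_enorm_sq_le_mul
    ((Q j).measurable_stopped hc.measurable _) hb).trans ?_) _
  exact mul_le_mul_right ((Q j).lintegral_stopped_le g _) _

theorem integrable_ftP_schwartz {n : ℕ} (g : SchwartzMap (En n) ℂ) :
    Integrable (ftP n fun y => g y) := by
  have h : (ftP n fun y => g y) =
      fun ξ => (FourierTransform.fourier g : SchwartzMap (En n) ℂ) ((2 * Real.pi)⁻¹ • ξ) :=
    funext fun ξ => by rw [ftP_eq_fourier, SchwartzMap.fourier_coe]
  rw [h]
  exact (FourierTransform.fourier g : SchwartzMap (En n) ℂ).integrable.comp_smul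
    (inv_ne_zero (ne_of_gt Real.two_pi_pos))

/-- The Bessel potential of a Schwartz function is a Schwartz function. -/
theorem exists_schwartz_bessel {n : ℕ} (β : ℝ) (f : SchwartzMap (En n) ℂ) :
    ∃ g : SchwartzMap (En n) ℂ,
      (∀ ξ, ftP n (fun y => g y) ξ =
        (((1 + ‖ξ‖ ^ 2) ^ (β / 2) : ℝ) : ℂ) * ftP n (fun y => f y) ξ) ∧
      ∀ x, g x = ((2 * Real.pi) ^ n)⁻¹ • ∫ ξ : En n,
        Complex.exp (Complex.I * ((⟪x, ξ⟫ : ℝ) : ℂ)) *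
          (((1 + ‖ξ‖ ^ 2) ^ (β / 2) : ℝ) : ℂ) * ftP n (fun y => f y) ξ := by
  have h2π : (2 * Real.pi) ≠ 0 := Real.two_pi_pos.ne'
  have hw : (fun η : En n => (1 + ‖(2 * Real.pi) • η‖ ^ 2) ^ (β / 2)).HasTemperateGrowth :=
    (Function.hasTemperateGrowth_one_add_norm_sq_rpow (En n) (β / 2)).comp
      ((2 * Real.pi) • ContinuousLinearMap.id ℝ (En n)).hasTemperateGrowth
  set φ : SchwartzMap (En n) ℂ := SchwartzMap.smulLeftCLM ℂ
    (fun η : En n => (1 + ‖(2 * Real.pi) • η‖ ^ 2) ^ (β / 2)) (FourierTransform.fourier f) with hφ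
  have hφη : ∀ η, φ η = (((1 + ‖(2 * Real.pi) • η‖ ^ 2) ^ (β / 2) : ℝ) : ℂ) *
      ftP n (fun y => f y) ((2 * Real.pi) • η) := fun η => by
    rw [hφ, SchwartzMap.smulLeftCLM_apply_apply hw, ftP_eq_fourier, inv_smul_smul₀ h2π,
      SchwartzMap.fourier_coe, Complex.real_smul]
  refine ⟨FourierTransformInv.fourierInv φ, fun ξ => ?_, fun x => ?_⟩
  · rw [ftP_eq_fourier, ← SchwartzMap.fourier_coe, FourierTransform.fourier_fourierInv_eq, hφη,
      smul_inv_smul₀ h2π]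
  · rw [SchwartzMap.fourierInv_coe, Real.fourierInv_eq']
    set H : En n → ℂ := fun ξ => Complex.exp (Complex.I * ((⟪x, ξ⟫ : ℝ) : ℂ)) *
      (((1 + ‖ξ‖ ^ 2) ^ (β / 2) : ℝ) : ℂ) * ftP n (fun y => f y) ξ with hH
    have := Measure.integral_comp_smul volume H (2 * Real.pi)
    rw [finrank_euclideanSpace_fin, abs_of_pos (by positivity)] at this
    rw [← this]
    refine integral_congr_ae (ae_of_all _ fun η => ?_)
    simp only [hH, smul_eq_mul]
    rw [hφη, ← mul_assoc]
    congr 3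
    rw [inner_smul_right, real_inner_comm, mul_comm]

theorem tendsto_mulOp_wavePiece {n : ℕ} (hn : 0 < n) {γ d θ : ℝ} (hγ : 1 < γ) (hd : 0 ≤ d)
    (hθ : 0 ≤ θ) {g : En n → ℂ} (hg : Integrable g) (hgi : Integrable (ftP n g)) (x : En n)
    (t : ℝ) :
    Tendsto (fun K => mulOp n (fun ξ => ∑ i ∈ waveIndices K, wavePiece n γ (θ * d / 2) i t ξ) g x)
      atTop (𝓝 (mulOp n (fun ξ => (((1 + ‖ξ‖ ^ 2) ^ (-(θ * d / 2)) : ℝ) : ℂ) *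
        Complex.exp (Complex.I * ((t * ‖ξ‖ ^ γ : ℝ) : ℂ))) g x)) := by
  have : Nonempty (Fin n) := ⟨⟨0, hn⟩⟩
  have hs : 0 ≤ θ * d / 2 := by positivity
  have hc : ∀ i, Continuous (wavePiece n γ (θ * d / 2) i t) := fun i =>
    (wavePiece_continuous_support (n := n) hγ hs i).1.comp
      (by fun_prop : Continuous fun ξ : En n => (t, ξ))
  have hb : ∀ K ξ, ‖∑ i ∈ waveIndices K, wavePiece n γ (θ * d / 2) i t ξ‖ ≤ 2 ^ (d * θ) + 3 :=
    fun K ξ => by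
      refine (norm_sum_le _ _).trans (le_trans (Finset.sum_le_sum fun i _ => ?_)
        (sum_norm_wavePiece_le (n := n) (γ := γ) hd hθ K t ξ))
      refine le_mul_of_one_le_left (norm_nonneg _) (Real.one_le_rpow (by norm_num) ?_)
      refine mul_nonneg ?_ hθ
      rcases i with k | i
      · exact mul_nonneg (by positivity) hd
      · exact le_rfl
  refine tendsto_integral_of_dominated_convergence
    (fun ξ => (2 ^ (d * θ) + 3) * ‖ftP n g ξ‖) (fun K => ?_) (hgi.norm.const_mul _)
    (fun K => ae_of_all _ fun ξ => ?_) ?_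
  · have h1 : Continuous fun ξ => ∑ i ∈ waveIndices K, wavePiece n γ (θ * d / 2) i t ξ :=
      continuous_finsetSum _ fun i _ => hc i
    have h2 := continuous_ftP hg
    exact Continuous.aestronglyMeasurable (by fun_prop)
  · rw [norm_mul, norm_exp_I_mul, one_mul, norm_mul]
    gcongr
    exact hb K ξ
  · have h0 : ∀ᵐ ξ : En n, ξ ≠ 0 := by
      simp [ae_iff]
    filter_upwards [h0] with ξ hξ
    refine Tendsto.congr' ?_ tendsto_const_nhds
    filter_upwards [sum_wavePiece_eventually (γ := γ) (s := θ * d / 2) t hξ] with K hK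
    rw [hK]

theorem waveExt_eq_mulOp {n : ℕ} {γ s : ℝ} {f g : En n → ℂ}
    (h : ∀ ξ, ftP n g ξ = (((1 + ‖ξ‖ ^ 2) ^ s : ℝ) : ℂ) * ftP n f ξ) (x : En n) (t : ℝ) :
    waveExt n γ f x t = mulOp n (fun ξ => (((1 + ‖ξ‖ ^ 2) ^ (-s) : ℝ) : ℂ) *
        Complex.exp (Complex.I * ((t * ‖ξ‖ ^ γ : ℝ) : ℂ))) g x := by
  refine integral_congr_ae (ae_of_all _ fun ξ => ?_)
  have h1 : (((1 + ‖ξ‖ ^ 2) ^ (-s) : ℝ) : ℂ) * (((1 + ‖ξ‖ ^ 2) ^ s : ℝ) : ℂ) = 1 := by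
    rw [← Complex.ofReal_mul, ← Real.rpow_add (by positivity), neg_add_cancel, Real.rpow_zero,
      Complex.ofReal_one]
  simp only [h, mul_add, Complex.exp_add, Complex.ofReal_mul]
  linear_combination -(Complex.exp (Complex.I * ((⟪x, ξ⟫ : ℝ) : ℂ)) *
    Complex.exp (Complex.I * ((t : ℂ) * ((‖ξ‖ ^ γ : ℝ) : ℂ))) * ftP n f ξ) * h1

theorem lintegral_wave_le {n : ℕ} (hn : 2 ≤ n) {γ p : ℝ} (hγ : 1 < γ) (hp1 : 1 < p)
    (hp2 : p ≤ 2) {d θ : ℝ} (hd : d = γ * n / 2) (hθ : θ = 2 / p - 1) (a b : ℝ) :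
    ∃ C : ℝ, 0 ≤ C ∧ ∀ g : SchwartzMap (En n) ℂ,
      ∫⁻ x, (∫⁻ t in Icc a b, ‖mulOp n (fun ξ => (((1 + ‖ξ‖ ^ 2) ^ (-(θ * d / 2)) : ℝ) : ℂ) *
        Complex.exp (Complex.I * ((t * ‖ξ‖ ^ γ : ℝ) : ℂ))) g x‖ₑ ^ 2) ^ (p / 2) ≤
        ENNReal.ofReal C * ∫⁻ x, ‖g x‖ₑ ^ p := by
  obtain ⟨C, hC, H⟩ := lintegral_wave_sum_le hn hγ hp1 hp2 hd hθ a b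
  have hθ0 : 0 ≤ θ := by rw [hθ, sub_nonneg, le_div_iff₀ (by linarith)]; linarith
  have hd0 : 0 ≤ d := by rw [hd]; positivity
  refine ⟨C, hC, fun g => ?_⟩
  obtain ⟨M, hM⟩ : ∃ M, ∀ x, ‖g x‖ ≤ M :=
    ⟨‖g.toBoundedContinuousFunction‖, g.toBoundedContinuousFunction.norm_coe_le_norm⟩
  have hfin : ∫⁻ x, ‖g x‖ₑ ^ p ≠ ∞ := by
    have h := lintegral_rpow_enorm_lt_top_of_eLpNorm_lt_top (p := ENNReal.ofReal p)
      (by simp; linarith) ENNReal.ofReal_ne_top (g.memLp (ENNReal.ofReal p) volume).2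
    rw [ENNReal.toReal_ofReal (by linarith)] at h
    exact h.ne
  set P : ℝ := (∫⁻ x, ‖g x‖ₑ ^ p).toReal with hP
  have hPe : ∫⁻ x, ‖g x‖ₑ ^ p = ENNReal.ofReal P := (ENNReal.ofReal_toReal hfin).symm
  rw [hPe, ← ENNReal.ofReal_mul hC]
  choose hcont r hr using wavePiece_continuous_support (n := n) hγ (s := θ * d / 2) (by positivity)
  refine lintegral_rpow_lintegral_le_of_tendsto (F := fun K q => mulOp n (fun ξ =>
    ∑ i ∈ waveIndices K, wavePiece n γ (θ * d / 2) i q.2 ξ) g q.1)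
    (G := fun q => mulOp n (fun ξ => (((1 + ‖ξ‖ ^ 2) ^ (-(θ * d / 2)) : ℝ) : ℂ) *
        Complex.exp (Complex.I * ((q.2 * ‖ξ‖ ^ γ : ℝ) : ℂ))) g q.1) (fun K => ?_)
    (fun q => tendsto_mulOp_wavePiece (by omega) hγ hd0 hθ0 g.integrable
      (integrable_ftP_schwartz g) q.1 q.2) (by linarith)
    fun K => H K g M P g.integrable g.continuous hM ENNReal.toReal_nonneg hPe.le
  refine (continuous_mulOp_param (m := fun t ξ => ∑ i ∈ waveIndices K,
    wavePiece n γ (θ * d / 2) i t ξ) (r := ∑ i ∈ waveIndices K, |r i|)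
    (continuous_finsetSum _ fun i _ => hcont i) (fun t ξ hξ => ?_) g.integrable).measurable
  exact Finset.sum_eq_zero fun i hi => hr i t ξ <| lt_of_le_of_lt (le_abs_self _) <|
    lt_of_le_of_lt (Finset.single_le_sum (f := fun i => |r i|) (fun _ _ => abs_nonneg _) hi) hξ

theorem statement11 (n : ℕ) (hn : 2 ≤ n) (p lam : ℝ) (hp1 : 1 < p) (hp2 : p ≤ 2)
    (hlam : 1 < lam) (a b : ℝ) (β : ℝ) (hβ : β / lam = n * (1 / p - 1 / 2)) :
    ∃ C : ℝ≥0, ∀ f : SchwartzMap (En n) ℂ,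
      (∫⁻ x : En n,
          ((∫⁻ t in Set.Icc a b,
              (‖waveExt n lam (fun y => f y) x t‖₊ : ℝ≥0∞) ^ 2) ^ ((1 : ℝ) / 2)) ^ p) ^ (1 / p) ≤
        C * besselNorm n β p (fun y => f y) := by
  have hp0 : 0 < p := by linarith
  obtain ⟨C, hC, H⟩ := lintegral_wave_le hn hlam hp1 hp2 rfl rfl a b
  have hβs : (2 / p - 1) * (lam * n / 2) / 2 = β / 2 := by
    rw [div_eq_iff (by linarith)] at hβ
    rw [hβ]
    ring
  refine ⟨(C ^ (1 / p)).toNNReal, fun f => ?_⟩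
  obtain ⟨g, hgft, hg⟩ := exists_schwartz_bessel β f
  have hnorm : besselNorm n β p (fun y => f y) = (∫⁻ x, ‖g x‖ₑ ^ p) ^ (1 / p) := by
    rw [besselNorm, eLpNorm_eq_lintegral_rpow_enorm_toReal (by simpa using hp0)
      ENNReal.ofReal_ne_top, ENNReal.toReal_ofReal hp0.le]
    simp_rw [← hg]
  have hpow : ∀ y : ℝ≥0∞, (y ^ ((1 : ℝ) / 2)) ^ p = y ^ (p / 2) := fun y => by
    rw [← ENNReal.rpow_mul]
    congr 1
    ring
  have h := H g
  rw [hβs] at h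
  simp_rw [← waveExt_eq_mulOp hgft] at h
  simp_rw [hpow]
  rw [hnorm, ← ENNReal.ofReal, ← ENNReal.ofReal_rpow_of_nonneg hC (by positivity),
    ← ENNReal.mul_rpow_of_nonneg _ _ (by positivity)]
  exact ENNReal.rpow_le_rpow h (by positivity)

end
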